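/- Among the 298 combinatorially inequivalent orientation-reversing gluing patterns of the faces of the octahedron, consider the 9 patterns whose non-sphere vertex-link data consists of two tori (two vertex classes have links of Euler characteristic 0 and all other vertex links are 2-spheres). The corresponding quotient spaces X(φ) fall into exactly 7 homeomorphism classes. -/

import Mathlib

/-! Combinatorial model of the octahedron and of orientation-reversing gluing
patterns of its faces, following Heard–Pervova–Petronio. -/

/-- Vertices of the octahedron `±e_i`, encoded as a pair (axis, sign). -/
abbrev OctVertex : Type := Fin 3 × Bool

/-- Faces of the octahedron: a choice of a sign for each coordinate axis;
the face `F` has vertex set `{(i, F i) : i ∈ Fin 3}`. -/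
abbrev OctFace : Type := Fin 3 → Bool

/-- The parity of a face.  The cyclic order (axis 0, axis 1, axis 2) of the vertices of
a face `F` agrees with the cyclic order induced by the outward orientation of the
boundary of the solid octahedron if and only if `faceSign F = true`. -/
def faceSign (F : OctFace) : Bool := Bool.xor (F 0) (Bool.xor (F 1) (F 2))

/-- `IsGluing σ π` says that the fixed-point-free involution `σ` of the set of faces,
together with the face identifications `π` (the bijection `φ_F` from the vertices of `F`
to those of `σ F` sends the vertex of `F` on axis `i` to the vertex of `σ F` on axis
`π F i`), is an orientation-reversing gluing pattern: `φ_{σ F} = φ_F⁻¹` and every `φ_F`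
reverses the cyclic orderings induced by the boundary orientation (a bijection
`F → σ F` given by `π` reverses them iff `sign (π) · faceSign F · faceSign (σ F) = -1`). -/
def IsGluing (σ : Equiv.Perm OctFace) (π : OctFace → Equiv.Perm (Fin 3)) : Prop :=
  (∀ F, σ (σ F) = F) ∧ (∀ F, σ F ≠ F) ∧ (∀ F, π (σ F) = (π F)⁻¹) ∧
    (∀ F, Equiv.Perm.sign (π F) = 1 ↔ faceSign F ≠ faceSign (σ F))

instance : DecidablePred fun p : Equiv.Perm OctFace × (OctFace → Equiv.Perm (Fin 3)) =>
    IsGluing p.1 p.2 := fun p => by unfold IsGluing; infer_instance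

/-- An orientation-reversing gluing pattern of the faces of the octahedron. -/
abbrev Gluing : Type :=
  {p : Equiv.Perm OctFace × (OctFace → Equiv.Perm (Fin 3)) // IsGluing p.1 p.2}

/-- The involution on faces underlying a gluing pattern. -/
def Gluing.face (g : Gluing) : Equiv.Perm OctFace := g.1.1

/-- The face identifications of a gluing pattern, as permutations of the axes. -/
def Gluing.axisMap (g : Gluing) : OctFace → Equiv.Perm (Fin 3) := g.1.2

/-- The action of the symmetry of the octahedron given by the signed axis permutation
`(ρ, ε)` (sending the vertex `(i, b)` to `(ρ i, xor b (ε i))`) on faces. -/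
def symMapFace (ρ : Equiv.Perm (Fin 3)) (ε : Fin 3 → Bool) (F : OctFace) : OctFace :=
  fun j => Bool.xor (F (ρ⁻¹ j)) (ε (ρ⁻¹ j))

/-- Two gluing patterns are combinatorially equivalent if some symmetry of the
octahedron conjugates one into the other. -/
def EquivGluing (g h : Gluing) : Prop :=
  ∃ (ρ : Equiv.Perm (Fin 3)) (ε : Fin 3 → Bool),
    (∀ F, h.face (symMapFace ρ ε F) = symMapFace ρ ε (g.face F)) ∧
    (∀ F, h.axisMap (symMapFace ρ ε F) = ρ * g.axisMap F * ρ⁻¹)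

/-- The combinatorial equivalence class (orbit under the symmetry group) of a gluing. -/
def orbit (g : Gluing) : Set Gluing := {h | EquivGluing g h}

/-- The identifications induced by a gluing pattern on the vertices of the octahedron:
the vertex of `F` on axis `i` is glued to the corresponding vertex of `face F`. -/
def vtxRel (g : Gluing) (v w : OctVertex) : Prop :=
  ∃ (F : OctFace) (i : Fin 3),
    v = (i, F i) ∧ w = (g.axisMap F i, g.face F (g.axisMap F i))

/-- The equivalence relation on vertices generated by the face identifications. -/
def vtxSetoid (g : Gluing) : Setoid OctVertex := Relation.EqvGen.setoid (vtxRel g)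

/-- The number of vertex classes of a gluing pattern. -/
noncomputable def vtxCount (g : Gluing) : ℕ := Nat.card (Quotient (vtxSetoid g))

/-- An edge-end (corner) of the octahedron: an ordered pair of vertices lying on
distinct axes; it represents the edge between them together with the choice of the
first vertex as its endpoint.  Edge-ends correspond to the corners of the
quadrilateral vertex links. -/
abbrev EdgeEnd : Type := {p : OctVertex × OctVertex // p.1.1 ≠ p.2.1}

/-- The identifications induced by a gluing pattern on edge-ends: an edge-end contained
in the face `F` is glued to the corresponding edge-end of `face F`. -/
def endRel (g : Gluing) (p q : EdgeEnd) : Prop :=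
  ∃ (F : OctFace) (i j : Fin 3), i ≠ j ∧ p.1 = ((i, F i), (j, F j)) ∧
    q.1 = ((g.axisMap F i, g.face F (g.axisMap F i)),
           (g.axisMap F j, g.face F (g.axisMap F j)))

/-- The equivalence relation on edge-ends generated by the face identifications.
Its classes are the vertices of the quadrangulated link surfaces of the vertex
classes. -/
def endSetoid (g : Gluing) : Setoid EdgeEnd := Relation.EqvGen.setoid (endRel g)

/-- The relation on edge-ends generating the edge identifications: face identifications
together with forgetting the choice of endpoint. -/
def edgeRel (g : Gluing) (p q : EdgeEnd) : Prop :=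
  endRel g p q ∨ q.1 = (p.1.2, p.1.1)

/-- The equivalence relation whose classes are the edge classes of a gluing pattern. -/
def edgeSetoid (g : Gluing) : Setoid EdgeEnd := Relation.EqvGen.setoid (edgeRel g)

/-- The number of edge classes of a gluing pattern. -/
noncomputable def edgeCount (g : Gluing) : ℕ := Nat.card (Quotient (edgeSetoid g))

/-- The number of vertices of the octahedron lying in the vertex class `c`; this is
the number of quadrilaterals tiling the link surface of `c`. -/
noncomputable def classSize (g : Gluing) (c : Quotient (vtxSetoid g)) : ℕ :=
  Nat.card {v : OctVertex // Quotient.mk (vtxSetoid g) v = c}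

/-- The number of vertices of the quadrangulated link surface of the vertex class `c`:
the number of classes of edge-ends whose endpoint lies in `c`. -/
noncomputable def cornerCount (g : Gluing) (c : Quotient (vtxSetoid g)) : ℕ :=
  Nat.card {q : Quotient (endSetoid g) //
    ∃ p : EdgeEnd, Quotient.mk (endSetoid g) p = q ∧ Quotient.mk (vtxSetoid g) p.1.1 = c}

/-- The Euler characteristic of the link surface of the vertex class `c`: the link is
tiled by `classSize g c` quadrilaterals, with `2 * classSize g c` edges and
`cornerCount g c` vertices, so `χ = cornerCount - 2 * classSize + classSize`. -/
noncomputable def linkChi (g : Gluing) (c : Quotient (vtxSetoid g)) : ℤ :=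
  (cornerCount g c : ℤ) - (classSize g c : ℤ)

/-- All vertex links are 2-spheres: the quotient space is a closed manifold. -/
def AllLinksSphere (g : Gluing) : Prop := ∀ c, linkChi g c = 2

/-- The non-sphere vertex-link data consists of a single torus. -/
def LinksOneTorus (g : Gluing) : Prop :=
  (∀ c, linkChi g c = 2 ∨ linkChi g c = 0) ∧
    Nat.card {c : Quotient (vtxSetoid g) // linkChi g c = 0} = 1

/-- The non-sphere vertex-link data consists of two tori. -/
def LinksTwoTori (g : Gluing) : Prop :=
  (∀ c, linkChi g c = 2 ∨ linkChi g c = 0) ∧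
    Nat.card {c : Quotient (vtxSetoid g) // linkChi g c = 0} = 2

/-- The non-sphere vertex-link data consists of a single genus-2 surface. -/
def LinksGenusTwo (g : Gluing) : Prop :=
  (∀ c, linkChi g c = 2 ∨ linkChi g c = -2) ∧
    Nat.card {c : Quotient (vtxSetoid g) // linkChi g c = -2} = 1

/-- The non-sphere vertex-link data consists of one genus-2 surface and one torus. -/
def LinksGenusTwoTorus (g : Gluing) : Prop :=
  (∀ c, linkChi g c = 2 ∨ linkChi g c = 0 ∨ linkChi g c = -2) ∧
    Nat.card {c : Quotient (vtxSetoid g) // linkChi g c = 0} = 1 ∧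
    Nat.card {c : Quotient (vtxSetoid g) // linkChi g c = -2} = 1

/-- The non-sphere vertex-link data consists of a single genus-3 surface. -/
def LinksGenusThree (g : Gluing) : Prop :=
  (∀ c, linkChi g c = 2 ∨ linkChi g c = -4) ∧
    Nat.card {c : Quotient (vtxSetoid g) // linkChi g c = -4} = 1

/-! The geometric realization: the solid octahedron in `ℝ³` and the quotient
space `X(φ)` of a gluing pattern `φ`. -/

/-- The point `±e_i` of `ℝ³` corresponding to a vertex of the octahedron. -/
def vertexPt (v : OctVertex) : Fin 3 → ℝ :=
  fun j => if j = v.1 then (if v.2 then 1 else -1) else 0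

/-- The solid octahedron: the convex hull of `{±e₁, ±e₂, ±e₃}` in `ℝ³`. -/
def SolidOcta : Set (Fin 3 → ℝ) := convexHull ℝ (Set.range vertexPt)

theorem vertexPt_mem_solidOcta (v : OctVertex) : vertexPt v ∈ SolidOcta :=
  subset_convexHull ℝ _ (Set.mem_range_self v)

/-- The gluing relation on the solid octahedron: the point of the closed triangular face
of `F` with barycentric coordinates `w` is glued to the point of the face of
`face F` with the corresponding barycentric coordinates, i.e. the faces
are identified via the affine extensions of the combinatorial identifications. -/
def glueRel (g : Gluing) (x y : SolidOcta) : Prop :=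
  ∃ (F : OctFace) (w : Fin 3 → ℝ), (∀ i, 0 ≤ w i) ∧ (∑ i, w i) = 1 ∧
    (x : Fin 3 → ℝ) = ∑ i, w i • vertexPt (i, F i) ∧
    (y : Fin 3 → ℝ) = ∑ i, w i • vertexPt (g.axisMap F i, g.face F (g.axisMap F i))

/-- The equivalence relation on the solid octahedron generated by the affine face
identifications of a gluing pattern. -/
def glueSetoid (g : Gluing) : Setoid SolidOcta := Relation.EqvGen.setoid (glueRel g)

/-- The quotient space `X(φ)` of the solid octahedron by the gluing pattern `φ`,
with the quotient topology. -/
abbrev XSpace (g : Gluing) : Type := Quotient (glueSetoid g)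

namespace OctaGlue

/-- `A` carries a primitive of the local structure `h`. -/
def Triv {E G : Type} [TopologicalSpace E] [Group G] (h : E → E → G) (A : Set E) : Prop :=
  ∃ k : E → G, ∀ x ∈ A, ∃ c : G, ∀ᶠ a in nhdsWithin x A, h x a = c * k a

/-- local structure on `D`. -/
def LocOn {E G : Type} [TopologicalSpace E] [Group G] (h : E → E → G) (D : Set E) : Prop :=
  ∀ y ∈ D, ∀ᶠ z in nhdsWithin y D, ∃ c : G, ∀ᶠ a in nhdsWithin z D, h z a = c * h y a

section gen
variable {E G : Type} [TopologicalSpace E] [Group G]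

/-- A locally constant function on a preconnected set is constant. -/
theorem const_of_loc {α : Type} {A : Set E} (hA : IsPreconnected A) (f : E → α)
    (hf : ∀ x ∈ A, ∀ᶠ a in nhdsWithin x A, f a = f x) : ∀ x ∈ A, ∀ y ∈ A, f x = f y := by
  intro x hx y hy
  let _ : TopologicalSpace α := ⊥
  have : DiscreteTopology α := ⟨rfl⟩
  have hc : ContinuousOn f A := by
    intro z hz
    have : Filter.Tendsto f (nhdsWithin z A) (pure (f z)) := by
      rw [Filter.tendsto_pure]; exact hf z hz
    exact this.mono_right (pure_le_nhds _)
  exact hA.constant hc hx hy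

theorem Triv.mono {h : E → E → G} {A B : Set E} (hB : Triv h B) (hAB : A ⊆ B) : Triv h A := by
  obtain ⟨k, hk⟩ := hB
  refine ⟨k, fun x hx => ?_⟩
  obtain ⟨c, hc⟩ := hk x (hAB hx)
  exact ⟨c, hc.filter_mono (nhdsWithin_mono x hAB)⟩

theorem prim_ratio {h : E → E → G} {A B : Set E} {kA kB : E → G}
    (hA : ∀ x ∈ A, ∃ c : G, ∀ᶠ a in nhdsWithin x A, h x a = c * kA a)
    (hB : ∀ x ∈ B, ∃ c : G, ∀ᶠ a in nhdsWithin x B, h x a = c * kB a)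
    (hpre : IsPreconnected (A ∩ B)) :
    ∃ d : G, ∀ x ∈ A ∩ B, kA x = d * kB x := by
  have key : ∀ x ∈ A ∩ B, ∀ᶠ a in nhdsWithin x (A ∩ B),
      kA a * (kB a)⁻¹ = kA x * (kB x)⁻¹ := by
    intro x hx
    obtain ⟨c, hc⟩ := hA x hx.1
    obtain ⟨c', hc'⟩ := hB x hx.2
    have e1 := hc.self_of_nhdsWithin hx.1
    have e2 := hc'.self_of_nhdsWithin hx.2
    have f1 := hc.filter_mono (nhdsWithin_mono x (Set.inter_subset_left : A ∩ B ⊆ A))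
    have f2 := hc'.filter_mono (nhdsWithin_mono x (Set.inter_subset_right : A ∩ B ⊆ B))
    filter_upwards [f1, f2] with a h1 h2
    have hx1 : kA x = c⁻¹ * h x x := by rw [e1]; group
    have hx2 : kB x = c'⁻¹ * h x x := by rw [e2]; group
    have ha1 : kA a = c⁻¹ * h x a := by rw [h1]; group
    have ha2 : kB a = c'⁻¹ * h x a := by rw [h2]; group
    rw [hx1, hx2, ha1, ha2]; group
  have hcst := const_of_loc hpre (fun a => kA a * (kB a)⁻¹) key
  by_cases hne : (A ∩ B).Nonempty
  · obtain ⟨x0, hx0⟩ := hne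
    refine ⟨kA x0 * (kB x0)⁻¹, fun x hx => ?_⟩
    have e : kA x * (kB x)⁻¹ = kA x0 * (kB x0)⁻¹ := hcst x hx x0 hx0
    rw [← e]; group
  · exact ⟨1, fun x hx => absurd ⟨x, hx⟩ hne⟩

/-- Gluing lemma for primitives. -/
theorem Triv.union {h : E → E → G} {A B : Set E} (hA : Triv h A) (hB : Triv h B)
    (hpre : IsPreconnected (A ∩ B))
    (h1 : ∀ x ∈ A, x ∉ B → A ∈ nhdsWithin x (A ∪ B))
    (h2 : ∀ x ∈ B, x ∉ A → B ∈ nhdsWithin x (A ∪ B)) : Triv h (A ∪ B) := by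
  classical
  obtain ⟨kA, hkA⟩ := hA
  obtain ⟨kB, hkB⟩ := hB
  obtain ⟨d, hd⟩ := prim_ratio hkA hkB hpre
  set k : E → G := fun a => if a ∈ A then kA a else d * kB a with hk
  have kA' : ∀ a ∈ A, k a = kA a := fun a ha => by simp [hk, ha]
  have kB' : ∀ a ∈ B, k a = d * kB a := by
    intro a ha
    by_cases haA : a ∈ A
    · rw [kA' a haA, hd a ⟨haA, ha⟩]
    · simp [hk, haA]
  have PA : ∀ x ∈ A, ∃ c : G, ∀ᶠ a in nhdsWithin x A, h x a = c * k a := by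
    intro x hx
    obtain ⟨c, hc⟩ := hkA x hx
    refine ⟨c, ?_⟩
    filter_upwards [hc, self_mem_nhdsWithin] with a ha haA
    rw [ha, kA' a haA]
  have PB : ∀ x ∈ B, ∃ c : G, ∀ᶠ a in nhdsWithin x B, h x a = c * k a := by
    intro x hx
    obtain ⟨c, hc⟩ := hkB x hx
    refine ⟨c * d⁻¹, ?_⟩
    filter_upwards [hc, self_mem_nhdsWithin] with a ha haB
    rw [ha, kB' a haB]; group
  refine ⟨k, fun x hx => ?_⟩
  by_cases hxA : x ∈ A
  · by_cases hxB : x ∈ B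
    · obtain ⟨c, hc⟩ := PA x hxA
      obtain ⟨c', hc'⟩ := PB x hxB
      have e1 := hc.self_of_nhdsWithin hxA
      have e2 := hc'.self_of_nhdsWithin hxB
      have : c = c' := by
        rw [e1] at e2; exact mul_right_cancel e2
      subst this
      refine ⟨c, ?_⟩
      rw [nhdsWithin_union]
      exact Filter.eventually_sup.2 ⟨hc, hc'⟩
    · obtain ⟨c, hc⟩ := PA x hxA
      refine ⟨c, hc.filter_mono ?_⟩
      exact nhdsWithin_le_of_mem (h1 x hxA hxB)
  · have hxB : x ∈ B := hx.resolve_left hxA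
    obtain ⟨c, hc⟩ := PB x hxB
    refine ⟨c, hc.filter_mono ?_⟩
    exact nhdsWithin_le_of_mem (h2 x hxB hxA)

theorem Triv.union_of_isClosed {h : E → E → G} {A B : Set E} (hA : Triv h A) (hB : Triv h B)
    (hpre : IsPreconnected (A ∩ B)) (cA : IsClosed A) (cB : IsClosed B) : Triv h (A ∪ B) := by
  refine hA.union hB hpre ?_ ?_
  · intro x _ hxB
    have : Bᶜ ∈ nhds x := cB.isOpen_compl.mem_nhds hxB
    refine Filter.mem_of_superset (inter_mem_nhdsWithin (A ∪ B) this) ?_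
    rintro y ⟨h1 | h1, h2⟩
    · exact h1
    · exact absurd h1 h2
  · intro x _ hxB
    have : Aᶜ ∈ nhds x := cA.isOpen_compl.mem_nhds hxB
    refine Filter.mem_of_superset (inter_mem_nhdsWithin (A ∪ B) this) ?_
    rintro y ⟨h1 | h1, h2⟩
    · exact absurd h1 h2
    · exact h1

/-- relatively open version -/
theorem Triv.union_of_relOpen {h : E → E → G} {A B : Set E} (hA : Triv h A) (hB : Triv h B)
    (hpre : IsPreconnected (A ∩ B)) (cA : ∀ x ∈ A, A ∈ nhdsWithin x (A ∪ B))
    (cB : ∀ x ∈ B, B ∈ nhdsWithin x (A ∪ B)) : Triv h (A ∪ B) :=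
  hA.union hB hpre (fun x hx _ => cA x hx) (fun x hx _ => cB x hx)

theorem LocOn.triv_nhds {h : E → E → G} {D : Set E} (hD : LocOn h D) {y : E} (hy : y ∈ D) :
    ∃ U, IsOpen U ∧ y ∈ U ∧ Triv h (U ∩ D) := by
  have := hD y hy
  rw [eventually_nhdsWithin_iff, eventually_nhds_iff] at this
  obtain ⟨U, hU, hUo, hyU⟩ := this
  refine ⟨U, hUo, hyU, h y, fun x hx => ?_⟩
  obtain ⟨c, hc⟩ := hU x hx.1 hx.2
  exact ⟨c, hc.filter_mono (nhdsWithin_mono x Set.inter_subset_right)⟩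

end gen

section boxes
variable {G : Type} [Group G]

/-- Local structures are trivial on compact convex sets. -/
theorem triv_compact_convex {h : (Fin 3 → ℝ) → (Fin 3 → ℝ) → G} {D K : Set (Fin 3 → ℝ)}
    (hD : LocOn h D) (hK : IsCompact K) (hKc : Convex ℝ K) (hKD : K ⊆ D) : Triv h K := by
  classical
  -- Lebesgue number
  choose! U hUo hUy hUT using fun (y : Fin 3 → ℝ) (hy : y ∈ D) => hD.triv_nhds hy
  obtain ⟨δ, hδ, hleb⟩ := lebesgue_number_lemma_of_metric (s := K) (c := fun y : K => U y) hK
    (fun y => hUo y (hKD y.2)) (fun y hy => Set.mem_iUnion.2 ⟨⟨y, hy⟩, hUy y (hKD hy)⟩)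
  have hKcl : IsClosed K := hK.isClosed
  have main : ∀ n : ℕ, ∀ m : Fin 3 → ℕ, ∑ i, m i = n → ∀ l u : Fin 3 → ℝ,
      (∀ i, u i - l i ≤ δ / 2 * 2 ^ m i) → Triv h (K ∩ Set.Icc l u) := by
    intro n
    induction n with
    | zero =>
      intro m hm l u hlu
      have hm0 : ∀ i, m i = 0 := by
        intro i
        have := (Finset.sum_eq_zero_iff.1 hm) i (Finset.mem_univ i)
        exact this
      by_cases hne : (K ∩ Set.Icc l u).Nonempty
      · obtain ⟨x, hxK, hx⟩ := hne
        obtain ⟨y, hy⟩ := hleb x hxK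
        refine (hUT y (hKD y.2)).mono ?_
        rintro z ⟨hzK, hz⟩
        refine ⟨hy ?_, hKD hzK⟩
        rw [Metric.mem_ball, dist_pi_lt_iff hδ]
        intro i
        have h1 := hlu i
        rw [hm0 i] at h1
        rw [Real.dist_eq, abs_lt]
        have := hx.1 i; have := hx.2 i; have := hz.1 i; have := hz.2 i
        constructor <;> linarith
      · rw [Set.not_nonempty_iff_eq_empty] at hne
        rw [hne]
        exact ⟨fun _ => 1, fun x hx => absurd hx (Set.notMem_empty x)⟩
    | succ n ih =>
      intro m hm l u hlu
      have : ∃ i, m i ≠ 0 := by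
        by_contra hcon
        push Not at hcon
        simp [hcon] at hm
      obtain ⟨i, hi⟩ := this
      set m' := Function.update m i (m i - 1) with hm'
      have hs : ∑ j, m' j = n := by
        have e1 := Finset.sum_update_of_mem (Finset.mem_univ i) m (m i - 1)
        have e2 := Finset.add_sum_erase Finset.univ m (Finset.mem_univ i)
        rw [← hm'] at e1
        rw [Finset.sdiff_singleton_eq_erase] at e1
        omega
      set c := (l i + u i) / 2 with hc
      have hpow : (2:ℝ) ^ m i = 2 * 2 ^ (m i - 1) := by
        rw [← pow_succ', Nat.sub_add_cancel (Nat.one_le_iff_ne_zero.2 hi)]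
      have hmi : m' i = m i - 1 := by simp [hm']
      have hmj : ∀ j, j ≠ i → m' j = m j := fun j hj => by simp [hm', hj]
      have T1 : Triv h (K ∩ Set.Icc l (Function.update u i c)) := by
        refine ih m' hs _ _ fun j => ?_
        by_cases hj : j = i
        · subst hj
          have := hlu j
          rw [hpow] at this
          rw [hmi]; simp only [Function.update_self, hc]; linarith
        · rw [hmj j hj]; simp only [Function.update_of_ne hj]; exact hlu j
      have T2 : Triv h (K ∩ Set.Icc (Function.update l i c) u) := by
        refine ih m' hs _ _ fun j => ?_
        by_cases hj : j = i
        · subst hj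
          have := hlu j
          rw [hpow] at this
          rw [hmi]; simp only [Function.update_self, hc]; linarith
        · rw [hmj j hj]; simp only [Function.update_of_ne hj]; exact hlu j
      by_cases hli : l i ≤ u i
      swap
      · have : K ∩ Set.Icc l u = ∅ := by
          ext x
          simp only [Set.mem_inter_iff, Set.mem_empty_iff_false, iff_false]
          rintro ⟨_, h1, h2⟩
          exact hli ((h1 i).trans (h2 i))
        rw [this]
        exact ⟨fun _ => 1, fun x hx => absurd hx (Set.notMem_empty x)⟩
      have e : K ∩ Set.Icc l u = (K ∩ Set.Icc l (Function.update u i c)) ∪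
          (K ∩ Set.Icc (Function.update l i c) u) := by
        rw [← Set.inter_union_distrib_left]
        congr 1
        ext x
        simp only [Set.mem_union, Set.mem_Icc, Pi.le_def]
        constructor
        · rintro ⟨h1, h2⟩
          rcases le_total (x i) c with hx | hx
          · left
            refine ⟨h1, fun j => ?_⟩
            by_cases hj : j = i
            · subst hj; simpa using hx
            · simpa [Function.update_of_ne hj] using h2 j
          · right
            refine ⟨fun j => ?_, h2⟩
            by_cases hj : j = i
            · subst hj; simpa using hx
            · simpa [Function.update_of_ne hj] using h1 j
        · rintro (⟨h1, h2⟩ | ⟨h1, h2⟩)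
          · refine ⟨h1, fun j => ?_⟩
            have := h2 j
            by_cases hj : j = i
            · subst hj; simp only [Function.update_self, hc] at this; linarith
            · simpa [Function.update_of_ne hj] using this
          · refine ⟨fun j => ?_, h2⟩
            have := h1 j
            by_cases hj : j = i
            · subst hj; simp only [Function.update_self, hc] at this; linarith
            · simpa [Function.update_of_ne hj] using this
      rw [e]
      refine T1.union_of_isClosed T2 ?_ (hKcl.inter isClosed_Icc) (hKcl.inter isClosed_Icc)
      exact ((hKc.inter (convex_Icc _ _)).inter (hKc.inter (convex_Icc _ _))).isPreconnected
  obtain ⟨R, hR⟩ := hK.isBounded.subset_closedBall (0 : Fin 3 → ℝ)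
  obtain ⟨N, hN⟩ := pow_unbounded_of_one_lt (2 * R / (δ / 2)) (one_lt_two : (1:ℝ) < 2)
  have := main _ (fun _ => N) rfl (fun _ => -R) (fun _ => R) (by
    intro i
    rw [div_lt_iff₀ (by positivity)] at hN
    linarith)
  refine this.mono fun x hx => ⟨hx, ?_⟩
  have h1 := hR hx
  rw [Metric.mem_closedBall, dist_zero_right] at h1
  refine ⟨fun i => ?_, fun i => ?_⟩
  · have := (norm_le_pi_norm x i).trans h1
    rw [Real.norm_eq_abs, abs_le] at this
    exact this.1
  · have := (norm_le_pi_norm x i).trans h1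
    rw [Real.norm_eq_abs, abs_le] at this
    exact this.2

end boxes
end OctaGlue

namespace OctaGlue
variable {G : Type} [Group G]

/-- Star-shaped region avoiding the finite set `T`. -/
def starReg (C T : Set (Fin 3 → ℝ)) (o : Fin 3 → ℝ) : Set (Fin 3 → ℝ) :=
  {x | x ∈ C ∧ Disjoint (segment ℝ o x) T}

theorem exists_cone {P O T : Set (Fin 3 → ℝ)} (hPk : IsCompact P) (hPc : Convex ℝ P)
    (hO : IsOpen O) (hOc : Convex ℝ O) (hT : T.Finite) {o x0 : Fin 3 → ℝ}
    (ho : o ∈ P ∩ O) (hx : x0 ∈ starReg (P ∩ O) T o) :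
    ∃ ε > 0, IsCompact (convexJoin ℝ {o} (Metric.closedBall x0 ε ∩ P)) ∧
      Convex ℝ (convexJoin ℝ {o} (Metric.closedBall x0 ε ∩ P)) ∧
      convexJoin ℝ {o} (Metric.closedBall x0 ε ∩ P) ⊆ (P ∩ O) \ T := by
  have hseg : segment ℝ o x0 ⊆ O ∩ Tᶜ := by
    intro y hy
    refine ⟨hOc.segment_subset ho.2 hx.1.2 hy, fun hyT => ?_⟩
    exact Set.disjoint_left.1 hx.2 hy hyT
  have hcs : IsCompact (segment ℝ o x0) := by
    rw [segment_eq_image]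
    refine isCompact_Icc.image (by fun_prop)
  obtain ⟨ε, hε, hsub⟩ := hcs.exists_cthickening_subset_open
    (hO.inter hT.isClosed.isOpen_compl) hseg
  have hcvx : Convex ℝ (Metric.closedBall x0 ε ∩ P) := (convex_closedBall _ _).inter hPc
  refine ⟨ε, hε, ?_, ?_, ?_⟩
  · have hck : IsCompact (Metric.closedBall x0 ε ∩ P) :=
      hPk.inter_left Metric.isClosed_closedBall
    have : convexJoin ℝ {o} (Metric.closedBall x0 ε ∩ P) =
        (fun p : ℝ × (Fin 3 → ℝ) => (1 - p.1) • o + p.1 • p.2) ''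
          (Set.Icc 0 1 ×ˢ (Metric.closedBall x0 ε ∩ P)) := by
      ext y
      rw [convexJoin_singleton_left]
      simp only [Set.mem_iUnion, segment_eq_image, Set.mem_image, Set.mem_prod, Prod.exists]
      constructor
      · rintro ⟨z, hz, t, ht, rfl⟩
        exact ⟨t, z, ⟨ht, hz⟩, rfl⟩
      · rintro ⟨t, z, ⟨ht, hz⟩, rfl⟩
        exact ⟨z, hz, t, ht, rfl⟩
    rw [this]
    exact (isCompact_Icc.prod hck).image (by fun_prop)
  · exact (convex_singleton o).convexJoin hcvx
  · intro y hy
    rw [convexJoin_singleton_left] at hy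
    simp only [Set.mem_iUnion] at hy
    obtain ⟨z, hz, hy⟩ := hy
    have hyP : y ∈ P := hPc.segment_subset ho.1 hz.2 hy
    have : y ∈ Metric.cthickening ε (segment ℝ o x0) := by
      rw [segment_eq_image] at hy
      obtain ⟨t, ht, rfl⟩ := hy
      refine Metric.mem_cthickening_of_dist_le _ ((1 - t) • o + t • x0) _ _ ?_ ?_
      · rw [segment_eq_image]; exact ⟨t, ht, rfl⟩
      · simp only [dist_add_left]
        rw [dist_smul₀, Real.norm_eq_abs, abs_of_nonneg ht.1]
        have := Metric.mem_closedBall.1 hz.1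
        calc t * dist z x0 ≤ 1 * dist z x0 := by
              exact mul_le_mul_of_nonneg_right ht.2 dist_nonneg
          _ ≤ ε := by linarith
    exact ⟨⟨hyP, (hsub this).1⟩, (hsub this).2⟩

theorem triv_star {P O T : Set (Fin 3 → ℝ)} (hPk : IsCompact P) (hPc : Convex ℝ P)
    (hO : IsOpen O) (hOc : Convex ℝ O) (hT : T.Finite)
    {h : (Fin 3 → ℝ) → (Fin 3 → ℝ) → G} (hh : LocOn h (P \ T)) {o : Fin 3 → ℝ}
    (ho : o ∈ P ∩ O) : Triv h (starReg (P ∩ O) T o) := by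
  classical
  have hsub : ∀ x ∈ starReg (P ∩ O) T o, segment ℝ o x ⊆ P \ T := by
    intro x hx y hy
    exact ⟨hPc.segment_subset ho.1 hx.1.1 hy, fun hyT => Set.disjoint_left.1 hx.2 hy hyT⟩
  have hcs : ∀ x, IsCompact (segment ℝ o x) := by
    intro x
    rw [segment_eq_image]
    refine isCompact_Icc.image (by fun_prop)
  have normal : ∀ K : Set (Fin 3 → ℝ), IsCompact K → Convex ℝ K → K ⊆ P \ T → 
      ∃ k : (Fin 3 → ℝ) → G, k o = 1 ∧
        ∀ x ∈ K, ∃ c : G, ∀ᶠ a in nhdsWithin x K, h x a = c * k a := by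
    intro K h1 h2 h3
    obtain ⟨k, hk⟩ := triv_compact_convex hh h1 h2 h3
    refine ⟨fun a => (k o)⁻¹ * k a, by simp, fun x hx => ?_⟩
    obtain ⟨c, hc⟩ := hk x hx
    refine ⟨c * k o, ?_⟩
    filter_upwards [hc] with a ha
    rw [ha]; group
  choose! κ hκ1 hκ using fun x (hx : x ∈ starReg (P ∩ O) T o) =>
    normal (segment ℝ o x) (hcs x) (convex_segment _ _) (hsub x hx)
  refine ⟨fun x => κ x x, fun x0 hx0 => ?_⟩
  obtain ⟨ε, hε, hKk, hKc, hKs⟩ := exists_cone hPk hPc hO hOc hT ho hx0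
  set K := convexJoin ℝ {o} (Metric.closedBall x0 ε ∩ P) with hK
  have hKs' : K ⊆ P \ T := fun y hy => ⟨(hKs hy).1.1, (hKs hy).2⟩
  obtain ⟨k, hk1, hk⟩ := normal K hKk hKc hKs'
  have hin : ∀ x ∈ starReg (P ∩ O) T o, x ∈ Metric.closedBall x0 ε →
      segment ℝ o x ⊆ K := by
    intro x hx hxb y hy
    rw [hK, convexJoin_singleton_left]
    simp only [Set.mem_iUnion]
    exact ⟨x, ⟨hxb, hx.1.1⟩, hy⟩
  have heq : ∀ x ∈ starReg (P ∩ O) T o, x ∈ Metric.closedBall x0 ε → κ x x = k x := by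
    intro x hx hxb
    have hs := hin x hx hxb
    obtain ⟨d, hd⟩ := prim_ratio (hκ x hx) hk (by
      rw [Set.inter_eq_left.2 hs]; exact (convex_segment o x).isPreconnected)
    have d1 := hd o ⟨left_mem_segment ℝ o x, hs (left_mem_segment ℝ o x)⟩
    have d2 := hd x ⟨right_mem_segment ℝ o x, hs (right_mem_segment ℝ o x)⟩
    rw [hκ1 x hx, hk1] at d1
    rw [d2]
    have : d = 1 := by simpa using d1.symm
    rw [this, one_mul]
  have hx0K : x0 ∈ K := hin x0 hx0 (Metric.mem_closedBall_self hε.le) (right_mem_segment ℝ o x0)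
  obtain ⟨c, hc⟩ := hk x0 hx0K
  refine ⟨c, ?_⟩
  have hb : ∀ᶠ a in nhdsWithin x0 (starReg (P ∩ O) T o), a ∈ Metric.closedBall x0 ε :=
    nhdsWithin_le_nhds (Metric.closedBall_mem_nhds x0 hε)
  rw [eventually_nhdsWithin_iff] at hc
  filter_upwards [hb, nhdsWithin_le_nhds hc, self_mem_nhdsWithin] with a ha1 ha2 ha3
  rw [heq a ha3 ha1]
  exact ha2 (hin a ha3 ha1 (right_mem_segment ℝ o a))

theorem starReg_relOpen {P O T : Set (Fin 3 → ℝ)} (hPk : IsCompact P) (hPc : Convex ℝ P)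
    (hO : IsOpen O) (hOc : Convex ℝ O) (hT : T.Finite) {o x : Fin 3 → ℝ}
    (ho : o ∈ P ∩ O) (hx : x ∈ starReg (P ∩ O) T o) :
    starReg (P ∩ O) T o ∈ nhdsWithin x P := by
  obtain ⟨ε, hε, -, -, hKs⟩ := exists_cone hPk hPc hO hOc hT ho hx
  refine Filter.mem_of_superset (inter_mem_nhdsWithin P (Metric.closedBall_mem_nhds x hε)) ?_
  rintro y ⟨hyP, hyb⟩
  have hs : segment ℝ o y ⊆ (P ∩ O) \ T := by
    refine subset_trans ?_ hKs
    intro z hz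
    rw [convexJoin_singleton_left]
    simp only [Set.mem_iUnion]
    exact ⟨y, ⟨hyb, hyP⟩, hz⟩
  exact ⟨(hs (right_mem_segment ℝ o y)).1,
    Set.disjoint_left.2 fun z hz hzT => (hs hz).2 hzT⟩

/-- One bad point. -/
theorem triv_one {P O T : Set (Fin 3 → ℝ)} (hPk : IsCompact P) (hPc : Convex ℝ P)
    (hPi : (interior P).Nonempty)
    (hO : IsOpen O) (hOc : Convex ℝ O) (hT : T.Finite)
    {h : (Fin 3 → ℝ) → (Fin 3 → ℝ) → G} (hh : LocOn h (P \ T)) {p : Fin 3 → ℝ}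
    (hp : (P ∩ O) ∩ T = {p}) : Triv h ((P ∩ O) \ T) := by
  have hpm : p ∈ (P ∩ O) ∩ T := by rw [hp]; rfl
  have hCc : Convex ℝ (P ∩ O) := hPc.inter hOc
  -- an interior point different from p
  obtain ⟨z, hz, hzp⟩ : ∃ z ∈ interior P ∩ O, z ≠ p := by
    have h1 : (interior P ∩ O).Nonempty := by
      have : p ∈ closure (interior P) := by
        rw [hPc.closure_interior_eq_closure_of_nonempty_interior hPi]
        exact subset_closure hpm.1.1
      rw [mem_closure_iff] at this
      obtain ⟨z, hz1, hz2⟩ := this O hO hpm.1.2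
      exact ⟨z, hz2, hz1⟩
    obtain ⟨z, hz1, hz2⟩ := (dense_compl_singleton p).inter_open_nonempty _
      (isOpen_interior.inter hO) h1
    exact ⟨z, hz1, hz2⟩
  obtain ⟨r, hr, hball⟩ := Metric.isOpen_iff.1 (isOpen_interior.inter hO) z hz
  have hballC : Metric.ball z r ⊆ P ∩ O := fun y hy =>
    ⟨interior_subset (hball hy).1, (hball hy).2⟩
  obtain ⟨i, hi⟩ : ∃ i, z i ≠ p i := by
    by_contra hcon
    push Not at hcon
    exact hzp (funext hcon)
  have hmemb : ∀ (j : Fin 3) (s : ℝ), |s| < r → z + Pi.single j s ∈ P ∩ O := by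
    intro j s hs
    apply hballC
    rw [Metric.mem_ball, dist_eq_norm, add_sub_cancel_left, Pi.norm_single, Real.norm_eq_abs]
    exact hs
  have hij : i + 1 ≠ i := by clear * -; revert i; decide
  have hil : i + 2 ≠ i := by clear * -; revert i; decide
  have hjl : i + 1 ≠ i + 2 := by clear * -; revert i; decide
  set l := i + 2 with hl
  set o' := z + Pi.single (i + 1) (r / 2) with ho'
  have hr2 : |r / 2| < r := by rw [abs_of_pos (by linarith)]; linarith
  have hr2' : |-(r / 2)| < r := by rw [abs_neg]; exact hr2
  have hoC : z ∈ P ∩ O := hballC (Metric.mem_ball_self hr)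
  have ho'C : o' ∈ P ∩ O := hmemb _ _ hr2
  have ho'i : o' i = z i := by simp [ho', hij.symm]
  have ho'l : o' l = z l := by simp [ho', hjl.symm]
  have ho'j : o' (i + 1) = z (i + 1) + r / 2 := by simp [ho']
  set m : (Fin 3 → ℝ) → ℝ := fun x => (x l - p l) * (z i - p i) - (x i - p i) * (z l - p l)
    with hm
  have maff : ∀ x y : Fin 3 → ℝ, ∀ s : ℝ, m ((1 - s) • x + s • y) = (1 - s) * m x + s * m y := by
    intro x y s
    simp only [hm, Pi.add_apply, Pi.smul_apply, smul_eq_mul]; ring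
  have mz : m z = 0 := by simp only [hm]; ring
  have mp : m p = 0 := by simp only [hm]; ring
  have mo' : m o' = 0 := by simp only [hm, ho'i, ho'l]; ring
  have hdi : z i - p i ≠ 0 := sub_ne_zero.2 hi
  have bad : ∀ x ∈ P ∩ O, ∀ w, w ∈ P ∩ O → ¬ Disjoint (segment ℝ w x) T → p ∈ segment ℝ w x := by
    intro x hx w hw hd
    rw [Set.not_disjoint_iff] at hd
    obtain ⟨y, hy1, hy2⟩ := hd
    have : y ∈ (P ∩ O) ∩ T := ⟨hCc.segment_subset hw hx hy1, hy2⟩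
    rw [hp] at this
    rw [Set.mem_singleton_iff] at this
    rw [← this]; exact hy1
  have hUn : (P ∩ O) \ T = starReg (P ∩ O) T z ∪ starReg (P ∩ O) T o' := by
    ext x
    constructor
    · rintro ⟨hx, hxT⟩
      by_contra hcon
      rw [Set.mem_union, not_or] at hcon
      have h1 := bad x hx z hoC fun hd => hcon.1 ⟨hx, hd⟩
      have h2 := bad x hx o' ho'C fun hd => hcon.2 ⟨hx, hd⟩
      rw [segment_eq_image] at h1 h2
      obtain ⟨s, hs, e1⟩ := h1
      obtain ⟨s', hs', e2⟩ := h2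
      have hxp : x ≠ p := fun e => hxT (e ▸ hpm.2)
      have f1 : ∀ j, (1 - s) * z j + s * x j = p j := fun j => by simpa using congrFun e1 j
      have f2 : ∀ j, (1 - s') * o' j + s' * x j = p j := fun j => by simpa using congrFun e2 j
      have hs1 : s ≠ 1 := by
        rintro rfl
        exact hxp (funext fun j => by have := f1 j; linarith)
      have g1 := f1 i
      have g2 := f2 i
      rw [ho'i] at g2
      have hzx : z i - x i ≠ 0 := by
        intro e
        apply hdi
        have : z i = x i := by linarith
        rw [← this] at g1
        linarith
      have hss : s = s' := by
        have : (s - s') * (z i - x i) = 0 := by linarith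
        rcases mul_eq_zero.1 this with h | h
        · linarith
        · exact absurd h hzx
      subst hss
      have g3 := f1 (i + 1)
      have g4 := f2 (i + 1)
      rw [ho'j] at g4
      have : (1 - s) * (r / 2) = 0 := by linarith
      rcases mul_eq_zero.1 this with h | h
      · exact hs1 (by linarith)
      · linarith
    · rintro (⟨hx, hd⟩ | ⟨hx, hd⟩)
      · exact ⟨hx, fun hxT => Set.disjoint_left.1 hd (right_mem_segment ℝ _ _) hxT⟩
      · exact ⟨hx, fun hxT => Set.disjoint_left.1 hd (right_mem_segment ℝ _ _) hxT⟩
  have hoff : ∀ x ∈ P ∩ O, m x ≠ 0 → x ∈ starReg (P ∩ O) T z ∩ starReg (P ∩ O) T o' := by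
    have aux : ∀ x ∈ P ∩ O, m x ≠ 0 → ∀ w ∈ P ∩ O, m w = 0 → w i = z i → x ∈ starReg (P ∩ O) T w := by
      intro x hx hmx w hw hmw hwi
      refine ⟨hx, ?_⟩
      by_contra hcon
      have h1 := bad x hx w hw hcon
      rw [segment_eq_image] at h1
      obtain ⟨s, hs, e1⟩ := h1
      have e3 := maff w x s
      simp only at e1
      rw [e1, mp, hmw] at e3
      have : s = 0 := by
        rcases mul_eq_zero.1 (by linarith : s * m x = 0) with h | h
        · exact h
        · exact absurd h hmx
      subst this
      simp only [sub_zero, one_smul, zero_smul, add_zero] at e1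
      rw [e1] at hwi
      exact hi hwi.symm
    intro x hx hmx
    exact ⟨aux x hx hmx z hoC mz rfl, aux x hx hmx o' ho'C mo' ho'i⟩
  have hpre : IsPreconnected (starReg (P ∩ O) T z ∩ starReg (P ∩ O) T o') := by
    have hzU : z ∈ starReg (P ∩ O) T z ∩ starReg (P ∩ O) T o' := by
      refine ⟨⟨hoC, ?_⟩, ⟨hoC, ?_⟩⟩
      · by_contra hcon
        have h1 := bad z hoC z hoC hcon
        rw [segment_same, Set.mem_singleton_iff] at h1
        exact hzp h1.symm
      · by_contra hcon
        have h1 := bad z hoC o' ho'C hcon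
        rw [segment_eq_image] at h1
        obtain ⟨s, hs, e1⟩ := h1
        have := congrFun e1 i
        simp only [Pi.add_apply, Pi.smul_apply, smul_eq_mul, ho'i] at this
        exact hi (by linarith)
    have hsegU : ∀ x ∈ starReg (P ∩ O) T z ∩ starReg (P ∩ O) T o', ∀ q ∈ P ∩ O, m q ≠ 0 →
        0 ≤ m x * m q → segment ℝ x q ⊆ starReg (P ∩ O) T z ∩ starReg (P ∩ O) T o' := by
      intro x hx q hq hmq hxq y hy
      by_cases hmy : m y = 0
      · rw [segment_eq_image] at hy
        obtain ⟨s, hs, rfl⟩ := hy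
        have e := maff x q s
        rw [show m ((1 - s) • x + s • q) = 0 from hmy] at e
        have e2 : (1 - s) * (m x * m q) + s * (m q * m q) = 0 := by
          have : ((1 - s) * m x + s * m q) * m q = 0 := by rw [← e, zero_mul]
          linarith
        have p1 : 0 ≤ (1 - s) * (m x * m q) := mul_nonneg (by linarith [hs.2]) hxq
        have p2 : 0 < m q * m q := mul_self_pos.2 hmq
        have p3 : 0 ≤ s * (m q * m q) := mul_nonneg hs.1 p2.le
        have p4 : s * (m q * m q) = 0 := by linarith
        have : s = 0 := by
          rcases mul_eq_zero.1 p4 with h | h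
          · exact h
          · exact absurd h p2.ne'
        subst this
        simpa using hx
      · exact hoff y (hCc.segment_subset hx.1.1 hq hy) hmy
    have mq : ∀ s : ℝ, m (z + Pi.single l s) = s * (z i - p i) := by
      intro s
      simp only [hm, Pi.add_apply, Pi.single_eq_same, Pi.single_eq_of_ne hil.symm]; ring
    refine isPreconnected_of_forall z ?_
    intro x hx
    obtain ⟨s, hsr, hs0, hsx⟩ : ∃ s : ℝ, |s| < r ∧ s ≠ 0 ∧ 0 ≤ m x * (s * (z i - p i)) := by
      rcases le_total 0 (m x * (z i - p i)) with h | h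
      · exact ⟨r / 2, hr2, by linarith, by nlinarith⟩
      · exact ⟨-(r / 2), hr2', by linarith, by nlinarith⟩
    have hqC := hmemb l s hsr
    have hmq : m (z + Pi.single l s) ≠ 0 := by rw [mq]; exact mul_ne_zero hs0 hdi
    refine ⟨segment ℝ x (z + Pi.single l s) ∪ segment ℝ z (z + Pi.single l s), ?_, ?_, ?_, ?_⟩
    · refine Set.union_subset (hsegU x hx _ hqC hmq (by rw [mq]; exact hsx))
        (hsegU z hzU _ hqC hmq (by rw [mz, zero_mul]))
    · exact Or.inr (left_mem_segment ℝ _ _)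
    · exact Or.inl (left_mem_segment ℝ _ _)
    · exact (convex_segment _ _).isPreconnected.union (z + Pi.single l s)
        (right_mem_segment ℝ _ _) (right_mem_segment ℝ _ _) (convex_segment _ _).isPreconnected
  rw [hUn]
  refine (triv_star hPk hPc hO hOc hT hh hoC).union_of_relOpen
    (triv_star hPk hPc hO hOc hT hh ho'C) hpre ?_ ?_
  · intro x hx
    refine nhdsWithin_mono x ?_ (starReg_relOpen hPk hPc hO hOc hT hoC hx)
    rw [← hUn]; exact fun y hy => hy.1.1
  · intro x hx
    refine nhdsWithin_mono x ?_ (starReg_relOpen hPk hPc hO hOc hT ho'C hx)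
    rw [← hUn]; exact fun y hy => hy.1.1

theorem triv_slabs {P T : Set (Fin 3 → ℝ)} (hPk : IsCompact P) (hPc : Convex ℝ P)
    (hPi : (interior P).Nonempty) (hT : T.Finite)
    {h : (Fin 3 → ℝ) → (Fin 3 → ℝ) → G} (hh : LocOn h (P \ T)) :
    ∀ n : ℕ, ∀ O : Set (Fin 3 → ℝ), IsOpen O → Convex ℝ O → ((P ∩ O) ∩ T).ncard = n →
      Triv h ((P ∩ O) \ T) := by
  intro n
  induction n using Nat.strong_induction_on with
  | _ n ih =>
  intro O hO hOc hn
  have hfin : ((P ∩ O) ∩ T).Finite := hT.subset Set.inter_subset_right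
  by_cases hsub : ((P ∩ O) ∩ T).Subsingleton
  · rcases hsub.eq_empty_or_singleton with he | ⟨p, hp⟩
    · by_cases hne : (P ∩ O).Nonempty
      · obtain ⟨o, ho⟩ := hne
        refine (triv_star hPk hPc hO hOc hT hh ho).mono ?_
        rintro x ⟨hx, hxT⟩
        refine ⟨hx, Set.disjoint_left.2 fun y hy hyT => ?_⟩
        have : y ∈ (P ∩ O) ∩ T := ⟨(hPc.inter hOc).segment_subset ho hx hy, hyT⟩
        rw [he] at this
        exact this
      · rw [Set.not_nonempty_iff_eq_empty] at hne
        rw [hne]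
        exact ⟨fun _ => 1, fun x hx => absurd hx.1 (Set.notMem_empty x)⟩
    · exact triv_one hPk hPc hPi hO hOc hT hh hp
  · rw [Set.not_subsingleton_iff] at hsub
    obtain ⟨p, hp, q, hq, hpq⟩ := hsub
    obtain ⟨i, hi⟩ : ∃ i, p i ≠ q i := by
      by_contra hcon
      push Not at hcon
      exact hpq (funext hcon)
    wlog hlt : p i < q i generalizing p q
    · exact this q hq p hp hpq.symm hi.symm (lt_of_le_of_ne (not_lt.1 hlt) hi.symm)
    -- minimal value above `p i`
    obtain ⟨q', hq', hmin⟩ := Set.exists_min_image ({x | x ∈ (P ∩ O) ∩ T ∧ p i < x i})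
      (fun x => x i) (hfin.subset fun x hx => hx.1) ⟨q, hq, hlt⟩
    have hA : Triv h ((P ∩ (O ∩ {x | x i < q' i})) \ T) := by
      refine ih _ ?_ _ (hO.inter (isOpen_lt (continuous_apply i) continuous_const))
        (hOc.inter ?_) rfl
      · rw [← hn]
        refine Set.ncard_lt_ncard ?_ hfin
        refine (Set.ssubset_iff_of_subset ?_).2 ?_
        · exact fun x hx => ⟨⟨hx.1.1, hx.1.2.1⟩, hx.2⟩
        exact ⟨q', hq'.1, fun hc => lt_irrefl (q' i) hc.1.2.2⟩
      · exact convex_halfSpace_lt (LinearMap.proj (R := ℝ) i).isLinear _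
    have hB : Triv h ((P ∩ (O ∩ {x | p i < x i})) \ T) := by
      refine ih _ ?_ _ (hO.inter (isOpen_lt continuous_const (continuous_apply i)))
        (hOc.inter ?_) rfl
      · rw [← hn]
        refine Set.ncard_lt_ncard ?_ hfin
        refine (Set.ssubset_iff_of_subset ?_).2 ?_
        · exact fun x hx => ⟨⟨hx.1.1, hx.1.2.1⟩, hx.2⟩
        exact ⟨p, hp, fun hc => lt_irrefl (p i) hc.1.2.2⟩
      · exact convex_halfSpace_gt (LinearMap.proj (R := ℝ) i).isLinear _
    have e : (P ∩ O) \ T = ((P ∩ (O ∩ {x | x i < q' i})) \ T) ∪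
        ((P ∩ (O ∩ {x | p i < x i})) \ T) := by
      ext x
      constructor
      · rintro ⟨⟨h1, h2⟩, h3⟩
        by_cases hx : x i < q' i
        · exact Or.inl ⟨⟨h1, h2, hx⟩, h3⟩
        · exact Or.inr ⟨⟨h1, h2, lt_of_lt_of_le hq'.2 (not_lt.1 hx)⟩, h3⟩
      · rintro (⟨⟨h1, h2⟩, h3⟩ | ⟨⟨h1, h2⟩, h3⟩)
        · exact ⟨⟨h1, h2.1⟩, h3⟩
        · exact ⟨⟨h1, h2.1⟩, h3⟩
    have e2 : ((P ∩ (O ∩ {x | x i < q' i})) \ T) ∩ ((P ∩ (O ∩ {x | p i < x i})) \ T) =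
        P ∩ (O ∩ ({x | x i < q' i} ∩ {x | p i < x i})) := by
      ext x
      constructor
      · rintro ⟨⟨⟨h1, h2, h3⟩, h4⟩, ⟨⟨h5, h6, h7⟩, h8⟩⟩
        exact ⟨h1, h2, h3, h7⟩
      · rintro ⟨h1, h2, h3, h4⟩
        have : x ∉ T := by
          intro hxT
          have := hmin x ⟨⟨⟨h1, h2⟩, hxT⟩, h4⟩
          exact absurd h3 (not_lt.2 this)
        exact ⟨⟨⟨h1, h2, h3⟩, this⟩, ⟨⟨h1, h2, h4⟩, this⟩⟩
    rw [e]
    refine hA.union_of_relOpen hB ?_ ?_ ?_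
    · rw [e2]
      refine (hPc.inter (hOc.inter (Convex.inter ?_ ?_))).isPreconnected
      · exact convex_halfSpace_lt (LinearMap.proj (R := ℝ) i).isLinear _
      · exact convex_halfSpace_gt (LinearMap.proj (R := ℝ) i).isLinear _
    · intro x hx
      rw [← e]
      refine Filter.mem_of_superset (inter_mem_nhdsWithin _
        ((isOpen_lt (continuous_apply i) continuous_const).mem_nhds hx.1.2.2)) ?_
      rintro y ⟨⟨⟨h1, h2⟩, h3⟩, h4⟩
      exact ⟨⟨h1, h2, h4⟩, h3⟩
    · intro x hx
      rw [← e]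
      refine Filter.mem_of_superset (inter_mem_nhdsWithin _
        ((isOpen_lt continuous_const (continuous_apply i)).mem_nhds hx.1.2.2)) ?_
      rintro y ⟨⟨⟨h1, h2⟩, h3⟩, h4⟩
      exact ⟨⟨h1, h2, h4⟩, h3⟩

/-- A compact convex body minus finitely many points has only trivial local structures. -/
theorem triv_body {P T : Set (Fin 3 → ℝ)} (hPk : IsCompact P) (hPc : Convex ℝ P)
    (hPi : (interior P).Nonempty) (hT : T.Finite)
    {h : (Fin 3 → ℝ) → (Fin 3 → ℝ) → G} (hh : LocOn h (P \ T)) : Triv h (P \ T) := by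
  have := triv_slabs hPk hPc hPi hT hh _ Set.univ isOpen_univ convex_univ rfl
  rwa [Set.inter_univ] at this

/-- Subtype version of `triv_body`. -/
theorem triv_subtype {P : Set (Fin 3 → ℝ)} (hPk : IsCompact P) (hPc : Convex ℝ P)
    (hPi : (interior P).Nonempty) {T : Set P} (hT : T.Finite) (h : P → P → G)
    (hh : ∀ y, y ∉ T → ∀ᶠ z in nhds y, ∃ c : G, ∀ᶠ a in nhds z, h z a = c * h y a) :
    ∃ k : P → G, ∀ x, x ∉ T → ∃ c : G, ∀ᶠ a in nhds x, h x a = c * k a := by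
  classical
  set T' : Set (Fin 3 → ℝ) := Subtype.val '' T with hT'
  have hT'f : T'.Finite := hT.image _
  set H : (Fin 3 → ℝ) → (Fin 3 → ℝ) → G := fun x a =>
    if hx : x ∈ P then (if ha : a ∈ P then h ⟨x, hx⟩ ⟨a, ha⟩ else 1) else 1 with hH
  have hHv : ∀ x a : P, H x a = h x a := fun x a => by simp [hH]
  have hmem : ∀ x : P, (x : Fin 3 → ℝ) ∈ P \ T' ↔ x ∉ T := by
    intro x
    simp [hT']
  have hle : ∀ (x : P), x ∉ T → nhdsWithin (x : Fin 3 → ℝ) (P \ T') = Filter.map Subtype.val (nhds x) := by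
    intro x hx
    have h1 : nhdsWithin (x : Fin 3 → ℝ) (P \ T') = nhdsWithin (x : Fin 3 → ℝ) P := by
      have : T'ᶜ ∈ nhds (x : Fin 3 → ℝ) := hT'f.isClosed.isOpen_compl.mem_nhds
        ((hmem x).2 hx).2
      rw [Set.sdiff_eq, Set.inter_comm]
      exact nhdsWithin_inter_of_mem (nhdsWithin_le_nhds this)
    rw [h1, nhds_subtype_eq_comap, Filter.map_comap, Subtype.range_coe]
    rfl
  have hloc : LocOn H (P \ T') := by
    intro y hy
    have hyT := (hmem ⟨y, hy.1⟩).1 hy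
    have := hle ⟨y, hy.1⟩ hyT
    simp only at this
    rw [this, Filter.eventually_map]
    have hTo : ∀ᶠ z in nhds (⟨y, hy.1⟩ : P), z ∉ T := hT.isClosed.isOpen_compl.mem_nhds hyT
    filter_upwards [hh _ hyT, hTo] with z hz hzT
    obtain ⟨c, hc⟩ := hz
    refine ⟨c, ?_⟩
    rw [hle z hzT, Filter.eventually_map]
    filter_upwards [hc] with a ha
    rw [hHv z a, ha, ← hHv ⟨y, hy.1⟩ a]
  obtain ⟨k, hk⟩ := triv_body hPk hPc hPi hT'f hloc
  refine ⟨fun x => k x, fun x hx => ?_⟩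
  obtain ⟨c, hc⟩ := hk x ((hmem x).2 hx)
  rw [hle x hx, Filter.eventually_map] at hc
  refine ⟨c, ?_⟩
  filter_upwards [hc] with a ha
  rw [← hHv, ha]

end OctaGlue

namespace OctaGlue

/-- Convex sets containing a non-degenerate triangle stay connected after removing finitely
many points. -/
theorem precon_diff {C T : Set (Fin 3 → ℝ)} (hC : Convex ℝ C) (hT : T.Finite)
    (hnd : ∃ a ∈ C, ∃ b ∈ C, ∃ c ∈ C, ∀ α β : ℝ, α • (b - a) + β • (c - a) = 0 → α = 0 ∧ β = 0) :
    IsPreconnected (C \ T) := by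
  obtain ⟨a, ha, b, hb, c, hc, hi⟩ := hnd
  refine isPreconnected_of_forall_pair ?_
  intro x hx y hy
  by_cases hxy : x = y
  · subst hxy
    exact ⟨{x}, by simpa using hx, rfl, rfl, isPreconnected_singleton⟩
  have hv : y - x ≠ 0 := sub_ne_zero.2 (Ne.symm hxy)
  obtain ⟨q, hq, hqi⟩ : ∃ q ∈ C, ∀ α β : ℝ, α • (y - x) + β • (q - x) = 0 → α = 0 ∧ β = 0 := by
    by_contra hcon
    push Not at hcon
    have key : ∀ q ∈ C, ∃ t : ℝ, q - x = t • (y - x) := by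
      intro q hq
      obtain ⟨α, β, h0, h1⟩ := hcon q hq
      have hβ : β ≠ 0 := by
        rintro rfl
        simp only [zero_smul, add_zero, smul_eq_zero] at h0
        rcases h0 with h0 | h0
        · exact h1 h0 rfl
        · exact hv h0
      refine ⟨-(α / β), ?_⟩
      have h2 : β • (q - x) = -(α • (y - x)) := by
        rw [eq_neg_iff_add_eq_zero, add_comm]; exact h0
      have h3 : q - x = β⁻¹ • (β • (q - x)) := by rw [smul_smul, inv_mul_cancel₀ hβ, one_smul]
      rw [h3, h2, ← neg_smul, smul_smul]
      congr 1
      field_simp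
    obtain ⟨ta, hta⟩ := key a ha
    obtain ⟨tb, htb⟩ := key b hb
    obtain ⟨tc, htc⟩ := key c hc
    have e1 : b - a = (tb - ta) • (y - x) := by
      rw [sub_smul, ← htb, ← hta]; abel
    have e2 : c - a = (tc - ta) • (y - x) := by
      rw [sub_smul, ← htc, ← hta]; abel
    by_cases htb' : tb - ta = 0
    · have := (hi 1 0 (by rw [e1, htb']; simp)).1
      norm_num at this
    · have := (hi (tc - ta) (-(tb - ta)) (by rw [e1, e2, smul_smul, smul_smul, ← add_smul]; ring_nf; simp)).2
      exact htb' (by linarith)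
  set w : ℝ → (Fin 3 → ℝ) := fun s => x + (((1 - s) / 2) • (y - x) + s • (q - x)) with hw
  have hwC : ∀ s ∈ Set.Icc (0:ℝ) 1, w s ∈ C := by
    intro s hs
    have h1 : (1/2 : ℝ) • x + (1/2 : ℝ) • y ∈ C :=
      hC hx.1 hy.1 (by norm_num) (by norm_num) (by norm_num)
    have h2 := hC h1 hq (sub_nonneg.2 hs.2) hs.1 (by ring)
    convert h2 using 1
    ext j
    simp only [hw, Pi.add_apply, Pi.smul_apply, Pi.sub_apply, smul_eq_mul]; ring
  have hfin : ∀ p ∈ T, {s : ℝ | s ∈ Set.Icc (0:ℝ) 1 ∧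
      (p ∈ segment ℝ x (w s) ∨ p ∈ segment ℝ y (w s))}.Finite := by
    intro p hp
    have hA : {s : ℝ | p ∈ segment ℝ x (w s)}.Subsingleton := by
      intro s hs s' hs'
      simp only [Set.mem_ofPred_eq, segment_eq_image] at hs hs'
      obtain ⟨r, hr, e1⟩ := hs
      obtain ⟨r', hr', e2⟩ := hs'
      have hr0 : r ≠ 0 := by
        rintro rfl
        simp only [sub_zero, one_smul, zero_smul, add_zero] at e1
        exact hx.2 (e1 ▸ hp)
      have := hqi (r * (1 - s) / 2 - r' * (1 - s') / 2) (r * s - r' * s') (by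
        have e3 := e1.trans e2.symm
        ext j
        have := congrFun e3 j
        simp only [hw, Pi.add_apply, Pi.smul_apply, Pi.sub_apply, smul_eq_mul, Pi.zero_apply] at this ⊢
        linarith)
      have h2 : r = r' := by linarith
      subst h2
      have : r * (s - s') = 0 := by linarith
      rcases mul_eq_zero.1 this with h | h
      · exact absurd h hr0
      · linarith
    have hB : {s : ℝ | p ∈ segment ℝ y (w s)}.Subsingleton := by
      intro s hs s' hs'
      simp only [Set.mem_ofPred_eq, segment_eq_image] at hs hs'
      obtain ⟨r, hr, e1⟩ := hs
      obtain ⟨r', hr', e2⟩ := hs'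
      have hr0 : r ≠ 0 := by
        rintro rfl
        simp only [sub_zero, one_smul, zero_smul, add_zero] at e1
        exact hy.2 (e1 ▸ hp)
      have := hqi ((-r + r * (1 - s) / 2) - (-r' + r' * (1 - s') / 2)) (r * s - r' * s') (by
        have e3 := e1.trans e2.symm
        ext j
        have := congrFun e3 j
        simp only [hw, Pi.add_apply, Pi.smul_apply, Pi.sub_apply, smul_eq_mul, Pi.zero_apply] at this ⊢
        linarith)
      have h2 : r = r' := by linarith
      subst h2
      have : r * (s - s') = 0 := by linarith
      rcases mul_eq_zero.1 this with h | h
      · exact absurd h hr0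
      · linarith
    refine (hA.finite.union hB.finite).subset ?_
    rintro s ⟨_, h | h⟩
    · exact Or.inl h
    · exact Or.inr h
  have hbad := hT.biUnion hfin
  obtain ⟨s, hs, hsb⟩ := (Set.Icc_infinite (zero_lt_one (α := ℝ))).exists_notMem_finite hbad
  have hsb' : ∀ p ∈ T, p ∉ segment ℝ x (w s) ∧ p ∉ segment ℝ y (w s) := by
    intro p hp
    rw [← not_or]
    intro hcon
    exact hsb (Set.mem_biUnion hp ⟨hs, hcon⟩)
  refine ⟨segment ℝ x (w s) ∪ segment ℝ y (w s), ?_, Or.inl (left_mem_segment ℝ _ _),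
    Or.inr (left_mem_segment ℝ _ _), ?_⟩
  · rintro z (hz | hz)
    · exact ⟨hC.segment_subset hx.1 (hwC s hs) hz, fun hzT => (hsb' z hzT).1 hz⟩
    · exact ⟨hC.segment_subset hy.1 (hwC s hs) hz, fun hzT => (hsb' z hzT).2 hz⟩
  · exact (convex_segment _ _).isPreconnected.union (w s)
        (right_mem_segment ℝ _ _) (right_mem_segment ℝ _ _) (convex_segment _ _).isPreconnected

/-- real sign of a Boolean -/
def sg (b : Bool) : ℝ := if b then 1 else -1

theorem sg_mul_self (b : Bool) : sg b * sg b = 1 := by cases b <;> simp [sg]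
theorem abs_sg (b : Bool) : |sg b| = 1 := by cases b <;> simp [sg]
theorem sg_ne (b : Bool) : sg b ≠ 0 := by cases b <;> simp [sg]
theorem vertexPt_apply (i : Fin 3) (b : Bool) (j : Fin 3) :
    vertexPt (i, b) j = if j = i then sg b else 0 := by
  simp [vertexPt, sg]

theorem mem_solidOcta (x : Fin 3 → ℝ) : x ∈ SolidOcta ↔ ∑ i, |x i| ≤ 1 := by
  constructor
  · intro hx
    have : SolidOcta ⊆ {x : Fin 3 → ℝ | ∑ i, |x i| ≤ 1} := by
      refine convexHull_min ?_ ?_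
      · rintro _ ⟨⟨i, b⟩, rfl⟩
        simp only [Set.mem_ofPred_eq, vertexPt_apply]
        have : ∀ j, |if j = i then sg b else 0| = if j = i then (1:ℝ) else 0 := by
          intro j; split_ifs <;> simp [abs_sg]
        simp [this]
      · intro x hx y hy a b ha hb hab
        simp only [Set.mem_ofPred_eq] at hx hy ⊢
        calc ∑ i, |(a • x + b • y) i| ≤ ∑ i, (a * |x i| + b * |y i|) := by
              refine Finset.sum_le_sum fun i _ => ?_
              simp only [Pi.add_apply, Pi.smul_apply, smul_eq_mul]
              refine (abs_add_le _ _).trans ?_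
              rw [abs_mul, abs_mul, abs_of_nonneg ha, abs_of_nonneg hb]
          _ = a * ∑ i, |x i| + b * ∑ i, |y i| := by
              rw [Finset.sum_add_distrib, Finset.mul_sum, Finset.mul_sum]
          _ ≤ a * 1 + b * 1 := by gcongr
          _ = 1 := by linarith
    exact this hx
  · intro hx
    set s := ∑ i, |x i| with hs
    have hcv : Convex ℝ SolidOcta := convex_convexHull ℝ _
    have := hcv.sum_mem (t := Finset.univ) (w := fun v : OctVertex => (|x v.1| + sg v.2 * x v.1) / 2 + (1 - s) / 6)
      (z := vertexPt) ?_ ?_ (fun v _ => vertexPt_mem_solidOcta v)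
    · convert this using 1
      ext j
      simp only [Finset.sum_apply, Pi.smul_apply, smul_eq_mul, Fintype.sum_prod_type, Fintype.sum_bool, vertexPt_apply, Fin.sum_univ_three]
      fin_cases j <;> simp [sg] <;> ring
    · rintro ⟨i, b⟩ _
      have h1 : 0 ≤ |x i| + sg b * x i := by
        have := neg_abs_le (x i); have := le_abs_self (x i)
        cases b <;> simp [sg] <;> linarith
      have : 0 ≤ 1 - s := by linarith
      positivity
    · simp only [Fintype.sum_prod_type, Fintype.sum_bool, Fin.sum_univ_three, sg] 
      simp only [Fin.sum_univ_three] at hs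
      simp
      linarith

theorem solid_compact : IsCompact SolidOcta := (Set.finite_range vertexPt).isCompact_convexHull (𝕜 := ℝ)
theorem solid_convex : Convex ℝ SolidOcta := convex_convexHull ℝ _
theorem solid_interior : (interior SolidOcta).Nonempty := by
  refine ⟨0, ?_⟩
  rw [mem_interior_iff_mem_nhds]
  refine Filter.mem_of_superset (Metric.ball_mem_nhds 0 (by norm_num : (0:ℝ) < 1 / 3)) ?_
  intro x hx
  rw [Metric.mem_ball, dist_zero_right] at hx
  rw [mem_solidOcta, Fin.sum_univ_three]
  have h := fun i => (norm_le_pi_norm x i).trans hx.le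
  simp only [Real.norm_eq_abs] at h
  have := h 0; have := h 1; have := h 2
  linarith

/-- closed face -/
def Fc (F : OctFace) : Set (Fin 3 → ℝ) := {x | (∀ i, 0 ≤ sg (F i) * x i) ∧ ∑ i, sg (F i) * x i = 1}

theorem Fc_closed (F : OctFace) : IsClosed (Fc F) := by
  have e : Fc F = (⋂ i, {x : Fin 3 → ℝ | 0 ≤ sg (F i) * x i}) ∩
      {x | ∑ i, sg (F i) * x i = 1} := by
    ext x; simp [Fc]
  rw [e]
  refine IsClosed.inter ?_ ?_
  · exact isClosed_iInter fun i => isClosed_le continuous_const (by fun_prop)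
  · exact isClosed_eq (by fun_prop) continuous_const

theorem Fc_convex (F : OctFace) : Convex ℝ (Fc F) := by
  intro x hx y hy a b ha hb hab
  refine ⟨fun i => ?_, ?_⟩
  · have h1 := mul_nonneg ha (hx.1 i)
    have h2 := mul_nonneg hb (hy.1 i)
    simp only [Pi.add_apply, Pi.smul_apply, smul_eq_mul]
    linarith
  · have h1 := hx.2
    have h2 := hy.2
    simp only [Pi.add_apply, Pi.smul_apply, smul_eq_mul]
    calc ∑ i, sg (F i) * (a * x i + b * y i) = a * ∑ i, sg (F i) * x i + b * ∑ i, sg (F i) * y i := by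
          rw [Finset.mul_sum, Finset.mul_sum, ← Finset.sum_add_distrib]
          exact Finset.sum_congr rfl fun i _ => by ring
      _ = 1 := by rw [h1, h2]; linarith

theorem Fc_sub (F : OctFace) : Fc F ⊆ SolidOcta := by
  intro x hx
  rw [mem_solidOcta, ← hx.2]
  refine Finset.sum_le_sum fun i _ => ?_
  rw [← abs_of_nonneg (hx.1 i), abs_mul, abs_sg, one_mul]

theorem vertexPt_mem_Fc (F : OctFace) (i : Fin 3) : vertexPt (i, F i) ∈ Fc F := by
  refine ⟨fun j => ?_, ?_⟩
  · rw [vertexPt_apply]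
    split_ifs with h
    · rw [h, sg_mul_self]; norm_num
    · simp
  · simp [vertexPt_apply, sg_mul_self]

theorem tri_nd (F : OctFace) : ∀ α β : ℝ,
    α • (vertexPt (1, F 1) - vertexPt (0, F 0)) + β • (vertexPt (2, F 2) - vertexPt (0, F 0)) = 0 →
      α = 0 ∧ β = 0 := by
  intro α β h
  have h1 := congrFun h 1
  have h2 := congrFun h 2
  simp [vertexPt_apply, sg_ne] at h1 h2
  exact ⟨h1, h2⟩

theorem Fc_diff_precon (F : OctFace) {T : Set (Fin 3 → ℝ)} (hT : T.Finite) :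
    IsPreconnected (Fc F \ T) :=
  precon_diff (Fc_convex F) hT ⟨_, vertexPt_mem_Fc F 0, _, vertexPt_mem_Fc F 1, _, vertexPt_mem_Fc F 2, tri_nd F⟩

theorem solid_diff_precon {T : Set (Fin 3 → ℝ)} (hT : T.Finite) :
    IsPreconnected (SolidOcta \ T) :=
  precon_diff solid_convex hT ⟨_, vertexPt_mem_solidOcta _, _, vertexPt_mem_solidOcta _, _,
    vertexPt_mem_solidOcta _, tri_nd (fun _ => true)⟩

theorem precon_sub {C : Set (Fin 3 → ℝ)} (hC : C ⊆ SolidOcta) {T : Set SolidOcta}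
    (h : IsPreconnected (C \ (Subtype.val '' T))) :
    IsPreconnected {x : SolidOcta | (x : Fin 3 → ℝ) ∈ C ∧ x ∉ T} := by
  rw [← Topology.IsInducing.subtypeVal.isPreconnected_image]
  convert h using 1
  ext x
  constructor
  · rintro ⟨y, ⟨h1, h2⟩, rfl⟩
    exact ⟨h1, by simpa using h2⟩
  · rintro ⟨h1, h2⟩
    refine ⟨⟨x, hC h1⟩, ⟨h1, fun h3 => h2 ⟨_, h3, rfl⟩⟩, rfl⟩

theorem precon_face (F : OctFace) {T : Set SolidOcta} (hT : T.Finite) :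
    IsPreconnected {x : SolidOcta | (x : Fin 3 → ℝ) ∈ Fc F ∧ x ∉ T} :=
  precon_sub (Fc_sub F) (Fc_diff_precon F (hT.image _))

theorem precon_solid {T : Set SolidOcta} (hT : T.Finite) :
    IsPreconnected {x : SolidOcta | x ∉ T} := by
  have := precon_sub subset_rfl (solid_diff_precon (hT.image Subtype.val))
  convert this using 1
  ext x; simp

end OctaGlue

namespace OctaGlue

/-- linear extension of a face identification -/
def gmE (g : Gluing) (F : OctFace) (x : Fin 3 → ℝ) : Fin 3 → ℝ := fun j =>
  sg (g.face F j) * sg (F ((g.axisMap F)⁻¹ j)) * x ((g.axisMap F)⁻¹ j)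

theorem abs_gmE (g : Gluing) (F : OctFace) (x : Fin 3 → ℝ) (j : Fin 3) :
    |gmE g F x j| = |x ((g.axisMap F)⁻¹ j)| := by
  simp [gmE, abs_mul, abs_sg]

theorem gmE_mem (g : Gluing) (F : OctFace) {x : Fin 3 → ℝ} (hx : x ∈ SolidOcta) :
    gmE g F x ∈ SolidOcta := by
  rw [mem_solidOcta] at hx ⊢
  simp only [abs_gmE]
  rw [Equiv.sum_comp (g.axisMap F)⁻¹ (fun i => |x i|)]
  exact hx

theorem dist_gmE (g : Gluing) (F : OctFace) (x y : Fin 3 → ℝ) :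
    dist (gmE g F x) (gmE g F y) ≤ dist x y := by
  rw [dist_pi_le_iff dist_nonneg]
  intro j
  refine le_trans (le_of_eq ?_) (dist_le_pi_dist x y ((g.axisMap F)⁻¹ j))
  simp only [gmE, Real.dist_eq]
  rw [← mul_sub, abs_mul, abs_mul, abs_sg, abs_sg, one_mul, one_mul]

theorem face_face (g : Gluing) (F : OctFace) : g.face (g.face F) = F := g.2.1 F
theorem face_ne (g : Gluing) (F : OctFace) : g.face F ≠ F := g.2.2.1 F
theorem axis_face (g : Gluing) (F : OctFace) : g.axisMap (g.face F) = (g.axisMap F)⁻¹ := g.2.2.2.1 F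
theorem axis_sign (g : Gluing) (F : OctFace) :
    Equiv.Perm.sign (g.axisMap F) = 1 ↔ faceSign F ≠ faceSign (g.face F) := g.2.2.2.2 F

theorem gmE_gmE (g : Gluing) (F : OctFace) (x : Fin 3 → ℝ) : gmE g (g.face F) (gmE g F x) = x := by
  ext j
  have h0 : (g.axisMap F)⁻¹ (g.axisMap F j) = j := by simp
  simp only [gmE, axis_face, face_face, inv_inv, h0]
  have h1 := sg_mul_self (F j)
  have h2 := sg_mul_self (g.face F (g.axisMap F j))
  calc _ = (sg (F j) * sg (F j)) * (sg (g.face F (g.axisMap F j)) * sg (g.face F (g.axisMap F j))) * x j := by ring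
    _ = x j := by rw [h1, h2]; ring

theorem gmE_face (g : Gluing) (F : OctFace) {x : Fin 3 → ℝ} (hx : x ∈ Fc F) :
    gmE g F x ∈ Fc (g.face F) := by
  have e : ∀ j, sg (g.face F j) * gmE g F x j =
      sg (F ((g.axisMap F)⁻¹ j)) * x ((g.axisMap F)⁻¹ j) := by
    intro j
    simp only [gmE]
    have h2 := sg_mul_self (g.face F j)
    calc _ = (sg (g.face F j) * sg (g.face F j)) * (sg (F ((g.axisMap F)⁻¹ j)) * x ((g.axisMap F)⁻¹ j)) := by ring
      _ = _ := by rw [h2, one_mul]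
  refine ⟨fun j => ?_, ?_⟩
  · rw [e]; exact hx.1 _
  · simp only [e]
    rw [Equiv.sum_comp (g.axisMap F)⁻¹ (fun i => sg (F i) * x i)]
    exact hx.2

/-- gluing maps on the solid octahedron -/
def gm (g : Gluing) (F : OctFace) (x : SolidOcta) : SolidOcta := ⟨gmE g F x, gmE_mem g F x.2⟩

theorem gm_gm (g : Gluing) (F : OctFace) (x : SolidOcta) : gm g (g.face F) (gm g F x) = x :=
  Subtype.ext (gmE_gmE g F x)

theorem dist_gm (g : Gluing) (F : OctFace) (x y : SolidOcta) :
    dist (gm g F x) (gm g F y) ≤ dist x y := dist_gmE g F x y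

theorem gm_continuous (g : Gluing) (F : OctFace) : Continuous (gm g F) :=
  (LipschitzWith.of_dist_le_mul (K := 1) fun x y => by simpa using dist_gm g F x y).continuous

/-- closed faces in the subtype -/
def Fs (F : OctFace) : Set SolidOcta := {x | (x : Fin 3 → ℝ) ∈ Fc F}

theorem Fs_closed (F : OctFace) : IsClosed (Fs F) := (Fc_closed F).preimage continuous_subtype_val

theorem gm_face (g : Gluing) (F : OctFace) {x : SolidOcta} (hx : x ∈ Fs F) :
    gm g F x ∈ Fs (g.face F) := gmE_face g F hx

theorem sum_smul_vertexPt (w : Fin 3 → ℝ) (f : Fin 3 → Bool) (p : Equiv.Perm (Fin 3)) (j : Fin 3) :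
    (∑ i, w i • vertexPt (p i, f (p i))) j = w (p⁻¹ j) * sg (f j) := by
  rw [Finset.sum_apply]
  rw [Finset.sum_eq_single (p⁻¹ j)]
  · simp [vertexPt_apply]
  · intro i _ hi
    rw [Pi.smul_apply, vertexPt_apply, if_neg, smul_zero]
    rintro rfl
    exact hi (by simp)
  · simp

theorem glueRel_iff (g : Gluing) (x y : SolidOcta) :
    glueRel g x y ↔ ∃ F, x ∈ Fs F ∧ y = gm g F x := by
  constructor
  · rintro ⟨F, w, hw0, hw1, hx, hy⟩
    have ex : ∀ i, (x : Fin 3 → ℝ) i = w i * sg (F i) := by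
      intro i
      rw [hx]
      simpa using sum_smul_vertexPt w F 1 i
    have ey : ∀ i, (y : Fin 3 → ℝ) i = w ((g.axisMap F)⁻¹ i) * sg (g.face F i) := by
      intro i
      rw [hy]
      exact sum_smul_vertexPt w (g.face F) (g.axisMap F) i
    have es : ∀ i, sg (F i) * (x : Fin 3 → ℝ) i = w i := by
      intro i
      rw [ex, mul_comm, mul_assoc, sg_mul_self, mul_one]
    refine ⟨F, ⟨fun i => ?_, ?_⟩, Subtype.ext (funext fun j => ?_)⟩
    · rw [es]; exact hw0 i
    · simp only [es]; exact hw1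
    · rw [ey]
      simp only [gm, gmE]
      rw [mul_assoc, es, mul_comm]
  · rintro ⟨F, hx, rfl⟩
    refine ⟨F, fun i => sg (F i) * (x : Fin 3 → ℝ) i, hx.1, hx.2, ?_, ?_⟩
    · ext i
      have := sum_smul_vertexPt (fun i => sg (F i) * (x : Fin 3 → ℝ) i) F 1 i
      simp only [Equiv.Perm.one_apply, inv_one] at this
      rw [this, mul_comm, ← mul_assoc, sg_mul_self, one_mul]
    · ext i
      rw [sum_smul_vertexPt]
      simp only [gm, gmE]
      ring

/-- quotient projection -/
def pr (g : Gluing) (x : SolidOcta) : XSpace g := Quotient.mk (glueSetoid g) x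

theorem pr_continuous (g : Gluing) : Continuous (pr g) := continuous_quotient_mk'
theorem pr_quot (g : Gluing) : Topology.IsQuotientMap (pr g) := isQuotientMap_quotient_mk'
theorem pr_surj (g : Gluing) : Function.Surjective (pr g) := Quotient.mk_surjective

theorem pr_gm (g : Gluing) (F : OctFace) {x : SolidOcta} (hx : x ∈ Fs F) :
    pr g (gm g F x) = pr g x :=
  Quotient.sound (Relation.EqvGen.symm _ _ (Relation.EqvGen.rel _ _ ((glueRel_iff g _ _).2 ⟨F, hx, rfl⟩)))

/-- Invariant functions are constant on classes. -/
theorem inv_of_gm {α : Type} (g : Gluing) (f : SolidOcta → α)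
    (hf : ∀ F, ∀ x ∈ Fs F, f (gm g F x) = f x) {x y : SolidOcta} (h : pr g x = pr g y) : f x = f y := by
  have h' : Relation.EqvGen (glueRel g) x y := Quotient.exact h
  induction h' with
  | rel x y hxy =>
    obtain ⟨F, hF, rfl⟩ := (glueRel_iff g _ _).1 hxy
    exact (hf F _ hF).symm
  | refl => rfl
  | symm x y _ ih => exact (ih (Quotient.sound (by assumption))).symm
  | trans x y z h1 h2 ih1 ih2 =>
    exact (ih1 (Quotient.sound h1)).trans (ih2 (Quotient.sound h2))

/-- Quotient lift of an invariant function. -/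
theorem exists_lift {α : Type} (g : Gluing) (f : SolidOcta → α)
    (hf : ∀ F, ∀ x ∈ Fs F, f (gm g F x) = f x) : ∃ f' : XSpace g → α, ∀ x, f' (pr g x) = f x :=
  ⟨Quotient.lift f fun _ _ h => inv_of_gm g f hf (Quotient.sound h), fun _ => rfl⟩

theorem class_finite (g : Gluing) (y : XSpace g) : {x | pr g x = y}.Finite := by
  obtain ⟨x, rfl⟩ := pr_surj g y
  have hinv := fun a b => inv_of_gm (x := a) (y := b) g (fun x : SolidOcta => {a : Fin 3 → ℝ | ∃ p : Equiv.Perm (Fin 3), ∀ j, |a j| = |(x : Fin 3 → ℝ) (p j)|})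
    (by
      intro F x _
      ext a
      constructor
      · rintro ⟨p, hp⟩
        refine ⟨(g.axisMap F)⁻¹ * p, fun j => ?_⟩
        rw [hp j]
        exact abs_gmE g F x _
      · rintro ⟨p, hp⟩
        refine ⟨(g.axisMap F) * p, fun j => ?_⟩
        rw [hp j]
        refine Eq.symm ((abs_gmE g F x _).trans ?_)
        simp)
  have hfin : {a : Fin 3 → ℝ | ∃ p : Equiv.Perm (Fin 3), ∀ j, |a j| = |(x : Fin 3 → ℝ) (p j)|}.Finite := by
    have : (Set.pi Set.univ fun _ : Fin 3 => (Set.range fun i => |(x : Fin 3 → ℝ) i|) ∪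
        (Set.range fun i => -|(x : Fin 3 → ℝ) i|)).Finite :=
      Set.Finite.pi fun _ => (Set.finite_range _).union (Set.finite_range _)
    refine this.subset ?_
    rintro a ⟨p, hp⟩ j -
    rcases abs_choice (a j) with h | h
    · left; exact ⟨p j, by simp only; rw [← hp j, h]⟩
    · right; exact ⟨p j, by simp only; rw [← hp j, h, neg_neg]⟩
  refine Set.Finite.of_finite_image (f := Subtype.val) (hfin.subset ?_) Subtype.val_injective.injOn
  rintro _ ⟨a, ha, rfl⟩
  have := hinv a x (show pr g a = pr g x from ha)
  rw [← this]
  exact ⟨1, fun j => rfl⟩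

/-- saturated balls -/
theorem sat_balls (g : Gluing) (y : XSpace g) (Q : SolidOcta → ℝ → Prop)
    (hQ : ∀ x, pr g x = y → ∀ᶠ ε in nhdsWithin (0:ℝ) (Set.Ioi 0), Q x ε) :
    ∃ ε > 0, (∀ x, pr g x = y → Q x ε) ∧
      (∀ x, pr g x = y → ∀ F, ∀ a, dist a x < ε → a ∈ Fs F → x ∈ Fs F) := by
  have hf := class_finite g y
  have h1 : ∀ᶠ ε in nhdsWithin (0:ℝ) (Set.Ioi 0), ∀ x ∈ {x | pr g x = y}, Q x ε ∧
      ∀ F, ∀ a, dist a x < ε → a ∈ Fs F → x ∈ Fs F := by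
    rw [Filter.eventually_all_finite hf]
    intro x hx
    refine (hQ x hx).and ?_
    rw [Filter.eventually_all]
    intro F
    by_cases hxF : x ∈ Fs F
    · exact Filter.Eventually.of_forall fun ε a _ _ => hxF
    · obtain ⟨δ, hδ, hb⟩ := Metric.isOpen_iff.1 (Fs_closed F).isOpen_compl x hxF
      filter_upwards [Ioo_mem_nhdsGT hδ] with ε hε a ha haF
      exact absurd haF (hb (Metric.mem_ball.2 (ha.trans hε.2)))
  obtain ⟨ε, hε, hpos⟩ := (h1.and self_mem_nhdsWithin).exists
  exact ⟨ε, hpos, fun x hx => (hε x hx).1, fun x hx => (hε x hx).2⟩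

theorem sat_nbhd (g : Gluing) (y : XSpace g) (ε : ℝ) (hε : 0 < ε)
    (hF : ∀ x, pr g x = y → ∀ F, ∀ a, dist a x < ε → a ∈ Fs F → x ∈ Fs F) :
    ∀ᶠ z in nhds y, ∀ b, pr g b = z → ∃ x, pr g x = y ∧ dist b x < ε := by
  have step : ∀ F, ∀ b ∈ Fs F, (∃ x, pr g x = y ∧ dist b x < ε) →
      ∃ x, pr g x = y ∧ dist (gm g F b) x < ε := by
    rintro F b hb ⟨x, hx, hd⟩
    have hxF := hF x hx F b hd hb
    exact ⟨gm g F x, (pr_gm g F hxF).trans hx, (dist_gm g F b x).trans_lt hd⟩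
  have hinv : ∀ F, ∀ b ∈ Fs F, (∃ x, pr g x = y ∧ dist (gm g F b) x < ε) =
      ∃ x, pr g x = y ∧ dist b x < ε := by
    intro F b hb
    refine propext ⟨fun h => ?_, step F b hb⟩
    have := step (g.face F) (gm g F b) (gm_face g F hb) h
    rwa [gm_gm] at this
  obtain ⟨W, hW⟩ := exists_lift g (fun b => ∃ x, pr g x = y ∧ dist b x < ε) hinv
  have hWo : IsOpen {z | W z} := by
    rw [← (pr_quot g).isOpen_preimage]
    have : pr g ⁻¹' {z | W z} = ⋃ x ∈ {x | pr g x = y}, Metric.ball x ε := by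
      ext b
      simp [hW]
    rw [this]
    exact isOpen_biUnion fun _ _ => Metric.isOpen_ball
  obtain ⟨x, rfl⟩ := pr_surj g y
  have hy : pr g x ∈ {z | W z} := by
    change W (pr g x)
    rw [hW]
    exact ⟨x, rfl, by simpa using hε⟩
  filter_upwards [hWo.mem_nhds hy] with z hz b hb
  subst hb
  have hzw : W (pr g b) := hz
  rwa [hW] at hzw

/-- Neighbourhoods in the quotient. -/
theorem nhds_quot (g : Gluing) (y : XSpace g) (Q : SolidOcta → Prop)
    (hQ : ∀ x, pr g x = y → ∀ᶠ b in nhds x, Q b) :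
    ∀ᶠ z in nhds y, ∀ b, pr g b = z → Q b := by
  obtain ⟨ε, hε, h1, h2⟩ := sat_balls g y (fun x ε => ∀ b, dist b x < ε → Q b) (by
    intro x hx
    obtain ⟨δ, hδ, hb⟩ := Metric.eventually_nhds_iff.1 (hQ x hx)
    filter_upwards [Ioo_mem_nhdsGT hδ] with ε hε b hd
    exact hb (hd.trans hε.2))
  filter_upwards [sat_nbhd g y ε hε h2] with z hz b hb
  obtain ⟨x, hx, hd⟩ := hz b hb
  exact h1 x hx b hd

end OctaGlue

namespace OctaGlue

section invariant
variable (X : Type) [TopologicalSpace X] (G : Type) [Group G]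

/-- Local structures with finitely many exceptional points. -/
def LocStr (h : X → X → G) : Prop :=
  ∃ S : Set X, S.Finite ∧ ∀ y, y ∉ S → ∀ᶠ z in nhds y, ∃ c : G, ∀ᶠ a in nhds z, h z a = c * h y a

/-- Equivalence of local structures. -/
def LRel (h h' : X → X → G) : Prop :=
  ∃ (k : X → G) (S : Set X), S.Finite ∧ ∀ y, y ∉ S → ∃ c : G, ∀ᶠ a in nhds y,
    h' y a = c * h y a * k a

/-- The set of local structures up to equivalence: a topological invariant. -/
def HH : Type := Quot fun h h' : {h : X → X → G // LocStr X G h} => LRel X G h.1 h'.1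

end invariant

theorem LocStr.comp {X Y G : Type} [TopologicalSpace X] [TopologicalSpace Y] [Group G]
    (e : X ≃ₜ Y) {h : Y → Y → G} (hh : LocStr Y G h) : LocStr X G (fun x y => h (e x) (e y)) := by
  obtain ⟨S, hS, hl⟩ := hh
  refine ⟨e ⁻¹' S, hS.preimage e.injective.injOn, fun y hy => ?_⟩
  have := e.continuous.continuousAt.eventually (hl (e y) hy)
  filter_upwards [this] with z hz
  obtain ⟨c, hc⟩ := hz
  exact ⟨c, e.continuous.continuousAt.eventually hc⟩

theorem LRel.comp {X Y G : Type} [TopologicalSpace X] [TopologicalSpace Y] [Group G]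
    (e : X ≃ₜ Y) {h h' : Y → Y → G} (hh : LRel Y G h h') :
    LRel X G (fun x y => h (e x) (e y)) (fun x y => h' (e x) (e y)) := by
  obtain ⟨k, S, hS, hl⟩ := hh
  refine ⟨fun x => k (e x), e ⁻¹' S, hS.preimage e.injective.injOn, fun y hy => ?_⟩
  obtain ⟨c, hc⟩ := hl (e y) hy
  exact ⟨c, e.continuous.continuousAt.eventually hc⟩

/-- pullback -/
def HH.map {X Y G : Type} [TopologicalSpace X] [TopologicalSpace Y] [Group G]
    (e : X ≃ₜ Y) : HH Y G → HH X G :=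
  Quot.map (fun h => ⟨fun x y => h.1 (e x) (e y), h.2.comp e⟩) fun _ _ h => h.comp e

theorem HH.card_eq {X Y G : Type} [TopologicalSpace X] [TopologicalSpace Y] [Group G]
    (e : X ≃ₜ Y) : Nat.card (HH X G) = Nat.card (HH Y G) := by
  refine Nat.card_congr ⟨HH.map e.symm, HH.map e, ?_, ?_⟩
  · rintro ⟨h⟩
    change Quot.mk _ _ = Quot.mk _ _
    congr 1
    apply Subtype.ext
    funext x y
    simp
  · rintro ⟨h⟩
    change Quot.mk _ _ = Quot.mk _ _
    congr 1
    apply Subtype.ext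
    funext x y
    simp

variable {G : Type} [Group G]

/-- Monodromy assignments of a gluing. -/
def IsRep (g : Gluing) (t : OctFace → G) : Prop :=
  ∃ c : OctVertex → OctVertex → G, ∀ F i j, i ≠ j →
    c (g.axisMap F i, g.face F (g.axisMap F i)) (g.axisMap F j, g.face F (g.axisMap F j)) =
      t F * c (i, F i) (j, F j)

/-- matching of a local structure with a monodromy -/
def Match (g : Gluing) (h : XSpace g → XSpace g → G) (t : OctFace → G) : Prop :=
  ∃ (k : SolidOcta → G) (S : Set (XSpace g)), S.Finite ∧
    (∀ x, pr g x ∉ S → ∃ c : G, ∀ᶠ a in nhds x, h (pr g x) (pr g a) = c * k a) ∧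
    (∀ F, ∀ x ∈ Fs F, pr g x ∉ S → k (gm g F x) = t F * k x)

theorem sat_finite (g : Gluing) {S : Set (XSpace g)} (hS : S.Finite) : {x | pr g x ∈ S}.Finite := by
  have : {x | pr g x ∈ S} = ⋃ y ∈ S, {x | pr g x = y} := by ext x; simp
  rw [this]
  exact hS.biUnion fun y _ => class_finite g y

/-- points on edges -/
noncomputable def edgeP (u v : OctVertex) (l : unitInterval) : SolidOcta :=
  ⟨(l : ℝ) • vertexPt u + (1 - l : ℝ) • vertexPt v,
    solid_convex (vertexPt_mem_solidOcta u) (vertexPt_mem_solidOcta v) l.2.1 (sub_nonneg.2 l.2.2)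
      (by ring)⟩

theorem edgeP_apply (u v : OctVertex) (l : unitInterval) (j : Fin 3) :
    (edgeP u v l : Fin 3 → ℝ) j =
      (if j = u.1 then (l : ℝ) * sg u.2 else 0) + (if j = v.1 then (1 - l : ℝ) * sg v.2 else 0) := by
  obtain ⟨i, b⟩ := u
  obtain ⟨i', b'⟩ := v
  simp only [edgeP, Pi.add_apply, Pi.smul_apply, vertexPt_apply, smul_eq_mul, mul_ite, mul_zero]

theorem edgeP_mem_Fs (F : OctFace) (i j : Fin 3) (l : unitInterval) :
    edgeP (i, F i) (j, F j) l ∈ Fs F :=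
  Fc_convex F (vertexPt_mem_Fc F i) (vertexPt_mem_Fc F j) l.2.1 (sub_nonneg.2 l.2.2) (by ring)

theorem gm_edgeP (g : Gluing) (F : OctFace) (i j : Fin 3) (l : unitInterval) :
    gm g F (edgeP (i, F i) (j, F j) l) =
      edgeP (g.axisMap F i, g.face F (g.axisMap F i)) (g.axisMap F j, g.face F (g.axisMap F j)) l := by
  apply Subtype.ext
  funext k
  rw [edgeP_apply]
  simp only [gm, gmE, edgeP_apply]
  have key : ∀ i, ((g.axisMap F)⁻¹ k = i) ↔ k = g.axisMap F i := fun i => Equiv.Perm.inv_eq_iff_eq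
  have key2 : ∀ i (r : ℝ), (sg (g.face F k) * sg (F ((g.axisMap F)⁻¹ k))) *
      (if (g.axisMap F)⁻¹ k = i then r * sg (F i) else 0) =
      if k = g.axisMap F i then r * sg (g.face F (g.axisMap F i)) else 0 := by
    intro i r
    by_cases h : k = g.axisMap F i
    · have h' := (key i).2 h
      rw [if_pos h', if_pos h, h', ← h]
      have := sg_mul_self (F i)
      linear_combination (sg (g.face F k) * r) * this
    · rw [if_neg h, if_neg (fun h' => h ((key i).1 h')), mul_zero]
  rw [mul_add, key2, key2]

theorem exists_good_param (g : Gluing) {S : Set (XSpace g)} (hS : S.Finite) :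
    ∃ l : unitInterval, ∀ u v : OctVertex, u.1 ≠ v.1 → pr g (edgeP u v l) ∉ S := by
  have hf : {l : unitInterval | ∃ u v : OctVertex, u.1 ≠ v.1 ∧ pr g (edgeP u v l) ∈ S}.Finite := by
    have : {l : unitInterval | ∃ u v : OctVertex, u.1 ≠ v.1 ∧ pr g (edgeP u v l) ∈ S} =
        ⋃ u : OctVertex, ⋃ v : OctVertex, {l | u.1 ≠ v.1 ∧ pr g (edgeP u v l) ∈ S} := by
      ext l; simp
    rw [this]
    refine Set.finite_iUnion fun u => Set.finite_iUnion fun v => ?_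
    by_cases huv : u.1 = v.1
    · simp [huv]
    · refine Set.Finite.of_finite_image (f := edgeP u v) ((sat_finite g hS).subset ?_) ?_
      · rintro _ ⟨l, hl, rfl⟩
        exact hl.2
      · intro l _ l' _ h
        have := congrFun (congrArg Subtype.val h) u.1
        rw [edgeP_apply, edgeP_apply] at this
        simp only [if_true, if_neg huv, add_zero] at this
        exact Subtype.ext (mul_right_cancel₀ (sg_ne _) this)
  have : Infinite unitInterval := (Set.Icc_infinite (zero_lt_one (α := ℝ))).to_subtype
  obtain ⟨l, hl⟩ := hf.infinite_compl.nonempty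
  refine ⟨l, fun u v huv h => hl ⟨u, v, huv, h⟩⟩

/-- Every local structure has a monodromy. -/
theorem exists_monodromy (g : Gluing) (h : XSpace g → XSpace g → G) (hh : LocStr (XSpace g) G h) :
    ∃ t : OctFace → G, IsRep g t ∧ Match g h t := by
  obtain ⟨S, hS, hl⟩ := hh
  have hT := sat_finite g hS
  obtain ⟨k, hk⟩ := triv_subtype solid_compact solid_convex solid_interior hT
    (fun x a => h (pr g x) (pr g a)) (by
      intro y hy
      filter_upwards [(pr_continuous g).continuousAt.eventually (hl (pr g y) hy)] with z hz
      obtain ⟨c, hc⟩ := hz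
      exact ⟨c, (pr_continuous g).continuousAt.eventually hc⟩)
  have hloc : ∀ F, ∃ t : G, ∀ x ∈ Fs F, pr g x ∉ S → k (gm g F x) = t * k x := by
    intro F
    have hp := precon_face F hT
    have hc := const_of_loc hp (fun x => k (gm g F x) * (k x)⁻¹) (by
      rintro x ⟨hxF, hxS⟩
      have hxF' : x ∈ Fs F := hxF
      obtain ⟨c, hc⟩ := hk x hxS
      have hS' : gm g F x ∉ {x | pr g x ∈ S} := by
        intro h'
        have h'' : pr g (gm g F x) ∈ S := h'
        rw [pr_gm g F hxF'] at h''
        exact hxS h''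
      obtain ⟨c', hc'⟩ := hk _ hS'
      have hc'' := (gm_continuous g F).continuousAt.eventually hc'
      have e1 := hc.self_of_nhds
      have e2 := hc''.self_of_nhds
      rw [pr_gm g F hxF'] at e2 hc''
      filter_upwards [nhdsWithin_le_nhds hc, nhdsWithin_le_nhds hc'', self_mem_nhdsWithin] with a h1 h2 h3
      rw [pr_gm g F (show a ∈ Fs F from h3.1)] at h2
      have f1 : k x = c⁻¹ * h (pr g x) (pr g x) := by rw [e1]; group
      have f2 : k (gm g F x) = c'⁻¹ * h (pr g x) (pr g x) := by rw [e2]; group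
      have f3 : k a = c⁻¹ * h (pr g x) (pr g a) := by rw [h1]; group
      have f4 : k (gm g F a) = c'⁻¹ * h (pr g x) (pr g a) := by rw [h2]; group
      rw [f1, f2, f3, f4]; group)
    obtain ⟨l, hl⟩ := exists_good_param g hS
    set x0 := edgeP (0, F 0) (1, F 1) l
    refine ⟨k (gm g F x0) * (k x0)⁻¹, fun x hx hxS => ?_⟩
    have := hc x ⟨hx, hxS⟩ x0 ⟨edgeP_mem_Fs F 0 1 l, hl _ _ (by simp)⟩
    rw [← this]; group
  choose t ht using hloc
  refine ⟨t, ?_, k, S, hS, hk, ht⟩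
  obtain ⟨l, hl⟩ := exists_good_param g hS
  refine ⟨fun u v => k (edgeP u v l), fun F i j hij => ?_⟩
  have e := gm_edgeP g F i j l
  simp only
  rw [← e]
  exact ht F _ (edgeP_mem_Fs F i j l) (hl _ _ hij)

theorem match_conj (g : Gluing) {h h' : XSpace g → XSpace g → G} {t t' : OctFace → G}
    (hm : Match g h t) (hm' : Match g h' t') (hr : LRel (XSpace g) G h h') :
    ∃ d : G, ∀ F, t' F = d * t F * d⁻¹ := by
  obtain ⟨k, S, hS, hk, hkt⟩ := hm
  obtain ⟨k', S', hS', hk', hkt'⟩ := hm'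
  obtain ⟨q, S'', hS'', hq⟩ := hr
  have hU := (hS.union hS').union hS''
  have hT := sat_finite g hU
  have hc := const_of_loc (precon_solid hT) (fun x => k' x * (q (pr g x))⁻¹ * (k x)⁻¹) (by
    intro x hx
    have hx1 : pr g x ∉ S := fun h => hx (Or.inl (Or.inl h))
    have hx2 : pr g x ∉ S' := fun h => hx (Or.inl (Or.inr h))
    have hx3 : pr g x ∉ S'' := fun h => hx (Or.inr h)
    obtain ⟨c, hc⟩ := hk x hx1
    obtain ⟨c', hc'⟩ := hk' x hx2
    obtain ⟨c'', hc''⟩ := hq _ hx3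
    have hc2 := (pr_continuous g).continuousAt.eventually hc''
    have key : ∀ a, h (pr g x) (pr g a) = c * k a → h' (pr g x) (pr g a) = c' * k' a →
        h' (pr g x) (pr g a) = c'' * h (pr g x) (pr g a) * q (pr g a) →
        k' a * (q (pr g a))⁻¹ * (k a)⁻¹ = c'⁻¹ * c'' * c := by
      intro a h1 h2 h3
      rw [h1, h2] at h3
      have : k' a = c'⁻¹ * (c'' * (c * k a) * q (pr g a)) := by rw [← h3]; group
      rw [this]; group
    have e := key x hc.self_of_nhds hc'.self_of_nhds hc2.self_of_nhds
    filter_upwards [nhdsWithin_le_nhds hc, nhdsWithin_le_nhds hc', nhdsWithin_le_nhds hc2] with a h1 h2 h3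
    rw [e, key a h1 h2 h3])
  obtain ⟨l, hl⟩ := exists_good_param g hU
  set x0 := edgeP (0, true) (1, true) l
  set d := k' x0 * (q (pr g x0))⁻¹ * (k x0)⁻¹ with hd
  have hall : ∀ x, pr g x ∉ S ∪ S' ∪ S'' → k' x = d * k x * q (pr g x) := by
    intro x hx
    have e : k' x * (q (pr g x))⁻¹ * (k x)⁻¹ = k' x0 * (q (pr g x0))⁻¹ * (k x0)⁻¹ :=
      hc x hx x0 (hl _ _ (by decide))
    rw [hd, ← e]; group
  refine ⟨d, fun F => ?_⟩
  set x := edgeP (0, F 0) (1, F 1) l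
  have hxF : x ∈ Fs F := edgeP_mem_Fs F 0 1 l
  have hxS : pr g x ∉ S ∪ S' ∪ S'' := hl _ _ (by simp)
  have h1 := hkt F x hxF (fun h => hxS (Or.inl (Or.inl h)))
  have h2 := hkt' F x hxF (fun h => hxS (Or.inl (Or.inr h)))
  have h3 := hall x hxS
  have h4 := hall (gm g F x) (by rw [pr_gm g F hxF]; exact hxS)
  rw [pr_gm g F hxF, h1] at h4
  rw [h2, h3] at h4
  have : t' F * d = d * t F := by
    have h5 : (t' F * d) * (k x * q (pr g x)) = (d * t F) * (k x * q (pr g x)) := by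
      calc _ = t' F * (d * k x * q (pr g x)) := by group
        _ = d * (t F * k x) * q (pr g x) := h4
        _ = _ := by group
    exact mul_right_cancel h5
  rw [← this]; group

theorem conj_match (g : Gluing) {h h' : XSpace g → XSpace g → G} {t t' : OctFace → G}
    (hm : Match g h t) (hm' : Match g h' t') (hr : ∃ d : G, ∀ F, t' F = d * t F * d⁻¹) :
    LRel (XSpace g) G h h' := by
  classical
  obtain ⟨k, S, hS, hk, hkt⟩ := hm
  obtain ⟨k', S', hS', hk', hkt'⟩ := hm'
  obtain ⟨d, hd⟩ := hr
  obtain ⟨q, hq⟩ := exists_lift g (fun x => if pr g x ∈ S ∪ S' then (1 : G) else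
      (k x)⁻¹ * d⁻¹ * k' x) (by
    intro F x hx
    simp only [pr_gm g F hx]
    split_ifs with hs
    · rfl
    · rw [hkt F x hx (fun h => hs (Or.inl h)), hkt' F x hx (fun h => hs (Or.inr h)), hd]
      group)
  refine ⟨q, S ∪ S', hS.union hS', fun y hy => ?_⟩
  have hcl : IsClosed {x | pr g x ∈ S ∪ S'} := (sat_finite g (hS.union hS')).isClosed
  refine ⟨h' y y * (q y)⁻¹ * (h y y)⁻¹, ?_⟩
  have := nhds_quot g y (fun b => h' y (pr g b) = h' y y * (q y)⁻¹ * (h y y)⁻¹ * h y (pr g b) * q (pr g b)) (by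
    intro x hx
    subst hx
    obtain ⟨c, hc⟩ := hk x (fun h => hy (Or.inl h))
    obtain ⟨c', hc'⟩ := hk' x (fun h => hy (Or.inr h))
    have e1 := hc.self_of_nhds
    have e2 := hc'.self_of_nhds
    have ho : ∀ᶠ b in nhds x, b ∉ {x | pr g x ∈ S ∪ S'} := hcl.isOpen_compl.mem_nhds hy
    filter_upwards [hc, hc', ho] with b h1 h2 h3
    have hb : pr g b ∉ S ∪ S' := h3
    rw [e1, e2, h1, h2, hq, hq, if_neg hy, if_neg hb]
    group)
  filter_upwards [this] with z hz
  obtain ⟨b, rfl⟩ := pr_surj g z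
  exact hz b rfl

end OctaGlue

namespace OctaGlue
variable {G : Type} [Group G]

theorem edgeP_unique {u v u' v' : OctVertex} {l l' : unitInterval} (huv : u.1 ≠ v.1)
    (huv' : u'.1 ≠ v'.1) (h1 : (1/2 : ℝ) < l) (h2 : (l : ℝ) < 1) (h1' : (1/2 : ℝ) < l')
    (h2' : (l' : ℝ) < 1) (h : edgeP u v l = edgeP u' v' l') : u = u' ∧ v = v' := by
  have e : ∀ j, (edgeP u v l : Fin 3 → ℝ) j = (edgeP u' v' l' : Fin 3 → ℝ) j := fun j => by rw [h]
  obtain ⟨i, b⟩ := u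
  obtain ⟨j, c⟩ := v
  obtain ⟨i', b'⟩ := u'
  obtain ⟨j', c'⟩ := v'
  simp only at huv huv'
  simp only [edgeP_apply] at e
  have hii : i = i' := by
    by_contra hne
    have e1 := e i
    simp only [if_true, if_neg huv, if_neg hne] at e1
    have e2 := congrArg abs e1
    simp only [add_zero, zero_add, abs_mul, abs_sg, mul_one] at e2
    rw [abs_of_pos (by linarith)] at e2
    split_ifs at e2
    · rw [abs_mul, abs_sg, abs_of_pos (by linarith)] at e2
      linarith
    · rw [abs_zero] at e2; linarith
  subst hii
  have hjj : j = j' := by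
    by_contra hne
    have e1 := e j
    simp only [if_true, if_neg (Ne.symm huv), if_neg hne] at e1
    have : (1 - l : ℝ) * sg c ≠ 0 := mul_ne_zero (by linarith) (sg_ne c)
    apply this
    linarith
  subst hjj
  have e1 := e i
  have e2 := e j
  simp only [if_true, if_neg huv, if_neg (Ne.symm huv)] at e1 e2
  have hbb : b = b' := by
    cases b <;> cases b' <;> simp [sg] at e1 ⊢ <;> linarith
  have hcc : c = c' := by
    cases c <;> cases c' <;> simp [sg] at e2 ⊢ <;> linarith
  subst hbb hcc
  exact ⟨rfl, rfl⟩

/-- special points -/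
def special (g : Gluing) : Set (XSpace g) :=
  {y | ∃ u v : OctVertex, ∃ l : unitInterval, ((l : ℝ) = 1 / 2 ∨ (l : ℝ) = 1) ∧ y = pr g (edgeP u v l)}

theorem special_finite (g : Gluing) : (special g).Finite := by
  have : special g ⊆ ⋃ u : OctVertex, ⋃ v : OctVertex,
      (fun l => pr g (edgeP u v l)) '' {l | (l : ℝ) = 1 / 2 ∨ (l : ℝ) = 1} := by
    rintro y ⟨u, v, l, hl, rfl⟩
    simp only [Set.mem_iUnion]
    exact ⟨u, v, l, hl, rfl⟩
  refine Set.Finite.subset ?_ this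
  refine Set.finite_iUnion fun u => Set.finite_iUnion fun v => Set.Finite.image _ ?_
  have h2 : ({1 / 2, 1} : Set ℝ).Finite := by simp
  refine (h2.preimage Subtype.val_injective.injOn).subset ?_
  intro l hl
  simpa using hl

/-- A point of a face with a vanishing coordinate which is not special. -/
theorem edge_form (g : Gluing) {F : OctFace} {x : SolidOcta} (hx : x ∈ Fs F)
    (h0 : ¬ ∀ i, (x : Fin 3 → ℝ) i ≠ 0) (hs : pr g x ∉ special g) :
    ∃ i j, ∃ l : unitInterval, i ≠ j ∧ (1/2 : ℝ) < l ∧ (l : ℝ) < 1 ∧ x = edgeP (i, F i) (j, F j) l := by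
  push Not at h0
  obtain ⟨k, hk⟩ := h0
  -- general fact
  have key : ∀ i j : Fin 3, i ≠ j → i ≠ k → j ≠ k → ∃ l : unitInterval,
      (l : ℝ) = sg (F i) * (x : Fin 3 → ℝ) i ∧ x = edgeP (i, F i) (j, F j) l := by
    intro i j hij hik hjk
    have hsum := hx.2
    have huniv : (Finset.univ : Finset (Fin 3)) = {i, j, k} := by
      revert hij hik hjk; clear * -; revert i j k; decide
    rw [huniv, Finset.sum_insert (by simp [hij, hik]), Finset.sum_insert (by simp [hjk]),
      Finset.sum_singleton, hk, mul_zero, add_zero] at hsum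
    have h1 := hx.1 i
    have h2 := hx.1 j
    refine ⟨⟨sg (F i) * (x : Fin 3 → ℝ) i, h1, by linarith⟩, rfl, ?_⟩
    apply Subtype.ext
    funext m
    rw [edgeP_apply]
    have hi2 := sg_mul_self (F i)
    have hj2 := sg_mul_self (F j)
    have hm : m = i ∨ m = j ∨ m = k := by
      have := Finset.mem_univ m
      rw [huniv] at this
      simpa using this
    rcases hm with rfl | rfl | rfl
    · simp only [if_true, if_neg hij, add_zero]
      linear_combination (-(x : Fin 3 → ℝ) m) * hi2
    · simp only [if_true, if_neg hij.symm, zero_add]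
      linear_combination (-(x : Fin 3 → ℝ) m) * hj2 + sg (F m) * hsum
    · simp only [if_neg hik.symm, if_neg hjk.symm, add_zero]
      exact hk
  have hk1 : k + 1 ≠ k + 2 ∧ k + 1 ≠ k ∧ k + 2 ≠ k := by clear * -; revert k; decide
  obtain ⟨l, hl, e⟩ := key (k + 1) (k + 2) hk1.1 hk1.2.1 hk1.2.2
  obtain ⟨l', hl', e'⟩ := key (k + 2) (k + 1) hk1.1.symm hk1.2.2 hk1.2.1
  have hll : (l : ℝ) + l' = 1 := by
    have h1 := congrFun (congrArg Subtype.val e) (k + 2)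
    rw [edgeP_apply] at h1
    simp only [if_true, if_neg hk1.1.symm, zero_add] at h1
    rw [hl', h1]
    have := sg_mul_self (F (k + 2))
    linear_combination (1 - (l : ℝ)) * this
  have n1 : (l : ℝ) ≠ 1 / 2 := fun h => hs ⟨_, _, l, Or.inl h, by rw [← e]⟩
  have n2 : (l : ℝ) ≠ 1 := fun h => hs ⟨_, _, l, Or.inr h, by rw [← e]⟩
  have n3 : (l' : ℝ) ≠ 1 := fun h => hs ⟨_, _, l', Or.inr h, by rw [← e']⟩
  rcases lt_or_gt_of_ne n1 with h | h
  · refine ⟨_, _, l', hk1.1.symm, by linarith, lt_of_le_of_ne l'.2.2 n3, e'⟩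
  · exact ⟨_, _, l, hk1.1, h, lt_of_le_of_ne l.2.2 n2, e⟩

theorem rep_inv {g : Gluing} {t : OctFace → G} (ht : IsRep g t) (F : OctFace) :
    t (g.face F) * t F = 1 := by
  obtain ⟨c, hc⟩ := ht
  have h1 := hc F 0 1 (by decide)
  have h2 := hc (g.face F) (g.axisMap F 0) (g.axisMap F 1) (by simp)
  have e : ∀ i, (g.axisMap F)⁻¹ (g.axisMap F i) = i := fun i => by simp
  rw [h1, axis_face, face_face] at h2
  simp only [e] at h2
  rw [← mul_assoc] at h2
  exact mul_right_cancel (b := c (0, F 0) (1, F 1)) (by rw [one_mul]; exact h2.symm)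

theorem exists_face_pot {g : Gluing} {t : OctFace → G} (ht : IsRep g t) :
    ∃ d : OctFace → G, ∀ F, d (g.face F) = t F * d F := by
  classical
  set e := Fintype.equivFin OctFace
  refine ⟨fun F => if e F < e (g.face F) then 1 else t (g.face F), fun F => ?_⟩
  simp only [face_face]
  have hne : e (g.face F) ≠ e F := fun h => face_ne g F (e.injective h)
  have hi := rep_inv ht F
  rcases lt_or_gt_of_ne hne with h | h
  · rw [if_pos h, if_neg (not_lt.2 h.le)]
    exact (mul_eq_one_comm.1 hi).symm
  · rw [if_neg (not_lt.2 h.le), if_pos h, mul_one]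

theorem sign_of_Fs {F : OctFace} {x : SolidOcta} (hx : x ∈ Fs F) (h0 : ∀ i, (x : Fin 3 → ℝ) i ≠ 0) :
    (fun i => decide (0 < (x : Fin 3 → ℝ) i)) = F := by
  funext i
  have h1 := hx.1 i
  have h2 := h0 i
  cases hF : F i
  · rw [hF] at h1
    simp only [sg, Bool.false_eq_true, if_false] at h1
    simp only [decide_eq_false_iff_not, not_lt]; linarith
  · rw [hF] at h1
    simp only [sg, if_true, one_mul] at h1
    simp only [decide_eq_true_eq]
    exact lt_of_le_of_ne h1 (Ne.symm h2)

/-- Equivariant potential on the solid octahedron. -/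
theorem exists_pot {g : Gluing} {t : OctFace → G} (ht : IsRep g t) :
    ∃ k : SolidOcta → G, ∀ F, ∀ x ∈ Fs F, pr g x ∉ special g → k (gm g F x) = t F * k x := by
  classical
  obtain ⟨d, hd⟩ := exists_face_pot ht
  obtain ⟨c, hc⟩ := ht
  have hex : ∃ k2 : SolidOcta → G, ∀ u v : OctVertex, ∀ l : unitInterval, u.1 ≠ v.1 →
      (1/2 : ℝ) < l → (l : ℝ) < 1 → k2 (edgeP u v l) = c u v := by
    refine ⟨fun x => if h : ∃ p : OctVertex × OctVertex, ∃ l : unitInterval, p.1.1 ≠ p.2.1 ∧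
      (1/2 : ℝ) < l ∧ (l : ℝ) < 1 ∧ x = edgeP p.1 p.2 l then c h.choose.1 h.choose.2 else 1, ?_⟩
    intro u v l huv h1 h2
    have h : ∃ p : OctVertex × OctVertex, ∃ l' : unitInterval, p.1.1 ≠ p.2.1 ∧
      (1/2 : ℝ) < l' ∧ (l' : ℝ) < 1 ∧ edgeP u v l = edgeP p.1 p.2 l' := ⟨(u, v), l, huv, h1, h2, rfl⟩
    simp only
    rw [dif_pos h]
    obtain ⟨l', a1, a2, a3, a4⟩ := h.choose_spec
    obtain ⟨b1, b2⟩ := edgeP_unique huv a1 h1 h2 a2 a3 a4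
    rw [← b1, ← b2]
  obtain ⟨k2, hk2⟩ := hex
  refine ⟨fun x => if ∀ i, (x : Fin 3 → ℝ) i ≠ 0 then d (fun i => decide (0 < (x : Fin 3 → ℝ) i))
    else k2 x, fun F x hx hs => ?_⟩
  have hiff : (∀ i, (gm g F x : Fin 3 → ℝ) i ≠ 0) ↔ ∀ i, (x : Fin 3 → ℝ) i ≠ 0 := by
    have e : ∀ i, (gm g F x : Fin 3 → ℝ) i ≠ 0 ↔ (x : Fin 3 → ℝ) ((g.axisMap F)⁻¹ i) ≠ 0 := by
      intro i
      rw [← abs_pos, ← abs_pos (a := (x : Fin 3 → ℝ) _), ← abs_gmE g F x i]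
      rfl
    constructor
    · intro h i
      have := (e (g.axisMap F i)).1 (h _)
      simpa using this
    · intro h i
      exact (e i).2 (h _)
  by_cases h0 : ∀ i, (x : Fin 3 → ℝ) i ≠ 0
  · simp only
    rw [if_pos h0, if_pos (hiff.2 h0), sign_of_Fs hx h0, sign_of_Fs (gm_face g F hx) (hiff.2 h0), hd]
  · simp only
    rw [if_neg h0, if_neg (fun h => h0 (hiff.1 h))]
    obtain ⟨i, j, l, hij, h1, h2, rfl⟩ := edge_form g hx h0 hs
    rw [gm_edgeP, hk2 _ _ l (by simpa using hij) h1 h2, hk2 _ _ l hij h1 h2, hc F i j hij]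

theorem exists_local (g : Gluing) {S : Set (XSpace g)} (hS : S.Finite) {t : OctFace → G}
    {k : SolidOcta → G} (hk : ∀ F, ∀ x ∈ Fs F, pr g x ∉ S → k (gm g F x) = t F * k x)
    (y : XSpace g) (hy : y ∉ S) :
    ∃ f : XSpace g → G, ∀ x, pr g x = y → ∀ᶠ a in nhds x, f (pr g a) = (k x)⁻¹ * k a := by
  classical
  have hcl : IsClosed {x | pr g x ∈ S} := (sat_finite g hS).isClosed
  obtain ⟨ε, hε, hQ, hF⟩ := sat_balls g y (fun x ε => (∀ x', pr g x' = y → x' ≠ x → 2 * ε ≤ dist x x') ∧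
      ∀ a, dist a x < ε → pr g a ∉ S) (by
    intro x hx
    refine Filter.Eventually.and ?_ ?_
    · have : ∀ᶠ ε in nhdsWithin (0:ℝ) (Set.Ioi 0), ∀ x' ∈ {x' | pr g x' = y}, x' ≠ x → 2 * ε ≤ dist x x' := by
        rw [Filter.eventually_all_finite (class_finite g y)]
        intro x' _
        by_cases h : x' = x
        · exact Filter.Eventually.of_forall fun ε h' => absurd h h'
        · have hd : 0 < dist x x' / 2 := half_pos (dist_pos.2 (Ne.symm h))
          filter_upwards [Ioo_mem_nhdsGT hd] with ε hε _
          linarith [hε.2]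
      exact this
    · have hx' : x ∈ {x | pr g x ∈ S}ᶜ := fun h => hy (hx ▸ h)
      obtain ⟨δ, hδ, hb⟩ := Metric.isOpen_iff.1 hcl.isOpen_compl x hx'
      filter_upwards [Ioo_mem_nhdsGT hδ] with ε hε a ha
      exact hb (Metric.mem_ball.2 (ha.trans hε.2)))
  have huniq : ∀ a x x', pr g x = y → pr g x' = y → dist a x < ε → dist a x' < ε → x = x' := by
    intro a x x' hx hx' h1 h2
    by_contra hne
    have := (hQ x hx).1 x' hx' (Ne.symm hne)
    have := dist_triangle_left x x' a
    linarith
  set f0 : SolidOcta → G := fun a => if h : ∃ x, pr g x = y ∧ dist a x < ε then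
    (k h.choose)⁻¹ * k a else 1 with hf0
  have f0v : ∀ a x, pr g x = y → dist a x < ε → f0 a = (k x)⁻¹ * k a := by
    intro a x hx hd
    have h : ∃ x, pr g x = y ∧ dist a x < ε := ⟨x, hx, hd⟩
    simp only [hf0]
    rw [dif_pos h, huniq a _ x h.choose_spec.1 hx h.choose_spec.2 hd]
  obtain ⟨f, hf⟩ := exists_lift g f0 (by
    intro F a ha
    by_cases h : ∃ x, pr g x = y ∧ dist a x < ε
    · obtain ⟨x, hx, hd⟩ := h
      have hxF := hF x hx F a hd ha
      rw [f0v a x hx hd, f0v (gm g F a) (gm g F x) ((pr_gm g F hxF).trans hx)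
        ((dist_gm g F a x).trans_lt hd)]
      rw [hk F x hxF (hx ▸ hy), hk F a ha ((hQ x hx).2 a hd)]
      group
    · have h' : ¬ ∃ x, pr g x = y ∧ dist (gm g F a) x < ε := by
        rintro ⟨x, hx, hd⟩
        have hxF := hF x hx (g.face F) _ hd (gm_face g F ha)
        refine h ⟨gm g (g.face F) x, (pr_gm g _ hxF).trans hx, ?_⟩
        have := dist_gm g (g.face F) (gm g F a) x
        rw [gm_gm] at this
        exact this.trans_lt hd
      simp only [hf0]
      rw [dif_neg h, dif_neg h'])
  refine ⟨f, fun x hx => ?_⟩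
  filter_upwards [Metric.ball_mem_nhds x hε] with a ha
  rw [hf, f0v a x hx (Metric.mem_ball.1 ha)]

/-- Every monodromy is realised. -/
theorem exists_structure (g : Gluing) {t : OctFace → G} (ht : IsRep g t) :
    ∃ h : XSpace g → XSpace g → G, LocStr (XSpace g) G h ∧ Match g h t := by
  obtain ⟨k, hk⟩ := exists_pot ht
  have hS := special_finite g
  choose! h hh using exists_local g hS hk
  have hcl : IsClosed {x | pr g x ∈ special g} := (sat_finite g hS).isClosed
  refine ⟨h, ⟨special g, hS, fun y hy => ?_⟩, k, special g, hS, fun x hx => ?_, hk⟩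
  · have := nhds_quot g y (fun b => pr g b ∉ special g ∧
      ∀ᶠ a in nhds b, h y (pr g a) = h y (pr g b) * ((k b)⁻¹ * k a)) (by
      intro x hx
      have hx' : pr g x ∉ special g := hx ▸ hy
      have ho : ∀ᶠ b in nhds x, b ∉ {x | pr g x ∈ special g} := hcl.isOpen_compl.mem_nhds hx'
      filter_upwards [ho, hh y hy x hx, (hh y hy x hx).eventually_nhds] with b hb h1 h2
      refine ⟨hb, ?_⟩
      filter_upwards [h2] with a ha
      rw [ha, h1]; group)
    filter_upwards [this] with z hz
    refine ⟨(h y z)⁻¹, ?_⟩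
    have h2 := nhds_quot g z (fun a => h z (pr g a) = (h y z)⁻¹ * h y (pr g a)) (by
      intro b hb
      obtain ⟨h3, h4⟩ := hz b hb
      rw [hb] at h3 h4
      filter_upwards [h4, hh z h3 b hb] with a h5 h6
      rw [h5, h6]; group)
    filter_upwards [h2] with w hw
    obtain ⟨a, rfl⟩ := pr_surj g w
    exact hw a rfl
  · exact ⟨(k x)⁻¹, hh _ hx x rfl⟩

/-- Monodromies up to conjugation -/
def RepQ (g : Gluing) (G : Type) [Group G] : Type :=
  Quot fun t t' : {t : OctFace → G // IsRep g t} => ∃ d : G, ∀ F, t'.1 F = d * t.1 F * d⁻¹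

theorem card_HH (g : Gluing) : Nat.card (HH (XSpace g) G) = Nat.card (RepQ g G) := by
  classical
  choose! τ hτ1 hτ2 using exists_monodromy (G := G) g
  have hconj : Equivalence fun t t' : {t : OctFace → G // IsRep g t} =>
      ∃ d : G, ∀ F, t'.1 F = d * t.1 F * d⁻¹ := by
    refine ⟨fun t => ⟨1, fun F => by simp⟩, ?_, ?_⟩
    · rintro t t' ⟨d, hd⟩
      exact ⟨d⁻¹, fun F => by rw [hd]; group⟩
    · rintro t t' t'' ⟨d, hd⟩ ⟨d', hd'⟩
      exact ⟨d' * d, fun F => by rw [hd', hd]; group⟩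
  refine Nat.card_congr (Equiv.ofBijective
    (Quot.map (fun h : {h : XSpace g → XSpace g → G // LocStr (XSpace g) G h} =>
      (⟨τ h.1, hτ1 h.1 h.2⟩ : {t : OctFace → G // IsRep g t})) ?_) ⟨?_, ?_⟩)
  · intro h h' hr
    exact match_conj g (hτ2 _ h.2) (hτ2 _ h'.2) hr
  · rintro ⟨h⟩ ⟨h'⟩ he
    have he' : Quot.mk _ (⟨τ h.1, hτ1 h.1 h.2⟩ : {t : OctFace → G // IsRep g t}) =
      Quot.mk _ (⟨τ h'.1, hτ1 h'.1 h'.2⟩ : {t : OctFace → G // IsRep g t}) := he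
    have hc := (hconj.eqvGen_iff).1 (Quot.eqvGen_exact he')
    exact Quot.sound (conj_match g (hτ2 _ h.2) (hτ2 _ h'.2) hc)
  · rintro ⟨t⟩
    obtain ⟨h, hl, hm⟩ := exists_structure g t.2
    refine ⟨Quot.mk _ ⟨h, hl⟩, ?_⟩
    refine Quot.sound ?_
    have hl' : LRel (XSpace g) G h h := ⟨fun _ => 1, ∅, Set.finite_empty, fun y _ => ⟨1, by simp⟩⟩
    exact match_conj g (hτ2 h hl) hm hl'

theorem homeo_card {g g' : Gluing} (e : XSpace g ≃ₜ XSpace g') (G : Type) [Group G] :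
    Nat.card (RepQ g G) = Nat.card (RepQ g' G) := by
  rw [← card_HH, ← card_HH, HH.card_eq e]

end OctaGlue

namespace OctaGlue

/-! ### Representatives -/

/-- Face with given signs. -/
def fc (a b c : Bool) : OctFace := ![a, b, c]

/-- Permutations of the axes. -/
def mkP (f h : Fin 3 → Fin 3) (h1 : ∀ i, h (f i) = i) (h2 : ∀ i, f (h i) = i) :
    Equiv.Perm (Fin 3) := ⟨f, h, h1, h2⟩

def p012 : Equiv.Perm (Fin 3) := mkP ![0, 1, 2] ![0, 1, 2] (by decide) (by decide)
def p120 : Equiv.Perm (Fin 3) := mkP ![1, 2, 0] ![2, 0, 1] (by decide) (by decide)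
def p201 : Equiv.Perm (Fin 3) := mkP ![2, 0, 1] ![1, 2, 0] (by decide) (by decide)
def p021 : Equiv.Perm (Fin 3) := mkP ![0, 2, 1] ![0, 2, 1] (by decide) (by decide)
def p102 : Equiv.Perm (Fin 3) := mkP ![1, 0, 2] ![1, 0, 2] (by decide) (by decide)
def p210 : Equiv.Perm (Fin 3) := mkP ![2, 1, 0] ![2, 1, 0] (by decide) (by decide)

/-- A gluing from tabulated data. -/
def mkG (d : OctFace → OctFace × Equiv.Perm (Fin 3)) (h1 : ∀ F, (d (d F).1).1 = F)
    (h2 : ∀ F, (d F).1 ≠ F) (h3 : ∀ F, (d (d F).1).2 = ((d F).2)⁻¹)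
    (h4 : ∀ F, Equiv.Perm.sign (d F).2 = 1 ↔ faceSign F ≠ faceSign (d F).1) : Gluing :=
  ⟨(⟨fun F => (d F).1, fun F => (d F).1, h1, h1⟩, fun F => (d F).2), h1, h2, h3, h4⟩

/-- Data of representative number 0. -/
def dat0 : OctFace → OctFace × Equiv.Perm (Fin 3) := fun F => match F 0, F 1, F 2 with
  | false, false, false => (fc false false true, p012)
  | false, false, true => (fc false false false, p012)
  | false, true, false => (fc false true true, p120)
  | false, true, true => (fc false true false, p201)
  | true, false, false => (fc true true true, p021)
  | true, false, true => (fc true true false, p021)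
  | true, true, false => (fc true false true, p021)
  | true, true, true => (fc true false false, p021)

/-- Representative number 0. -/
def rep0 : Gluing := mkG dat0 (by decide +kernel) (by decide +kernel) (by decide +kernel) (by decide +kernel)

/-- Data of representative number 1. -/
def dat1 : OctFace → OctFace × Equiv.Perm (Fin 3) := fun F => match F 0, F 1, F 2 with
  | false, false, false => (fc false false true, p012)
  | false, false, true => (fc false false false, p012)
  | false, true, false => (fc true false true, p012)
  | false, true, true => (fc true true false, p021)
  | true, false, false => (fc true true true, p021)
  | true, false, true => (fc false true false, p012)
  | true, true, false => (fc false true true, p021)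
  | true, true, true => (fc true false false, p021)

/-- Representative number 1. -/
def rep1 : Gluing := mkG dat1 (by decide +kernel) (by decide +kernel) (by decide +kernel) (by decide +kernel)

/-- Data of representative number 2. -/
def dat2 : OctFace → OctFace × Equiv.Perm (Fin 3) := fun F => match F 0, F 1, F 2 with
  | false, false, false => (fc false true true, p021)
  | false, false, true => (fc false true false, p021)
  | false, true, false => (fc false false true, p021)
  | false, true, true => (fc false false false, p021)
  | true, false, false => (fc true true true, p021)
  | true, false, true => (fc true true false, p021)
  | true, true, false => (fc true false true, p021)
  | true, true, true => (fc true false false, p021)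

/-- Representative number 2. -/
def rep2 : Gluing := mkG dat2 (by decide +kernel) (by decide +kernel) (by decide +kernel) (by decide +kernel)

/-- Data of representative number 3. -/
def dat3 : OctFace → OctFace × Equiv.Perm (Fin 3) := fun F => match F 0, F 1, F 2 with
  | false, false, false => (fc false true true, p021)
  | false, false, true => (fc false true false, p021)
  | false, true, false => (fc false false true, p021)
  | false, true, true => (fc false false false, p021)
  | true, false, false => (fc true true true, p021)
  | true, false, true => (fc true true false, p102)
  | true, true, false => (fc true false true, p102)
  | true, true, true => (fc true false false, p021)

/-- Representative number 3. -/
def rep3 : Gluing := mkG dat3 (by decide +kernel) (by decide +kernel) (by decide +kernel) (by decide +kernel)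

/-- Data of representative number 4. -/
def dat4 : OctFace → OctFace × Equiv.Perm (Fin 3) := fun F => match F 0, F 1, F 2 with
  | false, false, false => (fc false true true, p021)
  | false, false, true => (fc false true false, p021)
  | false, true, false => (fc false false true, p021)
  | false, true, true => (fc false false false, p021)
  | true, false, false => (fc true true true, p102)
  | true, false, true => (fc true true false, p102)
  | true, true, false => (fc true false true, p102)
  | true, true, true => (fc true false false, p102)

/-- Representative number 4. -/
def rep4 : Gluing := mkG dat4 (by decide +kernel) (by decide +kernel) (by decide +kernel) (by decide +kernel)

/-- Data of representative number 5. -/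
def dat5 : OctFace → OctFace × Equiv.Perm (Fin 3) := fun F => match F 0, F 1, F 2 with
  | false, false, false => (fc false true true, p021)
  | false, false, true => (fc false true false, p021)
  | false, true, false => (fc false false true, p021)
  | false, true, true => (fc false false false, p021)
  | true, false, false => (fc true true true, p102)
  | true, false, true => (fc true true false, p210)
  | true, true, false => (fc true false true, p210)
  | true, true, true => (fc true false false, p102)

/-- Representative number 5. -/
def rep5 : Gluing := mkG dat5 (by decide +kernel) (by decide +kernel) (by decide +kernel) (by decide +kernel)

/-- Data of representative number 6. -/
def dat6 : OctFace → OctFace × Equiv.Perm (Fin 3) := fun F => match F 0, F 1, F 2 with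
  | false, false, false => (fc false true true, p102)
  | false, false, true => (fc false true false, p102)
  | false, true, false => (fc false false true, p102)
  | false, true, true => (fc false false false, p102)
  | true, false, false => (fc true true true, p210)
  | true, false, true => (fc true true false, p210)
  | true, true, false => (fc true false true, p210)
  | true, true, true => (fc true false false, p210)

/-- Representative number 6. -/
def rep6 : Gluing := mkG dat6 (by decide +kernel) (by decide +kernel) (by decide +kernel) (by decide +kernel)

/-- Data of representative number 7. -/
def dat7 : OctFace → OctFace × Equiv.Perm (Fin 3) := fun F => match F 0, F 1, F 2 with
  | false, false, false => (fc false true true, p021)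
  | false, false, true => (fc true false false, p021)
  | false, true, false => (fc true true true, p021)
  | false, true, true => (fc false false false, p021)
  | true, false, false => (fc false false true, p021)
  | true, false, true => (fc true true false, p021)
  | true, true, false => (fc true false true, p021)
  | true, true, true => (fc false true false, p021)

/-- Representative number 7. -/
def rep7 : Gluing := mkG dat7 (by decide +kernel) (by decide +kernel) (by decide +kernel) (by decide +kernel)

/-- Data of representative number 8. -/
def dat8 : OctFace → OctFace × Equiv.Perm (Fin 3) := fun F => match F 0, F 1, F 2 with
  | false, false, false => (fc false true true, p102)
  | false, false, true => (fc true true false, p012)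
  | false, true, false => (fc true false true, p012)
  | false, true, true => (fc false false false, p102)
  | true, false, false => (fc true true true, p102)
  | true, false, true => (fc false true false, p012)
  | true, true, false => (fc false false true, p012)
  | true, true, true => (fc true false false, p102)

/-- Representative number 8. -/
def rep8 : Gluing := mkG dat8 (by decide +kernel) (by decide +kernel) (by decide +kernel) (by decide +kernel)

end OctaGlue

namespace OctaGlue

/-! ### Edge-ends indexed by the face on their left -/

abbrev En : Type := OctFace × Fin 3

def nx (F : OctFace) (i : Fin 3) : Fin 3 := if faceSign F then i + 1 else i + 2
def th (F : OctFace) (i : Fin 3) : Fin 3 := if faceSign F then i + 2 else i + 1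
def flipF (F : OctFace) (k : Fin 3) : OctFace := fun j => if j = k then !(F j) else F j

def rho (g : Gluing) (e : En) : En :=
  (flipF (g.face e.1) (g.axisMap e.1 (th e.1 e.2)), g.axisMap e.1 e.2)

def ends (e : En) : OctVertex × OctVertex := ((e.2, e.1 e.2), (nx e.1 e.2, e.1 (nx e.1 e.2)))

theorem ends_inj : Function.Injective ends := by
  intro a b h
  revert a b
  decide +kernel

theorem nx_ne (F : OctFace) (i : Fin 3) : nx F i ≠ i := by
  revert F i; decide +kernel

theorem ends_surj : ∀ u v : OctVertex, u.1 ≠ v.1 → ∃ e, ends e = (u, v) := by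
  decide +kernel

theorem nx_aux : ∀ (F F' : OctFace) (p : Equiv.Perm (Fin 3)),
    (Equiv.Perm.sign p = 1 ↔ faceSign F ≠ faceSign F') →
    ∀ i, nx (flipF F' (p (th F i))) (p i) = p (nx F i) ∧ p (th F i) = nx F' (p i) := by
  decide +kernel

theorem th_ne : ∀ (F : OctFace) (i : Fin 3), th F i ≠ i ∧ th F i ≠ nx F i := by
  decide +kernel

theorem nx_or_th : ∀ (F : OctFace) (i j : Fin 3), i ≠ j → j = nx F i ∨ j = th F i := by
  decide +kernel

theorem nx_aux' (g : Gluing) (F : OctFace) (i : Fin 3) :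
    nx (flipF (g.face F) (g.axisMap F (th F i))) (g.axisMap F i) = g.axisMap F (nx F i) ∧
      g.axisMap F (th F i) = nx (g.face F) (g.axisMap F i) :=
  nx_aux F (g.face F) (g.axisMap F) (g.2.2.2.2 F) i

theorem ends_rho (g : Gluing) (F : OctFace) (i : Fin 3) :
    ends (rho g (F, i)) = ((g.axisMap F i, g.face F (g.axisMap F i)),
      (g.axisMap F (nx F i), g.face F (g.axisMap F (nx F i)))) := by
  have h1 : g.axisMap F i ≠ g.axisMap F (th F i) := by
    simpa using (th_ne F i).1.symm
  have h2 : g.axisMap F (nx F i) ≠ g.axisMap F (th F i) := by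
    simpa using (th_ne F i).2.symm
  simp only [ends, rho]
  rw [(nx_aux' g F i).1]
  simp only [flipF, if_neg h1, if_neg h2]

/-- The image of a right end is an end on the left of the glued face, and `rho` brings it back. -/
theorem ends_right (g : Gluing) (F : OctFace) (i : Fin 3) :
    ends (g.face F, g.axisMap F i) = ((g.axisMap F i, g.face F (g.axisMap F i)),
      (g.axisMap F (th F i), g.face F (g.axisMap F (th F i)))) ∧
    ends (rho g (g.face F, g.axisMap F i)) = ((i, F i), (th F i, F (th F i))) := by
  constructor
  · simp only [ends]
    rw [← (nx_aux' g F i).2]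
  · rw [ends_rho, face_face, axis_face, ← (nx_aux' g F i).2]
    simp

theorem rho_inj (g : Gluing) : Function.Injective (rho g) := by
  intro a b h
  have key : ∀ e : En, (g.face (flipF (rho g e).1 (nx (flipF (rho g e).1 (th (rho g e).1 (rho g e).2)) (rho g e).2)) ) = (g.face (flipF (rho g e).1 (nx (flipF (rho g e).1 (th (rho g e).1 (rho g e).2)) (rho g e).2))) := fun _ => rfl
  clear key
  -- third axis of the image
  have hth : ∀ e : En, th (rho g e).1 (rho g e).2 = g.axisMap e.1 (th e.1 e.2) := by
    rintro ⟨F, i⟩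
    have h1 := (nx_aux' g F i).1
    have a1 := th_ne (rho g (F, i)).1 (rho g (F, i)).2
    rcases nx_or_th (rho g (F, i)).1 (rho g (F, i)).2 (g.axisMap F (th F i))
      (by simpa [rho] using (th_ne F i).1.symm) with h | h
    · exfalso
      have : g.axisMap F (th F i) = g.axisMap F (nx F i) := h.trans h1
      exact (th_ne F i).2 ((g.axisMap F).injective this)
    · exact h.symm
  have hf : ∀ e : En, g.face (flipF (rho g e).1 (th (rho g e).1 (rho g e).2)) = e.1 := by
    intro e
    rw [hth]
    have : flipF (rho g e).1 (g.axisMap e.1 (th e.1 e.2)) = g.face e.1 := by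
      funext j
      simp only [rho, flipF]
      split_ifs <;> simp
    rw [this, face_face]
  have e1 : a.1 = b.1 := by rw [← hf a, ← hf b, h]
  have e2 : g.axisMap a.1 a.2 = g.axisMap b.1 b.2 := congrArg Prod.snd h
  rw [e1] at e2
  exact Prod.ext e1 ((g.axisMap b.1).injective e2)

section
variable {G : Type} [Group G]

theorem isRep_iff (g : Gluing) (t : OctFace → G) :
    IsRep g t ↔ (∀ F, t (g.face F) * t F = 1) ∧ ∃ C : En → G, ∀ e, C (rho g e) = t e.1 * C e := by
  constructor
  · intro h
    refine ⟨rep_inv h, ?_⟩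
    obtain ⟨c, hc⟩ := h
    refine ⟨fun e => c (ends e).1 (ends e).2, ?_⟩
    rintro ⟨F, i⟩
    simp only [ends_rho]
    exact hc F i (nx F i) (nx_ne F i).symm
  · rintro ⟨hi, C, hC⟩
    have hx : ∀ e, Function.extend ends C 1 (ends e) = C e := fun e => ends_inj.extend_apply C 1 e
    refine ⟨fun u v => Function.extend ends C 1 (u, v), fun F i j hij => ?_⟩
    rcases nx_or_th F i j hij with rfl | rfl
    · simp only
      rw [← ends_rho g F i, hx, hC]
      exact congrArg (fun z => t F * z) (hx (F, i)).symm
    · simp only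
      obtain ⟨h1, h2⟩ := ends_right g F i
      rw [← h1, ← h2, hx, hx, hC, ← mul_assoc]
      have : t F * t (g.face F) = 1 := by
        have := hi (g.face F)
        rwa [face_face] at this
      rw [this, one_mul]

/-- Product of the `t`-labels along a list of ends. -/
def wd (t : OctFace → G) : List En → G
  | [] => 1
  | e :: l => wd t l * t e.1

theorem wd_snoc (t : OctFace → G) (l : List En) (e : En) : wd t (l ++ [e]) = t e.1 * wd t l := by
  induction l with
  | nil => simp [wd]
  | cons a l ih => simp only [List.cons_append, wd, ih, mul_assoc]

/-- the cycle containing `e` -/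
def cycOf (cs : List (List En)) (e : En) : List En := (cs.find? (fun l => e ∈ l)).getD []

def chk (g : Gluing) (cs : List (List En)) (e : En) : Prop :=
  cycOf cs e ∈ cs ∧ cycOf cs (rho g e) = cycOf cs e ∧
    (cycOf cs e)[(cycOf cs e).idxOf e]? = some e ∧
    (((cycOf cs e).idxOf (rho g e) = (cycOf cs e).idxOf e + 1) ∨
     ((cycOf cs e).idxOf (rho g e) = 0 ∧ (cycOf cs e).idxOf e + 1 = (cycOf cs e).length))

instance (g : Gluing) (cs : List (List En)) (e : En) : Decidable (chk g cs e) := by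
  unfold chk; infer_instance

theorem rep_words (g : Gluing) (cs : List (List En)) (hcs : ∀ e, chk g cs e)
    (hst : ∀ l ∈ cs, ∃ e, e ∈ l ∧ cycOf cs e = l)
    (t : OctFace → G) :
    IsRep g t ↔ (∀ F, t (g.face F) * t F = 1) ∧ ∀ l ∈ cs, wd t l = 1 := by
  rw [isRep_iff]
  refine and_congr_right fun _ => ?_
  constructor
  · rintro ⟨C, hC⟩ l hl
    obtain ⟨e0, he0, hl0⟩ := hst l hl
    have hmem : ∀ e, cycOf cs e = l → e ∈ l := by
      intro e he
      obtain ⟨-, -, h3, -⟩ := hcs e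
      rw [he] at h3
      exact List.mem_of_getElem? h3
    -- walk along
    have walk : ∀ n e, cycOf cs e = l → l.idxOf e + n = l.length →
        wd t (l.drop (l.idxOf e)) * C e = C (l.headD e) ∧ ∃ s, cycOf cs s = l ∧ l.idxOf s = 0 := by
      intro n
      induction n with
      | zero =>
        intro e he hn
        exfalso
        have := List.idxOf_lt_length_of_mem (hmem e he)
        omega
      | succ n ih =>
        intro e he hn
        obtain ⟨h1, h2, h3, h4⟩ := hcs e
        rw [he] at h2 h3 h4
        have hlt := List.idxOf_lt_length_of_mem (hmem e he)
        have hd : l.drop (l.idxOf e) = e :: l.drop (l.idxOf e + 1) := by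
          rw [List.drop_eq_getElem_cons hlt]
          congr 1
          exact List.getElem_idxOf hlt
        rw [hd, wd, mul_assoc, ← hC]
        rcases h4 with h4 | ⟨h4, h5⟩
        · have := ih (rho g e) h2 (by omega)
          rw [h4] at this
          refine ⟨?_, this.2⟩
          rw [this.1]
          cases l with
          | nil => simp at hlt
          | cons a l => rfl
        · rw [h5, List.drop_length, wd, one_mul]
          refine ⟨?_, _, h2, h4⟩
          have hm := hmem _ h2
          have hlt' := List.idxOf_lt_length_of_mem hm
          have := List.getElem_idxOf hlt'
          simp only [h4] at this
          cases l with
          | nil => simp at hlt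
          | cons a l => simp at this; simp [this]
    obtain ⟨-, s, hs, hs0⟩ := walk (l.length - l.idxOf e0) e0 hl0 (by
      have := List.idxOf_lt_length_of_mem he0; omega)
    obtain ⟨h, -⟩ := walk l.length s hs (by omega)
    rw [hs0, List.drop_zero] at h
    have hm := hmem _ hs
    have hlt' := List.idxOf_lt_length_of_mem hm
    have := List.getElem_idxOf hlt'
    simp only [hs0] at this
    have h' : l.headD s = s := by
      cases l with
      | nil => simp at hm
      | cons a l => simpa using this
    rw [h'] at h
    exact mul_right_cancel (b := C s) (by rw [one_mul]; exact h)
  · intro hw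
    refine ⟨fun e => wd t ((cycOf cs e).take ((cycOf cs e).idxOf e)), fun e => ?_⟩
    obtain ⟨h1, h2, h3, h4⟩ := hcs e
    simp only [h2]
    have hs : (cycOf cs e).take ((cycOf cs e).idxOf e + 1) =
        (cycOf cs e).take ((cycOf cs e).idxOf e) ++ [e] := by
      rw [List.take_add_one, h3]; rfl
    rw [← wd_snoc, ← hs]
    rcases h4 with h4 | ⟨h4, h5⟩
    · rw [h4]
    · rw [h4, h5, List.take_length, hw _ h1]; simp [wd]

end

end OctaGlue

namespace OctaGlue

theorem fc_eta (F : OctFace) : fc (F 0) (F 1) (F 2) = F := by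
  funext i; fin_cases i <;> rfl

set_option linter.unusedSimpArgs false

/-! #### representative 0 -/

def c0_0 : List En := [(fc false false false, 0), (fc false true true, 0), (fc true true false, 2), (fc false false true, 1), (fc true false false, 1), (fc false true true, 2), (fc false true true, 1)]
def c0_1 : List En := [(fc false false false, 1)]
def c0_2 : List En := [(fc false false false, 2), (fc true false true, 2), (fc false true false, 1), (fc false false true, 2), (fc false true false, 2), (fc false true false, 0), (fc true true true, 1)]
def c0_3 : List En := [(fc false false true, 0)]
def c0_4 : List En := [(fc true false false, 0), (fc true false true, 0), (fc true true true, 0), (fc true true false, 0)]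
def c0_5 : List En := [(fc true false false, 2), (fc true true false, 1), (fc true true true, 2), (fc true false true, 1)]
def cs0 : List (List En) := [c0_0, c0_1, c0_2, c0_3, c0_4, c0_5]

section
variable {G : Type} [Group G]

def rel0 (b d : G) : G := d⁻¹ * b⁻¹ * b⁻¹ * b⁻¹ * d * b * b * b

def T0 (b d : G) : OctFace → G := fun F => match F 0, F 1, F 2 with
  | false, false, false => 1
  | false, false, true => 1
  | false, true, false => b
  | false, true, true => b⁻¹
  | true, false, false => b * b * b * d
  | true, false, true => d
  | true, true, false => d⁻¹
  | true, true, true => d⁻¹ * b⁻¹ * b⁻¹ * b⁻¹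

theorem rep0_iff (t : OctFace → G) :
    IsRep rep0 t ↔ ∃ b d : G, rel0 b d = 1 ∧ t = T0 b d := by
  rw [rep_words rep0 cs0 (by decide +kernel) (by decide +kernel)]
  constructor
  · rintro ⟨hi, hw⟩
    have i0 : t (fc false false true) = (t (fc false false false))⁻¹ := eq_inv_of_mul_eq_one_left (hi (fc false false false))
    have i1 : t (fc false true true) = (t (fc false true false))⁻¹ := eq_inv_of_mul_eq_one_left (hi (fc false true false))
    have i2 : t (fc true true true) = (t (fc true false false))⁻¹ := eq_inv_of_mul_eq_one_left (hi (fc true false false))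
    have i3 : t (fc true true false) = (t (fc true false true))⁻¹ := eq_inv_of_mul_eq_one_left (hi (fc true false true))
    have w0 := hw c0_0 (by simp [cs0])
    have w1 := hw c0_1 (by simp [cs0])
    have w4 := hw c0_4 (by simp [cs0])
    simp only [c0_0, c0_1, c0_4, wd, one_mul, i0, i1, i2, i3] at w0 w1 w4
    have ht : t = fun F => match F 0, F 1, F 2 with
        | false, false, false => t (fc false false false)
        | false, false, true => (t (fc false false false))⁻¹
        | false, true, false => t (fc false true false)
        | false, true, true => (t (fc false true false))⁻¹
        | true, false, false => t (fc true false false)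
        | true, false, true => t (fc true false true)
        | true, true, false => (t (fc true false true))⁻¹
        | true, true, true => (t (fc true false false))⁻¹ := by
      funext F
      rw [← fc_eta F]
      cases F 0 <;> cases F 1 <;> cases F 2 <;> first | rfl | exact i0 | exact i1 | exact i2 | exact i3
    generalize t (fc false false false) = a at w0 w1 w4 ht
    generalize t (fc false true false) = b at w0 w1 w4 ht
    generalize t (fc true false false) = c at w0 w1 w4 ht
    generalize t (fc true false true) = d at w0 w1 w4 ht
    clear hi hw i0 i1 i2 i3
    have ea : 1 = a := by
      symm
      have q : a = 1 * (a) * 1 := by simp only [mul_assoc, mul_inv_rev, inv_inv, mul_one, one_mul, inv_one, inv_mul_cancel_left, mul_inv_cancel_left, inv_mul_cancel, mul_inv_cancel]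
      rw [q, show a = 1 from (by refine Eq.trans ?_ w1; simp only [mul_assoc, mul_inv_rev, inv_inv, mul_one, one_mul, inv_one, inv_mul_cancel_left, mul_inv_cancel_left, inv_mul_cancel, mul_inv_cancel])]; simp only [mul_assoc, mul_inv_rev, inv_inv, mul_one, one_mul, inv_one, inv_mul_cancel_left, mul_inv_cancel_left, inv_mul_cancel, mul_inv_cancel]
    subst ea
    have ec : b * b * b * d = c := by
      symm
      have q : c = (b * b) * (b⁻¹ * b⁻¹ * c * d⁻¹ * b⁻¹) * (b * d) := by simp only [mul_assoc, mul_inv_rev, inv_inv, mul_one, one_mul, inv_one, inv_mul_cancel_left, mul_inv_cancel_left, inv_mul_cancel, mul_inv_cancel]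
      rw [q, show b⁻¹ * b⁻¹ * c * d⁻¹ * b⁻¹ = 1 from (by refine Eq.trans ?_ w0; simp only [mul_assoc, mul_inv_rev, inv_inv, mul_one, one_mul, inv_one, inv_mul_cancel_left, mul_inv_cancel_left, inv_mul_cancel, mul_inv_cancel])]; simp only [mul_assoc, mul_inv_rev, inv_inv, mul_one, one_mul, inv_one, inv_mul_cancel_left, mul_inv_cancel_left, inv_mul_cancel, mul_inv_cancel]
    subst ec
    refine ⟨b, d, ?_, ?_⟩
    · have q : rel0 b d = (d) * (d⁻¹ * d⁻¹ * b⁻¹ * b⁻¹ * b⁻¹ * d * b * b * b * d) * (d⁻¹) := by unfold rel0; simp only [mul_assoc, mul_inv_rev, inv_inv, mul_one, one_mul, inv_one, inv_mul_cancel_left, mul_inv_cancel_left, inv_mul_cancel, mul_inv_cancel]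
      rw [q, show d⁻¹ * d⁻¹ * b⁻¹ * b⁻¹ * b⁻¹ * d * b * b * b * d = 1 from (by refine Eq.trans ?_ w4; simp only [mul_assoc, mul_inv_rev, inv_inv, mul_one, one_mul, inv_one, inv_mul_cancel_left, mul_inv_cancel_left, inv_mul_cancel, mul_inv_cancel])]; simp only [mul_assoc, mul_inv_rev, inv_inv, mul_one, one_mul, inv_one, inv_mul_cancel_left, mul_inv_cancel_left, inv_mul_cancel, mul_inv_cancel]
    · rw [ht]; funext F; rw [← fc_eta F]
      cases F 0 <;> cases F 1 <;> cases F 2 <;> simp [T0, fc, mul_assoc]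
  · rintro ⟨b, d, h, rfl⟩
    constructor
    · intro F; rw [← fc_eta F]
      cases F 0 <;> cases F 1 <;> cases F 2 <;> simp [T0, rep0, dat0, mkG, Gluing.face, fc, mul_assoc]
    have f0 : T0 b d (fc false false false) = 1 := rfl
    have f1 : T0 b d (fc false false true) = 1 := rfl
    have f2 : T0 b d (fc false true false) = b := rfl
    have f3 : T0 b d (fc false true true) = b⁻¹ := rfl
    have f4 : T0 b d (fc true false false) = b * b * b * d := rfl
    have f5 : T0 b d (fc true false true) = d := rfl
    have f6 : T0 b d (fc true true false) = d⁻¹ := rfl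
    have f7 : T0 b d (fc true true true) = d⁻¹ * b⁻¹ * b⁻¹ * b⁻¹ := rfl
    have g0 : b⁻¹ * b⁻¹ * (b * b * b * d) * 1 * d⁻¹ * b⁻¹ * 1 = 1 := by simp only [mul_assoc, mul_inv_rev, inv_inv, mul_one, one_mul, inv_one, inv_mul_cancel_left, mul_inv_cancel_left, inv_mul_cancel, mul_inv_cancel]
    have g1 : 1 = 1 := by simp only [mul_assoc, mul_inv_rev, inv_inv, mul_one, one_mul, inv_one, inv_mul_cancel_left, mul_inv_cancel_left, inv_mul_cancel, mul_inv_cancel]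
    have g2 : (d⁻¹ * b⁻¹ * b⁻¹ * b⁻¹) * b * b * 1 * b * d * 1 = 1 := by simp only [mul_assoc, mul_inv_rev, inv_inv, mul_one, one_mul, inv_one, inv_mul_cancel_left, mul_inv_cancel_left, inv_mul_cancel, mul_inv_cancel]
    have g3 : 1 = 1 := by simp only [mul_assoc, mul_inv_rev, inv_inv, mul_one, one_mul, inv_one, inv_mul_cancel_left, mul_inv_cancel_left, inv_mul_cancel, mul_inv_cancel]
    have g4 : d⁻¹ * (d⁻¹ * b⁻¹ * b⁻¹ * b⁻¹) * d * (b * b * b * d) = 1 := by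
      rw [show d⁻¹ * (d⁻¹ * b⁻¹ * b⁻¹ * b⁻¹) * d * (b * b * b * d) = (d⁻¹) * rel0 b d * (d) from (by unfold rel0; simp only [mul_assoc, mul_inv_rev, inv_inv, mul_one, one_mul, inv_one, inv_mul_cancel_left, mul_inv_cancel_left, inv_mul_cancel, mul_inv_cancel]), h]; simp only [mul_assoc, mul_inv_rev, inv_inv, mul_one, one_mul, inv_one, inv_mul_cancel_left, mul_inv_cancel_left, inv_mul_cancel, mul_inv_cancel]
    have g5 : d * (d⁻¹ * b⁻¹ * b⁻¹ * b⁻¹) * d⁻¹ * (b * b * b * d) = 1 := by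
      rw [show d * (d⁻¹ * b⁻¹ * b⁻¹ * b⁻¹) * d⁻¹ * (b * b * b * d) = 1 * (rel0 b d)⁻¹ * 1 from (by unfold rel0; simp only [mul_assoc, mul_inv_rev, inv_inv, mul_one, one_mul, inv_one, inv_mul_cancel_left, mul_inv_cancel_left, inv_mul_cancel, mul_inv_cancel]), h]; simp only [mul_assoc, mul_inv_rev, inv_inv, mul_one, one_mul, inv_one, inv_mul_cancel_left, mul_inv_cancel_left, inv_mul_cancel, mul_inv_cancel]
    intro l hl
    simp only [cs0, List.mem_cons, List.not_mem_nil, or_false] at hl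
    rcases hl with rfl | rfl | rfl | rfl | rfl | rfl
    · simp only [c0_0, wd, one_mul, f0, f1, f2, f3, f4, f5, f6, f7]; exact g0
    · simp only [c0_1, wd, one_mul, f0, f1, f2, f3, f4, f5, f6, f7]
    · simp only [c0_2, wd, one_mul, f0, f1, f2, f3, f4, f5, f6, f7]; exact g2
    · simp only [c0_3, wd, one_mul, f0, f1, f2, f3, f4, f5, f6, f7]
    · simp only [c0_4, wd, one_mul, f0, f1, f2, f3, f4, f5, f6, f7]; exact g4
    · simp only [c0_5, wd, one_mul, f0, f1, f2, f3, f4, f5, f6, f7]; exact g5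
end

/-! #### representative 1 -/

def c1_0 : List En := [(fc false false false, 0), (fc false true true, 0), (fc true true true, 0), (fc true true false, 0), (fc false true false, 0), (fc true false false, 0), (fc true false true, 0)]
def c1_1 : List En := [(fc false false false, 1)]
def c1_2 : List En := [(fc false false false, 2), (fc true false true, 2), (fc true true false, 2), (fc true true true, 1)]
def c1_3 : List En := [(fc false false true, 0)]
def c1_4 : List En := [(fc false false true, 1), (fc true false false, 1), (fc false true true, 2), (fc false true false, 1)]
def c1_5 : List En := [(fc false false true, 2), (fc false true false, 2), (fc true true true, 2), (fc true false true, 1), (fc false true true, 1), (fc true false false, 2), (fc true true false, 1)]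
def cs1 : List (List En) := [c1_0, c1_1, c1_2, c1_3, c1_4, c1_5]

section
variable {G : Type} [Group G]

def rel1 (c d : G) : G := c * d * c⁻¹ * c⁻¹ * d⁻¹ * c

def T1 (c d : G) : OctFace → G := fun F => match F 0, F 1, F 2 with
  | false, false, false => 1
  | false, false, true => 1
  | false, true, false => d⁻¹ * c⁻¹
  | false, true, true => c
  | true, false, false => d
  | true, false, true => c * d
  | true, true, false => c⁻¹
  | true, true, true => d⁻¹

theorem rep1_iff (t : OctFace → G) :
    IsRep rep1 t ↔ ∃ c d : G, rel1 c d = 1 ∧ t = T1 c d := by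
  rw [rep_words rep1 cs1 (by decide +kernel) (by decide +kernel)]
  constructor
  · rintro ⟨hi, hw⟩
    have i0 : t (fc false false true) = (t (fc false false false))⁻¹ := eq_inv_of_mul_eq_one_left (hi (fc false false false))
    have i1 : t (fc true false true) = (t (fc false true false))⁻¹ := eq_inv_of_mul_eq_one_left (hi (fc false true false))
    have i2 : t (fc true true false) = (t (fc false true true))⁻¹ := eq_inv_of_mul_eq_one_left (hi (fc false true true))
    have i3 : t (fc true true true) = (t (fc true false false))⁻¹ := eq_inv_of_mul_eq_one_left (hi (fc true false false))
    have w0 := hw c1_0 (by simp [cs1])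
    have w1 := hw c1_1 (by simp [cs1])
    have w2 := hw c1_2 (by simp [cs1])
    simp only [c1_0, c1_1, c1_2, wd, one_mul, i0, i1, i2, i3] at w0 w1 w2
    have ht : t = fun F => match F 0, F 1, F 2 with
        | false, false, false => t (fc false false false)
        | false, false, true => (t (fc false false false))⁻¹
        | false, true, false => t (fc false true false)
        | false, true, true => t (fc false true true)
        | true, false, false => t (fc true false false)
        | true, false, true => (t (fc false true false))⁻¹
        | true, true, false => (t (fc false true true))⁻¹
        | true, true, true => (t (fc true false false))⁻¹ := by
      funext F
      rw [← fc_eta F]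
      cases F 0 <;> cases F 1 <;> cases F 2 <;> first | rfl | exact i0 | exact i1 | exact i2 | exact i3
    generalize t (fc false false false) = a at w0 w1 w2 ht
    generalize t (fc false true false) = b at w0 w1 w2 ht
    generalize t (fc false true true) = c at w0 w1 w2 ht
    generalize t (fc true false false) = d at w0 w1 w2 ht
    clear hi hw i0 i1 i2 i3
    have ea : 1 = a := by
      symm
      have q : a = 1 * (a) * 1 := by simp only [mul_assoc, mul_inv_rev, inv_inv, mul_one, one_mul, inv_one, inv_mul_cancel_left, mul_inv_cancel_left, inv_mul_cancel, mul_inv_cancel]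
      rw [q, show a = 1 from (by refine Eq.trans ?_ w1; simp only [mul_assoc, mul_inv_rev, inv_inv, mul_one, one_mul, inv_one, inv_mul_cancel_left, mul_inv_cancel_left, inv_mul_cancel, mul_inv_cancel])]; simp only [mul_assoc, mul_inv_rev, inv_inv, mul_one, one_mul, inv_one, inv_mul_cancel_left, mul_inv_cancel_left, inv_mul_cancel, mul_inv_cancel]
    subst ea
    have eb : d⁻¹ * c⁻¹ = b := by
      symm
      have q : b = 1 * (d⁻¹ * c⁻¹ * b⁻¹)⁻¹ * (d⁻¹ * c⁻¹) := by simp only [mul_assoc, mul_inv_rev, inv_inv, mul_one, one_mul, inv_one, inv_mul_cancel_left, mul_inv_cancel_left, inv_mul_cancel, mul_inv_cancel]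
      rw [q, show d⁻¹ * c⁻¹ * b⁻¹ = 1 from (by refine Eq.trans ?_ w2; simp only [mul_assoc, mul_inv_rev, inv_inv, mul_one, one_mul, inv_one, inv_mul_cancel_left, mul_inv_cancel_left, inv_mul_cancel, mul_inv_cancel])]; simp only [mul_assoc, mul_inv_rev, inv_inv, mul_one, one_mul, inv_one, inv_mul_cancel_left, mul_inv_cancel_left, inv_mul_cancel, mul_inv_cancel]
    subst eb
    refine ⟨c, d, ?_, ?_⟩
    · have q : rel1 c d = 1 * (c * d * c⁻¹ * c⁻¹ * d⁻¹ * c) * 1 := by unfold rel1; simp only [mul_assoc, mul_inv_rev, inv_inv, mul_one, one_mul, inv_one, inv_mul_cancel_left, mul_inv_cancel_left, inv_mul_cancel, mul_inv_cancel]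
      rw [q, show c * d * c⁻¹ * c⁻¹ * d⁻¹ * c = 1 from (by refine Eq.trans ?_ w0; simp only [mul_assoc, mul_inv_rev, inv_inv, mul_one, one_mul, inv_one, inv_mul_cancel_left, mul_inv_cancel_left, inv_mul_cancel, mul_inv_cancel])]; simp only [mul_assoc, mul_inv_rev, inv_inv, mul_one, one_mul, inv_one, inv_mul_cancel_left, mul_inv_cancel_left, inv_mul_cancel, mul_inv_cancel]
    · rw [ht]; funext F; rw [← fc_eta F]
      cases F 0 <;> cases F 1 <;> cases F 2 <;> simp [T1, fc, mul_assoc]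
  · rintro ⟨c, d, h, rfl⟩
    constructor
    · intro F; rw [← fc_eta F]
      cases F 0 <;> cases F 1 <;> cases F 2 <;> simp [T1, rep1, dat1, mkG, Gluing.face, fc, mul_assoc]
    have f0 : T1 c d (fc false false false) = 1 := rfl
    have f1 : T1 c d (fc false false true) = 1 := rfl
    have f2 : T1 c d (fc false true false) = d⁻¹ * c⁻¹ := rfl
    have f3 : T1 c d (fc false true true) = c := rfl
    have f4 : T1 c d (fc true false false) = d := rfl
    have f5 : T1 c d (fc true false true) = c * d := rfl
    have f6 : T1 c d (fc true true false) = c⁻¹ := rfl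
    have f7 : T1 c d (fc true true true) = d⁻¹ := rfl
    have g0 : (c * d) * d * (d⁻¹ * c⁻¹) * c⁻¹ * d⁻¹ * c * 1 = 1 := by
      rw [show (c * d) * d * (d⁻¹ * c⁻¹) * c⁻¹ * d⁻¹ * c * 1 = 1 * rel1 c d * 1 from (by unfold rel1; simp only [mul_assoc, mul_inv_rev, inv_inv, mul_one, one_mul, inv_one, inv_mul_cancel_left, mul_inv_cancel_left, inv_mul_cancel, mul_inv_cancel]), h]; simp only [mul_assoc, mul_inv_rev, inv_inv, mul_one, one_mul, inv_one, inv_mul_cancel_left, mul_inv_cancel_left, inv_mul_cancel, mul_inv_cancel]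
    have g1 : 1 = 1 := by simp only [mul_assoc, mul_inv_rev, inv_inv, mul_one, one_mul, inv_one, inv_mul_cancel_left, mul_inv_cancel_left, inv_mul_cancel, mul_inv_cancel]
    have g2 : d⁻¹ * c⁻¹ * (c * d) * 1 = 1 := by simp only [mul_assoc, mul_inv_rev, inv_inv, mul_one, one_mul, inv_one, inv_mul_cancel_left, mul_inv_cancel_left, inv_mul_cancel, mul_inv_cancel]
    have g3 : 1 = 1 := by simp only [mul_assoc, mul_inv_rev, inv_inv, mul_one, one_mul, inv_one, inv_mul_cancel_left, mul_inv_cancel_left, inv_mul_cancel, mul_inv_cancel]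
    have g4 : (d⁻¹ * c⁻¹) * c * d * 1 = 1 := by simp only [mul_assoc, mul_inv_rev, inv_inv, mul_one, one_mul, inv_one, inv_mul_cancel_left, mul_inv_cancel_left, inv_mul_cancel, mul_inv_cancel]
    have g5 : c⁻¹ * d * c * (c * d) * d⁻¹ * (d⁻¹ * c⁻¹) * 1 = 1 := by
      rw [show c⁻¹ * d * c * (c * d) * d⁻¹ * (d⁻¹ * c⁻¹) * 1 = 1 * (rel1 c d)⁻¹ * 1 from (by unfold rel1; simp only [mul_assoc, mul_inv_rev, inv_inv, mul_one, one_mul, inv_one, inv_mul_cancel_left, mul_inv_cancel_left, inv_mul_cancel, mul_inv_cancel]), h]; simp only [mul_assoc, mul_inv_rev, inv_inv, mul_one, one_mul, inv_one, inv_mul_cancel_left, mul_inv_cancel_left, inv_mul_cancel, mul_inv_cancel]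
    intro l hl
    simp only [cs1, List.mem_cons, List.not_mem_nil, or_false] at hl
    rcases hl with rfl | rfl | rfl | rfl | rfl | rfl
    · simp only [c1_0, wd, one_mul, f0, f1, f2, f3, f4, f5, f6, f7]; exact g0
    · simp only [c1_1, wd, one_mul, f0, f1, f2, f3, f4, f5, f6, f7]
    · simp only [c1_2, wd, one_mul, f0, f1, f2, f3, f4, f5, f6, f7]; exact g2
    · simp only [c1_3, wd, one_mul, f0, f1, f2, f3, f4, f5, f6, f7]
    · simp only [c1_4, wd, one_mul, f0, f1, f2, f3, f4, f5, f6, f7]; exact g4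
    · simp only [c1_5, wd, one_mul, f0, f1, f2, f3, f4, f5, f6, f7]; exact g5
end

/-! #### representative 2 -/

def c2_0 : List En := [(fc false false false, 0), (fc false true false, 0), (fc false true true, 0), (fc false false true, 0)]
def c2_1 : List En := [(fc false false false, 1), (fc false false true, 2), (fc false true true, 1), (fc false true false, 2)]
def c2_2 : List En := [(fc false false false, 2), (fc true true true, 1)]
def c2_3 : List En := [(fc false false true, 1), (fc true true false, 2)]
def c2_4 : List En := [(fc false true false, 1), (fc true false true, 2)]
def c2_5 : List En := [(fc false true true, 2), (fc true false false, 1)]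
def c2_6 : List En := [(fc true false false, 0), (fc true false true, 0), (fc true true true, 0), (fc true true false, 0)]
def c2_7 : List En := [(fc true false false, 2), (fc true true false, 1), (fc true true true, 2), (fc true false true, 1)]
def cs2 : List (List En) := [c2_0, c2_1, c2_2, c2_3, c2_4, c2_5, c2_6, c2_7]

section
variable {G : Type} [Group G]

def rel2 (a b : G) : G := b * a⁻¹ * b⁻¹ * a

def T2 (a b : G) : OctFace → G := fun F => match F 0, F 1, F 2 with
  | false, false, false => a
  | false, false, true => b
  | false, true, false => b⁻¹
  | false, true, true => a⁻¹
  | true, false, false => a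
  | true, false, true => b
  | true, true, false => b⁻¹
  | true, true, true => a⁻¹

theorem rep2_iff (t : OctFace → G) :
    IsRep rep2 t ↔ ∃ a b : G, rel2 a b = 1 ∧ t = T2 a b := by
  rw [rep_words rep2 cs2 (by decide +kernel) (by decide +kernel)]
  constructor
  · rintro ⟨hi, hw⟩
    have i0 : t (fc false true true) = (t (fc false false false))⁻¹ := eq_inv_of_mul_eq_one_left (hi (fc false false false))
    have i1 : t (fc false true false) = (t (fc false false true))⁻¹ := eq_inv_of_mul_eq_one_left (hi (fc false false true))
    have i2 : t (fc true true true) = (t (fc true false false))⁻¹ := eq_inv_of_mul_eq_one_left (hi (fc true false false))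
    have i3 : t (fc true true false) = (t (fc true false true))⁻¹ := eq_inv_of_mul_eq_one_left (hi (fc true false true))
    have w0 := hw c2_0 (by simp [cs2])
    have w2 := hw c2_2 (by simp [cs2])
    have w3 := hw c2_3 (by simp [cs2])
    simp only [c2_0, c2_2, c2_3, wd, one_mul, i0, i1, i2, i3] at w0 w2 w3
    have ht : t = fun F => match F 0, F 1, F 2 with
        | false, false, false => t (fc false false false)
        | false, false, true => t (fc false false true)
        | false, true, false => (t (fc false false true))⁻¹
        | false, true, true => (t (fc false false false))⁻¹
        | true, false, false => t (fc true false false)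
        | true, false, true => t (fc true false true)
        | true, true, false => (t (fc true false true))⁻¹
        | true, true, true => (t (fc true false false))⁻¹ := by
      funext F
      rw [← fc_eta F]
      cases F 0 <;> cases F 1 <;> cases F 2 <;> first | rfl | exact i0 | exact i1 | exact i2 | exact i3
    generalize t (fc false false false) = a at w0 w2 w3 ht
    generalize t (fc false false true) = b at w0 w2 w3 ht
    generalize t (fc true false false) = c at w0 w2 w3 ht
    generalize t (fc true false true) = d at w0 w2 w3 ht
    clear hi hw i0 i1 i2 i3
    have ec : a = c := by
      symm
      have q : c = (a) * (c⁻¹ * a)⁻¹ * 1 := by simp only [mul_assoc, mul_inv_rev, inv_inv, mul_one, one_mul, inv_one, inv_mul_cancel_left, mul_inv_cancel_left, inv_mul_cancel, mul_inv_cancel]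
      rw [q, show c⁻¹ * a = 1 from (by refine Eq.trans ?_ w2; simp only [mul_assoc, mul_inv_rev, inv_inv, mul_one, one_mul, inv_one, inv_mul_cancel_left, mul_inv_cancel_left, inv_mul_cancel, mul_inv_cancel])]; simp only [mul_assoc, mul_inv_rev, inv_inv, mul_one, one_mul, inv_one, inv_mul_cancel_left, mul_inv_cancel_left, inv_mul_cancel, mul_inv_cancel]
    subst ec
    have ed : b = d := by
      symm
      have q : d = (b) * (d⁻¹ * b)⁻¹ * 1 := by simp only [mul_assoc, mul_inv_rev, inv_inv, mul_one, one_mul, inv_one, inv_mul_cancel_left, mul_inv_cancel_left, inv_mul_cancel, mul_inv_cancel]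
      rw [q, show d⁻¹ * b = 1 from (by refine Eq.trans ?_ w3; simp only [mul_assoc, mul_inv_rev, inv_inv, mul_one, one_mul, inv_one, inv_mul_cancel_left, mul_inv_cancel_left, inv_mul_cancel, mul_inv_cancel])]; simp only [mul_assoc, mul_inv_rev, inv_inv, mul_one, one_mul, inv_one, inv_mul_cancel_left, mul_inv_cancel_left, inv_mul_cancel, mul_inv_cancel]
    subst ed
    refine ⟨a, b, ?_, ?_⟩
    · have q : rel2 a b = 1 * (b * a⁻¹ * b⁻¹ * a) * 1 := by unfold rel2; simp only [mul_assoc, mul_inv_rev, inv_inv, mul_one, one_mul, inv_one, inv_mul_cancel_left, mul_inv_cancel_left, inv_mul_cancel, mul_inv_cancel]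
      rw [q, show b * a⁻¹ * b⁻¹ * a = 1 from (by refine Eq.trans ?_ w0; simp only [mul_assoc, mul_inv_rev, inv_inv, mul_one, one_mul, inv_one, inv_mul_cancel_left, mul_inv_cancel_left, inv_mul_cancel, mul_inv_cancel])]; simp only [mul_assoc, mul_inv_rev, inv_inv, mul_one, one_mul, inv_one, inv_mul_cancel_left, mul_inv_cancel_left, inv_mul_cancel, mul_inv_cancel]
    · rw [ht]; funext F; rw [← fc_eta F]
      cases F 0 <;> cases F 1 <;> cases F 2 <;> simp [T2, fc, mul_assoc]
  · rintro ⟨a, b, h, rfl⟩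
    constructor
    · intro F; rw [← fc_eta F]
      cases F 0 <;> cases F 1 <;> cases F 2 <;> simp [T2, rep2, dat2, mkG, Gluing.face, fc, mul_assoc]
    have f0 : T2 a b (fc false false false) = a := rfl
    have f1 : T2 a b (fc false false true) = b := rfl
    have f2 : T2 a b (fc false true false) = b⁻¹ := rfl
    have f3 : T2 a b (fc false true true) = a⁻¹ := rfl
    have f4 : T2 a b (fc true false false) = a := rfl
    have f5 : T2 a b (fc true false true) = b := rfl
    have f6 : T2 a b (fc true true false) = b⁻¹ := rfl
    have f7 : T2 a b (fc true true true) = a⁻¹ := rfl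
    have g0 : b * a⁻¹ * b⁻¹ * a = 1 := by
      rw [show b * a⁻¹ * b⁻¹ * a = 1 * rel2 a b * 1 from (by unfold rel2; simp only [mul_assoc, mul_inv_rev, inv_inv, mul_one, one_mul, inv_one, inv_mul_cancel_left, mul_inv_cancel_left, inv_mul_cancel, mul_inv_cancel]), h]; simp only [mul_assoc, mul_inv_rev, inv_inv, mul_one, one_mul, inv_one, inv_mul_cancel_left, mul_inv_cancel_left, inv_mul_cancel, mul_inv_cancel]
    have g1 : b⁻¹ * a⁻¹ * b * a = 1 := by
      rw [show b⁻¹ * a⁻¹ * b * a = (a⁻¹ * b⁻¹ * a) * (rel2 a b)⁻¹ * (a⁻¹ * b * a) from (by unfold rel2; simp only [mul_assoc, mul_inv_rev, inv_inv, mul_one, one_mul, inv_one, inv_mul_cancel_left, mul_inv_cancel_left, inv_mul_cancel, mul_inv_cancel]), h]; simp only [mul_assoc, mul_inv_rev, inv_inv, mul_one, one_mul, inv_one, inv_mul_cancel_left, mul_inv_cancel_left, inv_mul_cancel, mul_inv_cancel]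
    have g2 : a⁻¹ * a = 1 := by simp only [mul_assoc, mul_inv_rev, inv_inv, mul_one, one_mul, inv_one, inv_mul_cancel_left, mul_inv_cancel_left, inv_mul_cancel, mul_inv_cancel]
    have g3 : b⁻¹ * b = 1 := by simp only [mul_assoc, mul_inv_rev, inv_inv, mul_one, one_mul, inv_one, inv_mul_cancel_left, mul_inv_cancel_left, inv_mul_cancel, mul_inv_cancel]
    have g4 : b * b⁻¹ = 1 := by simp only [mul_assoc, mul_inv_rev, inv_inv, mul_one, one_mul, inv_one, inv_mul_cancel_left, mul_inv_cancel_left, inv_mul_cancel, mul_inv_cancel]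
    have g5 : a * a⁻¹ = 1 := by simp only [mul_assoc, mul_inv_rev, inv_inv, mul_one, one_mul, inv_one, inv_mul_cancel_left, mul_inv_cancel_left, inv_mul_cancel, mul_inv_cancel]
    have g6 : b⁻¹ * a⁻¹ * b * a = 1 := by
      rw [show b⁻¹ * a⁻¹ * b * a = (a⁻¹ * b⁻¹ * a) * (rel2 a b)⁻¹ * (a⁻¹ * b * a) from (by unfold rel2; simp only [mul_assoc, mul_inv_rev, inv_inv, mul_one, one_mul, inv_one, inv_mul_cancel_left, mul_inv_cancel_left, inv_mul_cancel, mul_inv_cancel]), h]; simp only [mul_assoc, mul_inv_rev, inv_inv, mul_one, one_mul, inv_one, inv_mul_cancel_left, mul_inv_cancel_left, inv_mul_cancel, mul_inv_cancel]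
    have g7 : b * a⁻¹ * b⁻¹ * a = 1 := by
      rw [show b * a⁻¹ * b⁻¹ * a = 1 * rel2 a b * 1 from (by unfold rel2; simp only [mul_assoc, mul_inv_rev, inv_inv, mul_one, one_mul, inv_one, inv_mul_cancel_left, mul_inv_cancel_left, inv_mul_cancel, mul_inv_cancel]), h]; simp only [mul_assoc, mul_inv_rev, inv_inv, mul_one, one_mul, inv_one, inv_mul_cancel_left, mul_inv_cancel_left, inv_mul_cancel, mul_inv_cancel]
    intro l hl
    simp only [cs2, List.mem_cons, List.not_mem_nil, or_false] at hl
    rcases hl with rfl | rfl | rfl | rfl | rfl | rfl | rfl | rfl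
    · simp only [c2_0, wd, one_mul, f0, f1, f2, f3, f4, f5, f6, f7]; exact g0
    · simp only [c2_1, wd, one_mul, f0, f1, f2, f3, f4, f5, f6, f7]; exact g1
    · simp only [c2_2, wd, one_mul, f0, f1, f2, f3, f4, f5, f6, f7]; exact g2
    · simp only [c2_3, wd, one_mul, f0, f1, f2, f3, f4, f5, f6, f7]; exact g3
    · simp only [c2_4, wd, one_mul, f0, f1, f2, f3, f4, f5, f6, f7]; exact g4
    · simp only [c2_5, wd, one_mul, f0, f1, f2, f3, f4, f5, f6, f7]; exact g5
    · simp only [c2_6, wd, one_mul, f0, f1, f2, f3, f4, f5, f6, f7]; exact g6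
    · simp only [c2_7, wd, one_mul, f0, f1, f2, f3, f4, f5, f6, f7]; exact g7
end

/-! #### representative 3 -/

def c3_0 : List En := [(fc false false false, 0), (fc false true false, 0), (fc false true true, 0), (fc false false true, 0)]
def c3_1 : List En := [(fc false false false, 1), (fc false false true, 2), (fc false true true, 1), (fc false true false, 2)]
def c3_2 : List En := [(fc false false false, 2), (fc true true true, 1)]
def c3_3 : List En := [(fc false false true, 1), (fc true true false, 2), (fc true true true, 2), (fc true false true, 1), (fc true true true, 0), (fc true true false, 0)]
def c3_4 : List En := [(fc false true false, 1), (fc true false true, 2), (fc true false false, 2), (fc true true false, 1), (fc true false false, 0), (fc true false true, 0)]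
def c3_5 : List En := [(fc false true true, 2), (fc true false false, 1)]
def cs3 : List (List En) := [c3_0, c3_1, c3_2, c3_3, c3_4, c3_5]

section
variable {G : Type} [Group G]

def rel3 (a d : G) : G := d * a * d⁻¹ * a * d * a⁻¹ * d⁻¹ * a⁻¹ * d * a⁻¹ * d⁻¹ * a

def T3 (a d : G) : OctFace → G := fun F => match F 0, F 1, F 2 with
  | false, false, false => a
  | false, false, true => d * a * d⁻¹ * a * d
  | false, true, false => d⁻¹ * a⁻¹ * d * a⁻¹ * d⁻¹
  | false, true, true => a⁻¹
  | true, false, false => a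
  | true, false, true => d
  | true, true, false => d⁻¹
  | true, true, true => a⁻¹

theorem rep3_iff (t : OctFace → G) :
    IsRep rep3 t ↔ ∃ a d : G, rel3 a d = 1 ∧ t = T3 a d := by
  rw [rep_words rep3 cs3 (by decide +kernel) (by decide +kernel)]
  constructor
  · rintro ⟨hi, hw⟩
    have i0 : t (fc false true true) = (t (fc false false false))⁻¹ := eq_inv_of_mul_eq_one_left (hi (fc false false false))
    have i1 : t (fc false true false) = (t (fc false false true))⁻¹ := eq_inv_of_mul_eq_one_left (hi (fc false false true))
    have i2 : t (fc true true true) = (t (fc true false false))⁻¹ := eq_inv_of_mul_eq_one_left (hi (fc true false false))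
    have i3 : t (fc true true false) = (t (fc true false true))⁻¹ := eq_inv_of_mul_eq_one_left (hi (fc true false true))
    have w0 := hw c3_0 (by simp [cs3])
    have w2 := hw c3_2 (by simp [cs3])
    have w3 := hw c3_3 (by simp [cs3])
    simp only [c3_0, c3_2, c3_3, wd, one_mul, i0, i1, i2, i3] at w0 w2 w3
    have ht : t = fun F => match F 0, F 1, F 2 with
        | false, false, false => t (fc false false false)
        | false, false, true => t (fc false false true)
        | false, true, false => (t (fc false false true))⁻¹
        | false, true, true => (t (fc false false false))⁻¹
        | true, false, false => t (fc true false false)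
        | true, false, true => t (fc true false true)
        | true, true, false => (t (fc true false true))⁻¹
        | true, true, true => (t (fc true false false))⁻¹ := by
      funext F
      rw [← fc_eta F]
      cases F 0 <;> cases F 1 <;> cases F 2 <;> first | rfl | exact i0 | exact i1 | exact i2 | exact i3
    generalize t (fc false false false) = a at w0 w2 w3 ht
    generalize t (fc false false true) = b at w0 w2 w3 ht
    generalize t (fc true false false) = c at w0 w2 w3 ht
    generalize t (fc true false true) = d at w0 w2 w3 ht
    clear hi hw i0 i1 i2 i3
    have ec : a = c := by
      symm
      have q : c = (a) * (c⁻¹ * a)⁻¹ * 1 := by simp only [mul_assoc, mul_inv_rev, inv_inv, mul_one, one_mul, inv_one, inv_mul_cancel_left, mul_inv_cancel_left, inv_mul_cancel, mul_inv_cancel]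
      rw [q, show c⁻¹ * a = 1 from (by refine Eq.trans ?_ w2; simp only [mul_assoc, mul_inv_rev, inv_inv, mul_one, one_mul, inv_one, inv_mul_cancel_left, mul_inv_cancel_left, inv_mul_cancel, mul_inv_cancel])]; simp only [mul_assoc, mul_inv_rev, inv_inv, mul_one, one_mul, inv_one, inv_mul_cancel_left, mul_inv_cancel_left, inv_mul_cancel, mul_inv_cancel]
    subst ec
    have eb : d * a * d⁻¹ * a * d = b := by
      symm
      have q : b = (d * a * d⁻¹ * a * d) * (d⁻¹ * a⁻¹ * d * a⁻¹ * d⁻¹ * b) * 1 := by simp only [mul_assoc, mul_inv_rev, inv_inv, mul_one, one_mul, inv_one, inv_mul_cancel_left, mul_inv_cancel_left, inv_mul_cancel, mul_inv_cancel]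
      rw [q, show d⁻¹ * a⁻¹ * d * a⁻¹ * d⁻¹ * b = 1 from (by refine Eq.trans ?_ w3; simp only [mul_assoc, mul_inv_rev, inv_inv, mul_one, one_mul, inv_one, inv_mul_cancel_left, mul_inv_cancel_left, inv_mul_cancel, mul_inv_cancel])]; simp only [mul_assoc, mul_inv_rev, inv_inv, mul_one, one_mul, inv_one, inv_mul_cancel_left, mul_inv_cancel_left, inv_mul_cancel, mul_inv_cancel]
    subst eb
    refine ⟨a, d, ?_, ?_⟩
    · have q : rel3 a d = 1 * (d * a * d⁻¹ * a * d * a⁻¹ * d⁻¹ * a⁻¹ * d * a⁻¹ * d⁻¹ * a) * 1 := by unfold rel3; simp only [mul_assoc, mul_inv_rev, inv_inv, mul_one, one_mul, inv_one, inv_mul_cancel_left, mul_inv_cancel_left, inv_mul_cancel, mul_inv_cancel]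
      rw [q, show d * a * d⁻¹ * a * d * a⁻¹ * d⁻¹ * a⁻¹ * d * a⁻¹ * d⁻¹ * a = 1 from (by refine Eq.trans ?_ w0; simp only [mul_assoc, mul_inv_rev, inv_inv, mul_one, one_mul, inv_one, inv_mul_cancel_left, mul_inv_cancel_left, inv_mul_cancel, mul_inv_cancel])]; simp only [mul_assoc, mul_inv_rev, inv_inv, mul_one, one_mul, inv_one, inv_mul_cancel_left, mul_inv_cancel_left, inv_mul_cancel, mul_inv_cancel]
    · rw [ht]; funext F; rw [← fc_eta F]
      cases F 0 <;> cases F 1 <;> cases F 2 <;> simp [T3, fc, mul_assoc]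
  · rintro ⟨a, d, h, rfl⟩
    constructor
    · intro F; rw [← fc_eta F]
      cases F 0 <;> cases F 1 <;> cases F 2 <;> simp [T3, rep3, dat3, mkG, Gluing.face, fc, mul_assoc]
    have f0 : T3 a d (fc false false false) = a := rfl
    have f1 : T3 a d (fc false false true) = d * a * d⁻¹ * a * d := rfl
    have f2 : T3 a d (fc false true false) = d⁻¹ * a⁻¹ * d * a⁻¹ * d⁻¹ := rfl
    have f3 : T3 a d (fc false true true) = a⁻¹ := rfl
    have f4 : T3 a d (fc true false false) = a := rfl
    have f5 : T3 a d (fc true false true) = d := rfl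
    have f6 : T3 a d (fc true true false) = d⁻¹ := rfl
    have f7 : T3 a d (fc true true true) = a⁻¹ := rfl
    have g0 : (d * a * d⁻¹ * a * d) * a⁻¹ * (d⁻¹ * a⁻¹ * d * a⁻¹ * d⁻¹) * a = 1 := by
      rw [show (d * a * d⁻¹ * a * d) * a⁻¹ * (d⁻¹ * a⁻¹ * d * a⁻¹ * d⁻¹) * a = 1 * rel3 a d * 1 from (by unfold rel3; simp only [mul_assoc, mul_inv_rev, inv_inv, mul_one, one_mul, inv_one, inv_mul_cancel_left, mul_inv_cancel_left, inv_mul_cancel, mul_inv_cancel]), h]; simp only [mul_assoc, mul_inv_rev, inv_inv, mul_one, one_mul, inv_one, inv_mul_cancel_left, mul_inv_cancel_left, inv_mul_cancel, mul_inv_cancel]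
    have g1 : (d⁻¹ * a⁻¹ * d * a⁻¹ * d⁻¹) * a⁻¹ * (d * a * d⁻¹ * a * d) * a = 1 := by
      rw [show (d⁻¹ * a⁻¹ * d * a⁻¹ * d⁻¹) * a⁻¹ * (d * a * d⁻¹ * a * d) * a = (a⁻¹ * d⁻¹ * a⁻¹ * d * a⁻¹ * d⁻¹ * a) * (rel3 a d)⁻¹ * (a⁻¹ * d * a * d⁻¹ * a * d * a) from (by unfold rel3; simp only [mul_assoc, mul_inv_rev, inv_inv, mul_one, one_mul, inv_one, inv_mul_cancel_left, mul_inv_cancel_left, inv_mul_cancel, mul_inv_cancel]), h]; simp only [mul_assoc, mul_inv_rev, inv_inv, mul_one, one_mul, inv_one, inv_mul_cancel_left, mul_inv_cancel_left, inv_mul_cancel, mul_inv_cancel]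
    have g2 : a⁻¹ * a = 1 := by simp only [mul_assoc, mul_inv_rev, inv_inv, mul_one, one_mul, inv_one, inv_mul_cancel_left, mul_inv_cancel_left, inv_mul_cancel, mul_inv_cancel]
    have g3 : d⁻¹ * a⁻¹ * d * a⁻¹ * d⁻¹ * (d * a * d⁻¹ * a * d) = 1 := by simp only [mul_assoc, mul_inv_rev, inv_inv, mul_one, one_mul, inv_one, inv_mul_cancel_left, mul_inv_cancel_left, inv_mul_cancel, mul_inv_cancel]
    have g4 : d * a * d⁻¹ * a * d * (d⁻¹ * a⁻¹ * d * a⁻¹ * d⁻¹) = 1 := by simp only [mul_assoc, mul_inv_rev, inv_inv, mul_one, one_mul, inv_one, inv_mul_cancel_left, mul_inv_cancel_left, inv_mul_cancel, mul_inv_cancel]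
    have g5 : a * a⁻¹ = 1 := by simp only [mul_assoc, mul_inv_rev, inv_inv, mul_one, one_mul, inv_one, inv_mul_cancel_left, mul_inv_cancel_left, inv_mul_cancel, mul_inv_cancel]
    intro l hl
    simp only [cs3, List.mem_cons, List.not_mem_nil, or_false] at hl
    rcases hl with rfl | rfl | rfl | rfl | rfl | rfl
    · simp only [c3_0, wd, one_mul, f0, f1, f2, f3, f4, f5, f6, f7]; exact g0
    · simp only [c3_1, wd, one_mul, f0, f1, f2, f3, f4, f5, f6, f7]; exact g1
    · simp only [c3_2, wd, one_mul, f0, f1, f2, f3, f4, f5, f6, f7]; exact g2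
    · simp only [c3_3, wd, one_mul, f0, f1, f2, f3, f4, f5, f6, f7]; exact g3
    · simp only [c3_4, wd, one_mul, f0, f1, f2, f3, f4, f5, f6, f7]; exact g4
    · simp only [c3_5, wd, one_mul, f0, f1, f2, f3, f4, f5, f6, f7]; exact g5
end

/-! #### representative 4 -/

def c4_0 : List En := [(fc false false false, 0), (fc false true false, 0), (fc false true true, 0), (fc false false true, 0)]
def c4_1 : List En := [(fc false false false, 1), (fc false false true, 2), (fc false true true, 1), (fc false true false, 2)]
def c4_2 : List En := [(fc false false false, 2), (fc true true true, 1), (fc true true false, 0), (fc false false true, 1), (fc true true false, 2), (fc true true true, 2)]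
def c4_3 : List En := [(fc false true false, 1), (fc true false true, 2), (fc true false false, 2), (fc false true true, 2), (fc true false false, 1), (fc true false true, 0)]
def c4_4 : List En := [(fc true false false, 0), (fc true true false, 1)]
def c4_5 : List En := [(fc true false true, 1), (fc true true true, 0)]
def cs4 : List (List En) := [c4_0, c4_1, c4_2, c4_3, c4_4, c4_5]

section
variable {G : Type} [Group G]

def rel4 (a c : G) : G := c * c * a⁻¹ * c * c * a⁻¹ * c⁻¹ * c⁻¹ * a * c⁻¹ * c⁻¹ * a

def T4 (a c : G) : OctFace → G := fun F => match F 0, F 1, F 2 with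
  | false, false, false => a
  | false, false, true => c * c * a⁻¹ * c * c
  | false, true, false => c⁻¹ * c⁻¹ * a * c⁻¹ * c⁻¹
  | false, true, true => a⁻¹
  | true, false, false => c
  | true, false, true => c
  | true, true, false => c⁻¹
  | true, true, true => c⁻¹

theorem rep4_iff (t : OctFace → G) :
    IsRep rep4 t ↔ ∃ a c : G, rel4 a c = 1 ∧ t = T4 a c := by
  rw [rep_words rep4 cs4 (by decide +kernel) (by decide +kernel)]
  constructor
  · rintro ⟨hi, hw⟩
    have i0 : t (fc false true true) = (t (fc false false false))⁻¹ := eq_inv_of_mul_eq_one_left (hi (fc false false false))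
    have i1 : t (fc false true false) = (t (fc false false true))⁻¹ := eq_inv_of_mul_eq_one_left (hi (fc false false true))
    have i2 : t (fc true true true) = (t (fc true false false))⁻¹ := eq_inv_of_mul_eq_one_left (hi (fc true false false))
    have i3 : t (fc true true false) = (t (fc true false true))⁻¹ := eq_inv_of_mul_eq_one_left (hi (fc true false true))
    have w0 := hw c4_0 (by simp [cs4])
    have w2 := hw c4_2 (by simp [cs4])
    have w4 := hw c4_4 (by simp [cs4])
    simp only [c4_0, c4_2, c4_4, wd, one_mul, i0, i1, i2, i3] at w0 w2 w4
    have ht : t = fun F => match F 0, F 1, F 2 with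
        | false, false, false => t (fc false false false)
        | false, false, true => t (fc false false true)
        | false, true, false => (t (fc false false true))⁻¹
        | false, true, true => (t (fc false false false))⁻¹
        | true, false, false => t (fc true false false)
        | true, false, true => t (fc true false true)
        | true, true, false => (t (fc true false true))⁻¹
        | true, true, true => (t (fc true false false))⁻¹ := by
      funext F
      rw [← fc_eta F]
      cases F 0 <;> cases F 1 <;> cases F 2 <;> first | rfl | exact i0 | exact i1 | exact i2 | exact i3
    generalize t (fc false false false) = a at w0 w2 w4 ht
    generalize t (fc false false true) = b at w0 w2 w4 ht
    generalize t (fc true false false) = c at w0 w2 w4 ht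
    generalize t (fc true false true) = d at w0 w2 w4 ht
    clear hi hw i0 i1 i2 i3
    have ed : c = d := by
      symm
      have q : d = (c) * (d⁻¹ * c)⁻¹ * 1 := by simp only [mul_assoc, mul_inv_rev, inv_inv, mul_one, one_mul, inv_one, inv_mul_cancel_left, mul_inv_cancel_left, inv_mul_cancel, mul_inv_cancel]
      rw [q, show d⁻¹ * c = 1 from (by refine Eq.trans ?_ w4; simp only [mul_assoc, mul_inv_rev, inv_inv, mul_one, one_mul, inv_one, inv_mul_cancel_left, mul_inv_cancel_left, inv_mul_cancel, mul_inv_cancel])]; simp only [mul_assoc, mul_inv_rev, inv_inv, mul_one, one_mul, inv_one, inv_mul_cancel_left, mul_inv_cancel_left, inv_mul_cancel, mul_inv_cancel]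
    subst ed
    have eb : c * c * a⁻¹ * c * c = b := by
      symm
      have q : b = (c * c) * (c⁻¹ * c⁻¹ * b * c⁻¹ * c⁻¹ * a) * (a⁻¹ * c * c) := by simp only [mul_assoc, mul_inv_rev, inv_inv, mul_one, one_mul, inv_one, inv_mul_cancel_left, mul_inv_cancel_left, inv_mul_cancel, mul_inv_cancel]
      rw [q, show c⁻¹ * c⁻¹ * b * c⁻¹ * c⁻¹ * a = 1 from (by refine Eq.trans ?_ w2; simp only [mul_assoc, mul_inv_rev, inv_inv, mul_one, one_mul, inv_one, inv_mul_cancel_left, mul_inv_cancel_left, inv_mul_cancel, mul_inv_cancel])]; simp only [mul_assoc, mul_inv_rev, inv_inv, mul_one, one_mul, inv_one, inv_mul_cancel_left, mul_inv_cancel_left, inv_mul_cancel, mul_inv_cancel]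
    subst eb
    refine ⟨a, c, ?_, ?_⟩
    · have q : rel4 a c = 1 * (c * c * a⁻¹ * c * c * a⁻¹ * c⁻¹ * c⁻¹ * a * c⁻¹ * c⁻¹ * a) * 1 := by unfold rel4; simp only [mul_assoc, mul_inv_rev, inv_inv, mul_one, one_mul, inv_one, inv_mul_cancel_left, mul_inv_cancel_left, inv_mul_cancel, mul_inv_cancel]
      rw [q, show c * c * a⁻¹ * c * c * a⁻¹ * c⁻¹ * c⁻¹ * a * c⁻¹ * c⁻¹ * a = 1 from (by refine Eq.trans ?_ w0; simp only [mul_assoc, mul_inv_rev, inv_inv, mul_one, one_mul, inv_one, inv_mul_cancel_left, mul_inv_cancel_left, inv_mul_cancel, mul_inv_cancel])]; simp only [mul_assoc, mul_inv_rev, inv_inv, mul_one, one_mul, inv_one, inv_mul_cancel_left, mul_inv_cancel_left, inv_mul_cancel, mul_inv_cancel]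
    · rw [ht]; funext F; rw [← fc_eta F]
      cases F 0 <;> cases F 1 <;> cases F 2 <;> simp [T4, fc, mul_assoc]
  · rintro ⟨a, c, h, rfl⟩
    constructor
    · intro F; rw [← fc_eta F]
      cases F 0 <;> cases F 1 <;> cases F 2 <;> simp [T4, rep4, dat4, mkG, Gluing.face, fc, mul_assoc]
    have f0 : T4 a c (fc false false false) = a := rfl
    have f1 : T4 a c (fc false false true) = c * c * a⁻¹ * c * c := rfl
    have f2 : T4 a c (fc false true false) = c⁻¹ * c⁻¹ * a * c⁻¹ * c⁻¹ := rfl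
    have f3 : T4 a c (fc false true true) = a⁻¹ := rfl
    have f4 : T4 a c (fc true false false) = c := rfl
    have f5 : T4 a c (fc true false true) = c := rfl
    have f6 : T4 a c (fc true true false) = c⁻¹ := rfl
    have f7 : T4 a c (fc true true true) = c⁻¹ := rfl
    have g0 : (c * c * a⁻¹ * c * c) * a⁻¹ * (c⁻¹ * c⁻¹ * a * c⁻¹ * c⁻¹) * a = 1 := by
      rw [show (c * c * a⁻¹ * c * c) * a⁻¹ * (c⁻¹ * c⁻¹ * a * c⁻¹ * c⁻¹) * a = 1 * rel4 a c * 1 from (by unfold rel4; simp only [mul_assoc, mul_inv_rev, inv_inv, mul_one, one_mul, inv_one, inv_mul_cancel_left, mul_inv_cancel_left, inv_mul_cancel, mul_inv_cancel]), h]; simp only [mul_assoc, mul_inv_rev, inv_inv, mul_one, one_mul, inv_one, inv_mul_cancel_left, mul_inv_cancel_left, inv_mul_cancel, mul_inv_cancel]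
    have g1 : (c⁻¹ * c⁻¹ * a * c⁻¹ * c⁻¹) * a⁻¹ * (c * c * a⁻¹ * c * c) * a = 1 := by
      rw [show (c⁻¹ * c⁻¹ * a * c⁻¹ * c⁻¹) * a⁻¹ * (c * c * a⁻¹ * c * c) * a = (a⁻¹ * c⁻¹ * c⁻¹ * a * c⁻¹ * c⁻¹ * a) * (rel4 a c)⁻¹ * (a⁻¹ * c * c * a⁻¹ * c * c * a) from (by unfold rel4; simp only [mul_assoc, mul_inv_rev, inv_inv, mul_one, one_mul, inv_one, inv_mul_cancel_left, mul_inv_cancel_left, inv_mul_cancel, mul_inv_cancel]), h]; simp only [mul_assoc, mul_inv_rev, inv_inv, mul_one, one_mul, inv_one, inv_mul_cancel_left, mul_inv_cancel_left, inv_mul_cancel, mul_inv_cancel]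
    have g2 : c⁻¹ * c⁻¹ * (c * c * a⁻¹ * c * c) * c⁻¹ * c⁻¹ * a = 1 := by simp only [mul_assoc, mul_inv_rev, inv_inv, mul_one, one_mul, inv_one, inv_mul_cancel_left, mul_inv_cancel_left, inv_mul_cancel, mul_inv_cancel]
    have g3 : c * c * a⁻¹ * c * c * (c⁻¹ * c⁻¹ * a * c⁻¹ * c⁻¹) = 1 := by simp only [mul_assoc, mul_inv_rev, inv_inv, mul_one, one_mul, inv_one, inv_mul_cancel_left, mul_inv_cancel_left, inv_mul_cancel, mul_inv_cancel]
    have g4 : c⁻¹ * c = 1 := by simp only [mul_assoc, mul_inv_rev, inv_inv, mul_one, one_mul, inv_one, inv_mul_cancel_left, mul_inv_cancel_left, inv_mul_cancel, mul_inv_cancel]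
    have g5 : c⁻¹ * c = 1 := by simp only [mul_assoc, mul_inv_rev, inv_inv, mul_one, one_mul, inv_one, inv_mul_cancel_left, mul_inv_cancel_left, inv_mul_cancel, mul_inv_cancel]
    intro l hl
    simp only [cs4, List.mem_cons, List.not_mem_nil, or_false] at hl
    rcases hl with rfl | rfl | rfl | rfl | rfl | rfl
    · simp only [c4_0, wd, one_mul, f0, f1, f2, f3, f4, f5, f6, f7]; exact g0
    · simp only [c4_1, wd, one_mul, f0, f1, f2, f3, f4, f5, f6, f7]; exact g1
    · simp only [c4_2, wd, one_mul, f0, f1, f2, f3, f4, f5, f6, f7]; exact g2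
    · simp only [c4_3, wd, one_mul, f0, f1, f2, f3, f4, f5, f6, f7]; exact g3
    · simp only [c4_4, wd, one_mul, f0, f1, f2, f3, f4, f5, f6, f7]; exact g4
    · simp only [c4_5, wd, one_mul, f0, f1, f2, f3, f4, f5, f6, f7]; exact g5
end

/-! #### representative 5 -/

def c5_0 : List En := [(fc false false false, 0), (fc false true false, 0), (fc false true true, 0), (fc false false true, 0)]
def c5_1 : List En := [(fc false false false, 1), (fc false false true, 2), (fc false true true, 1), (fc false true false, 2)]
def c5_2 : List En := [(fc false false false, 2), (fc true true true, 1), (fc true true false, 0), (fc true true true, 2)]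
def c5_3 : List En := [(fc false false true, 1), (fc true true false, 2), (fc true false false, 0), (fc true true false, 1)]
def c5_4 : List En := [(fc false true false, 1), (fc true false true, 2), (fc true true true, 0), (fc true false true, 1)]
def c5_5 : List En := [(fc false true true, 2), (fc true false false, 1), (fc true false true, 0), (fc true false false, 2)]
def cs5 : List (List En) := [c5_0, c5_1, c5_2, c5_3, c5_4, c5_5]

section
variable {G : Type} [Group G]

def rel5 (b d : G) : G := b * d⁻¹ * b * d⁻¹ * d⁻¹ * d⁻¹ * b * d⁻¹ * b⁻¹ * d * b⁻¹ * d * d * d * b⁻¹ * d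

def T5 (b d : G) : OctFace → G := fun F => match F 0, F 1, F 2 with
  | false, false, false => d * b⁻¹ * d * d * d * b⁻¹ * d
  | false, false, true => b
  | false, true, false => b⁻¹
  | false, true, true => d⁻¹ * b * d⁻¹ * d⁻¹ * d⁻¹ * b * d⁻¹
  | true, false, false => d * b⁻¹ * d
  | true, false, true => d
  | true, true, false => d⁻¹
  | true, true, true => d⁻¹ * b * d⁻¹

theorem rep5_iff (t : OctFace → G) :
    IsRep rep5 t ↔ ∃ b d : G, rel5 b d = 1 ∧ t = T5 b d := by
  rw [rep_words rep5 cs5 (by decide +kernel) (by decide +kernel)]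
  constructor
  · rintro ⟨hi, hw⟩
    have i0 : t (fc false true true) = (t (fc false false false))⁻¹ := eq_inv_of_mul_eq_one_left (hi (fc false false false))
    have i1 : t (fc false true false) = (t (fc false false true))⁻¹ := eq_inv_of_mul_eq_one_left (hi (fc false false true))
    have i2 : t (fc true true true) = (t (fc true false false))⁻¹ := eq_inv_of_mul_eq_one_left (hi (fc true false false))
    have i3 : t (fc true true false) = (t (fc true false true))⁻¹ := eq_inv_of_mul_eq_one_left (hi (fc true false true))
    have w0 := hw c5_0 (by simp [cs5])
    have w2 := hw c5_2 (by simp [cs5])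
    have w3 := hw c5_3 (by simp [cs5])
    simp only [c5_0, c5_2, c5_3, wd, one_mul, i0, i1, i2, i3] at w0 w2 w3
    have ht : t = fun F => match F 0, F 1, F 2 with
        | false, false, false => t (fc false false false)
        | false, false, true => t (fc false false true)
        | false, true, false => (t (fc false false true))⁻¹
        | false, true, true => (t (fc false false false))⁻¹
        | true, false, false => t (fc true false false)
        | true, false, true => t (fc true false true)
        | true, true, false => (t (fc true false true))⁻¹
        | true, true, true => (t (fc true false false))⁻¹ := by
      funext F
      rw [← fc_eta F]
      cases F 0 <;> cases F 1 <;> cases F 2 <;> first | rfl | exact i0 | exact i1 | exact i2 | exact i3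
    generalize t (fc false false false) = a at w0 w2 w3 ht
    generalize t (fc false false true) = b at w0 w2 w3 ht
    generalize t (fc true false false) = c at w0 w2 w3 ht
    generalize t (fc true false true) = d at w0 w2 w3 ht
    clear hi hw i0 i1 i2 i3
    have ec : d * b⁻¹ * d = c := by
      symm
      have q : c = (d) * (d⁻¹ * c * d⁻¹ * b) * (b⁻¹ * d) := by simp only [mul_assoc, mul_inv_rev, inv_inv, mul_one, one_mul, inv_one, inv_mul_cancel_left, mul_inv_cancel_left, inv_mul_cancel, mul_inv_cancel]
      rw [q, show d⁻¹ * c * d⁻¹ * b = 1 from (by refine Eq.trans ?_ w3; simp only [mul_assoc, mul_inv_rev, inv_inv, mul_one, one_mul, inv_one, inv_mul_cancel_left, mul_inv_cancel_left, inv_mul_cancel, mul_inv_cancel])]; simp only [mul_assoc, mul_inv_rev, inv_inv, mul_one, one_mul, inv_one, inv_mul_cancel_left, mul_inv_cancel_left, inv_mul_cancel, mul_inv_cancel]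
    subst ec
    have ea : d * b⁻¹ * d * d * d * b⁻¹ * d = a := by
      symm
      have q : a = (d * b⁻¹ * d * d * d * b⁻¹ * d) * (d⁻¹ * b * d⁻¹ * d⁻¹ * d⁻¹ * b * d⁻¹ * a) * 1 := by simp only [mul_assoc, mul_inv_rev, inv_inv, mul_one, one_mul, inv_one, inv_mul_cancel_left, mul_inv_cancel_left, inv_mul_cancel, mul_inv_cancel]
      rw [q, show d⁻¹ * b * d⁻¹ * d⁻¹ * d⁻¹ * b * d⁻¹ * a = 1 from (by refine Eq.trans ?_ w2; simp only [mul_assoc, mul_inv_rev, inv_inv, mul_one, one_mul, inv_one, inv_mul_cancel_left, mul_inv_cancel_left, inv_mul_cancel, mul_inv_cancel])]; simp only [mul_assoc, mul_inv_rev, inv_inv, mul_one, one_mul, inv_one, inv_mul_cancel_left, mul_inv_cancel_left, inv_mul_cancel, mul_inv_cancel]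
    subst ea
    refine ⟨b, d, ?_, ?_⟩
    · have q : rel5 b d = 1 * (b * d⁻¹ * b * d⁻¹ * d⁻¹ * d⁻¹ * b * d⁻¹ * b⁻¹ * d * b⁻¹ * d * d * d * b⁻¹ * d) * 1 := by unfold rel5; simp only [mul_assoc, mul_inv_rev, inv_inv, mul_one, one_mul, inv_one, inv_mul_cancel_left, mul_inv_cancel_left, inv_mul_cancel, mul_inv_cancel]
      rw [q, show b * d⁻¹ * b * d⁻¹ * d⁻¹ * d⁻¹ * b * d⁻¹ * b⁻¹ * d * b⁻¹ * d * d * d * b⁻¹ * d = 1 from (by refine Eq.trans ?_ w0; simp only [mul_assoc, mul_inv_rev, inv_inv, mul_one, one_mul, inv_one, inv_mul_cancel_left, mul_inv_cancel_left, inv_mul_cancel, mul_inv_cancel])]; simp only [mul_assoc, mul_inv_rev, inv_inv, mul_one, one_mul, inv_one, inv_mul_cancel_left, mul_inv_cancel_left, inv_mul_cancel, mul_inv_cancel]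
    · rw [ht]; funext F; rw [← fc_eta F]
      cases F 0 <;> cases F 1 <;> cases F 2 <;> simp [T5, fc, mul_assoc]
  · rintro ⟨b, d, h, rfl⟩
    constructor
    · intro F; rw [← fc_eta F]
      cases F 0 <;> cases F 1 <;> cases F 2 <;> simp [T5, rep5, dat5, mkG, Gluing.face, fc, mul_assoc]
    have f0 : T5 b d (fc false false false) = d * b⁻¹ * d * d * d * b⁻¹ * d := rfl
    have f1 : T5 b d (fc false false true) = b := rfl
    have f2 : T5 b d (fc false true false) = b⁻¹ := rfl
    have f3 : T5 b d (fc false true true) = d⁻¹ * b * d⁻¹ * d⁻¹ * d⁻¹ * b * d⁻¹ := rfl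
    have f4 : T5 b d (fc true false false) = d * b⁻¹ * d := rfl
    have f5 : T5 b d (fc true false true) = d := rfl
    have f6 : T5 b d (fc true true false) = d⁻¹ := rfl
    have f7 : T5 b d (fc true true true) = d⁻¹ * b * d⁻¹ := rfl
    have g0 : b * (d⁻¹ * b * d⁻¹ * d⁻¹ * d⁻¹ * b * d⁻¹) * b⁻¹ * (d * b⁻¹ * d * d * d * b⁻¹ * d) = 1 := by
      rw [show b * (d⁻¹ * b * d⁻¹ * d⁻¹ * d⁻¹ * b * d⁻¹) * b⁻¹ * (d * b⁻¹ * d * d * d * b⁻¹ * d) = 1 * rel5 b d * 1 from (by unfold rel5; simp only [mul_assoc, mul_inv_rev, inv_inv, mul_one, one_mul, inv_one, inv_mul_cancel_left, mul_inv_cancel_left, inv_mul_cancel, mul_inv_cancel]), h]; simp only [mul_assoc, mul_inv_rev, inv_inv, mul_one, one_mul, inv_one, inv_mul_cancel_left, mul_inv_cancel_left, inv_mul_cancel, mul_inv_cancel]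
    have g1 : b⁻¹ * (d⁻¹ * b * d⁻¹ * d⁻¹ * d⁻¹ * b * d⁻¹) * b * (d * b⁻¹ * d * d * d * b⁻¹ * d) = 1 := by
      rw [show b⁻¹ * (d⁻¹ * b * d⁻¹ * d⁻¹ * d⁻¹ * b * d⁻¹) * b * (d * b⁻¹ * d * d * d * b⁻¹ * d) = (d⁻¹ * b * d⁻¹ * d⁻¹ * d⁻¹ * b * d⁻¹ * b⁻¹ * d * b⁻¹ * d * d * d * b⁻¹ * d) * (rel5 b d)⁻¹ * (d⁻¹ * b * d⁻¹ * d⁻¹ * d⁻¹ * b * d⁻¹ * b * d * b⁻¹ * d * d * d * b⁻¹ * d) from (by unfold rel5; simp only [mul_assoc, mul_inv_rev, inv_inv, mul_one, one_mul, inv_one, inv_mul_cancel_left, mul_inv_cancel_left, inv_mul_cancel, mul_inv_cancel]), h]; simp only [mul_assoc, mul_inv_rev, inv_inv, mul_one, one_mul, inv_one, inv_mul_cancel_left, mul_inv_cancel_left, inv_mul_cancel, mul_inv_cancel]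
    have g2 : (d⁻¹ * b * d⁻¹) * d⁻¹ * (d⁻¹ * b * d⁻¹) * (d * b⁻¹ * d * d * d * b⁻¹ * d) = 1 := by simp only [mul_assoc, mul_inv_rev, inv_inv, mul_one, one_mul, inv_one, inv_mul_cancel_left, mul_inv_cancel_left, inv_mul_cancel, mul_inv_cancel]
    have g3 : d⁻¹ * (d * b⁻¹ * d) * d⁻¹ * b = 1 := by simp only [mul_assoc, mul_inv_rev, inv_inv, mul_one, one_mul, inv_one, inv_mul_cancel_left, mul_inv_cancel_left, inv_mul_cancel, mul_inv_cancel]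
    have g4 : d * (d⁻¹ * b * d⁻¹) * d * b⁻¹ = 1 := by simp only [mul_assoc, mul_inv_rev, inv_inv, mul_one, one_mul, inv_one, inv_mul_cancel_left, mul_inv_cancel_left, inv_mul_cancel, mul_inv_cancel]
    have g5 : (d * b⁻¹ * d) * d * (d * b⁻¹ * d) * (d⁻¹ * b * d⁻¹ * d⁻¹ * d⁻¹ * b * d⁻¹) = 1 := by simp only [mul_assoc, mul_inv_rev, inv_inv, mul_one, one_mul, inv_one, inv_mul_cancel_left, mul_inv_cancel_left, inv_mul_cancel, mul_inv_cancel]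
    intro l hl
    simp only [cs5, List.mem_cons, List.not_mem_nil, or_false] at hl
    rcases hl with rfl | rfl | rfl | rfl | rfl | rfl
    · simp only [c5_0, wd, one_mul, f0, f1, f2, f3, f4, f5, f6, f7]; exact g0
    · simp only [c5_1, wd, one_mul, f0, f1, f2, f3, f4, f5, f6, f7]; exact g1
    · simp only [c5_2, wd, one_mul, f0, f1, f2, f3, f4, f5, f6, f7]; exact g2
    · simp only [c5_3, wd, one_mul, f0, f1, f2, f3, f4, f5, f6, f7]; exact g3
    · simp only [c5_4, wd, one_mul, f0, f1, f2, f3, f4, f5, f6, f7]; exact g4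
    · simp only [c5_5, wd, one_mul, f0, f1, f2, f3, f4, f5, f6, f7]; exact g5
end

/-! #### representative 7 -/

def c7_0 : List En := [(fc false false false, 0), (fc false true false, 0), (fc true false true, 0), (fc true true true, 0)]
def c7_1 : List En := [(fc false false false, 1), (fc false false true, 2), (fc true false true, 1), (fc true false false, 2)]
def c7_2 : List En := [(fc false false false, 2), (fc true true true, 1), (fc true true false, 2), (fc false false true, 1)]
def c7_3 : List En := [(fc false false true, 0), (fc true true false, 0), (fc true false false, 0), (fc false true true, 0)]
def c7_4 : List En := [(fc false true false, 1), (fc false true true, 2), (fc true false false, 1), (fc true false true, 2)]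
def c7_5 : List En := [(fc false true false, 2), (fc true true false, 1), (fc true true true, 2), (fc false true true, 1)]
def cs7 : List (List En) := [c7_0, c7_1, c7_2, c7_3, c7_4, c7_5]

section
variable {G : Type} [Group G]

def rel7 (b d : G) : G := d * b⁻¹ * b⁻¹ * d * b * d * b⁻¹ * d⁻¹ * b * b * d⁻¹ * b⁻¹ * d⁻¹ * b

def T7 (b d : G) : OctFace → G := fun F => match F 0, F 1, F 2 with
  | false, false, false => b⁻¹ * d⁻¹ * b
  | false, false, true => b
  | false, true, false => b⁻¹ * d⁻¹ * b * b * d⁻¹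
  | false, true, true => b⁻¹ * d * b
  | true, false, false => b⁻¹
  | true, false, true => d
  | true, true, false => d⁻¹
  | true, true, true => d * b⁻¹ * b⁻¹ * d * b

theorem rep7_iff (t : OctFace → G) :
    IsRep rep7 t ↔ ∃ b d : G, rel7 b d = 1 ∧ t = T7 b d := by
  rw [rep_words rep7 cs7 (by decide +kernel) (by decide +kernel)]
  constructor
  · rintro ⟨hi, hw⟩
    have i0 : t (fc false true true) = (t (fc false false false))⁻¹ := eq_inv_of_mul_eq_one_left (hi (fc false false false))
    have i1 : t (fc true false false) = (t (fc false false true))⁻¹ := eq_inv_of_mul_eq_one_left (hi (fc false false true))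
    have i2 : t (fc true true true) = (t (fc false true false))⁻¹ := eq_inv_of_mul_eq_one_left (hi (fc false true false))
    have i3 : t (fc true true false) = (t (fc true false true))⁻¹ := eq_inv_of_mul_eq_one_left (hi (fc true false true))
    have w0 := hw c7_0 (by simp [cs7])
    have w1 := hw c7_1 (by simp [cs7])
    have w2 := hw c7_2 (by simp [cs7])
    simp only [c7_0, c7_1, c7_2, wd, one_mul, i0, i1, i2, i3] at w0 w1 w2
    have ht : t = fun F => match F 0, F 1, F 2 with
        | false, false, false => t (fc false false false)
        | false, false, true => t (fc false false true)
        | false, true, false => t (fc false true false)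
        | false, true, true => (t (fc false false false))⁻¹
        | true, false, false => (t (fc false false true))⁻¹
        | true, false, true => t (fc true false true)
        | true, true, false => (t (fc true false true))⁻¹
        | true, true, true => (t (fc false true false))⁻¹ := by
      funext F
      rw [← fc_eta F]
      cases F 0 <;> cases F 1 <;> cases F 2 <;> first | rfl | exact i0 | exact i1 | exact i2 | exact i3
    generalize t (fc false false false) = a at w0 w1 w2 ht
    generalize t (fc false false true) = b at w0 w1 w2 ht
    generalize t (fc false true false) = c at w0 w1 w2 ht
    generalize t (fc true false true) = d at w0 w1 w2 ht
    clear hi hw i0 i1 i2 i3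
    have ec : a * b * d⁻¹ = c := by
      symm
      have q : c = (a) * (b * d⁻¹ * c⁻¹ * a)⁻¹ * (b * d⁻¹) := by simp only [mul_assoc, mul_inv_rev, inv_inv, mul_one, one_mul, inv_one, inv_mul_cancel_left, mul_inv_cancel_left, inv_mul_cancel, mul_inv_cancel]
      rw [q, show b * d⁻¹ * c⁻¹ * a = 1 from (by refine Eq.trans ?_ w2; simp only [mul_assoc, mul_inv_rev, inv_inv, mul_one, one_mul, inv_one, inv_mul_cancel_left, mul_inv_cancel_left, inv_mul_cancel, mul_inv_cancel])]; simp only [mul_assoc, mul_inv_rev, inv_inv, mul_one, one_mul, inv_one, inv_mul_cancel_left, mul_inv_cancel_left, inv_mul_cancel, mul_inv_cancel]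
    subst ec
    have ea : b⁻¹ * d⁻¹ * b = a := by
      symm
      have q : a = (b⁻¹ * d⁻¹ * b) * (b⁻¹ * d * b * a) * 1 := by simp only [mul_assoc, mul_inv_rev, inv_inv, mul_one, one_mul, inv_one, inv_mul_cancel_left, mul_inv_cancel_left, inv_mul_cancel, mul_inv_cancel]
      rw [q, show b⁻¹ * d * b * a = 1 from (by refine Eq.trans ?_ w1; simp only [mul_assoc, mul_inv_rev, inv_inv, mul_one, one_mul, inv_one, inv_mul_cancel_left, mul_inv_cancel_left, inv_mul_cancel, mul_inv_cancel])]; simp only [mul_assoc, mul_inv_rev, inv_inv, mul_one, one_mul, inv_one, inv_mul_cancel_left, mul_inv_cancel_left, inv_mul_cancel, mul_inv_cancel]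
    subst ea
    refine ⟨b, d, ?_, ?_⟩
    · have q : rel7 b d = 1 * (d * b⁻¹ * b⁻¹ * d * b * d * b⁻¹ * d⁻¹ * b * b * d⁻¹ * b⁻¹ * d⁻¹ * b) * 1 := by unfold rel7; simp only [mul_assoc, mul_inv_rev, inv_inv, mul_one, one_mul, inv_one, inv_mul_cancel_left, mul_inv_cancel_left, inv_mul_cancel, mul_inv_cancel]
      rw [q, show d * b⁻¹ * b⁻¹ * d * b * d * b⁻¹ * d⁻¹ * b * b * d⁻¹ * b⁻¹ * d⁻¹ * b = 1 from (by refine Eq.trans ?_ w0; simp only [mul_assoc, mul_inv_rev, inv_inv, mul_one, one_mul, inv_one, inv_mul_cancel_left, mul_inv_cancel_left, inv_mul_cancel, mul_inv_cancel])]; simp only [mul_assoc, mul_inv_rev, inv_inv, mul_one, one_mul, inv_one, inv_mul_cancel_left, mul_inv_cancel_left, inv_mul_cancel, mul_inv_cancel]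
    · rw [ht]; funext F; rw [← fc_eta F]
      cases F 0 <;> cases F 1 <;> cases F 2 <;> simp [T7, fc, mul_assoc]
  · rintro ⟨b, d, h, rfl⟩
    constructor
    · intro F; rw [← fc_eta F]
      cases F 0 <;> cases F 1 <;> cases F 2 <;> simp [T7, rep7, dat7, mkG, Gluing.face, fc, mul_assoc]
    have f0 : T7 b d (fc false false false) = b⁻¹ * d⁻¹ * b := rfl
    have f1 : T7 b d (fc false false true) = b := rfl
    have f2 : T7 b d (fc false true false) = b⁻¹ * d⁻¹ * b * b * d⁻¹ := rfl
    have f3 : T7 b d (fc false true true) = b⁻¹ * d * b := rfl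
    have f4 : T7 b d (fc true false false) = b⁻¹ := rfl
    have f5 : T7 b d (fc true false true) = d := rfl
    have f6 : T7 b d (fc true true false) = d⁻¹ := rfl
    have f7 : T7 b d (fc true true true) = d * b⁻¹ * b⁻¹ * d * b := rfl
    have g0 : (d * b⁻¹ * b⁻¹ * d * b) * d * (b⁻¹ * d⁻¹ * b * b * d⁻¹) * (b⁻¹ * d⁻¹ * b) = 1 := by
      rw [show (d * b⁻¹ * b⁻¹ * d * b) * d * (b⁻¹ * d⁻¹ * b * b * d⁻¹) * (b⁻¹ * d⁻¹ * b) = 1 * rel7 b d * 1 from (by unfold rel7; simp only [mul_assoc, mul_inv_rev, inv_inv, mul_one, one_mul, inv_one, inv_mul_cancel_left, mul_inv_cancel_left, inv_mul_cancel, mul_inv_cancel]), h]; simp only [mul_assoc, mul_inv_rev, inv_inv, mul_one, one_mul, inv_one, inv_mul_cancel_left, mul_inv_cancel_left, inv_mul_cancel, mul_inv_cancel]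
    have g1 : b⁻¹ * d * b * (b⁻¹ * d⁻¹ * b) = 1 := by simp only [mul_assoc, mul_inv_rev, inv_inv, mul_one, one_mul, inv_one, inv_mul_cancel_left, mul_inv_cancel_left, inv_mul_cancel, mul_inv_cancel]
    have g2 : b * d⁻¹ * (d * b⁻¹ * b⁻¹ * d * b) * (b⁻¹ * d⁻¹ * b) = 1 := by simp only [mul_assoc, mul_inv_rev, inv_inv, mul_one, one_mul, inv_one, inv_mul_cancel_left, mul_inv_cancel_left, inv_mul_cancel, mul_inv_cancel]
    have g3 : (b⁻¹ * d * b) * b⁻¹ * d⁻¹ * b = 1 := by simp only [mul_assoc, mul_inv_rev, inv_inv, mul_one, one_mul, inv_one, inv_mul_cancel_left, mul_inv_cancel_left, inv_mul_cancel, mul_inv_cancel]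
    have g4 : d * b⁻¹ * (b⁻¹ * d * b) * (b⁻¹ * d⁻¹ * b * b * d⁻¹) = 1 := by simp only [mul_assoc, mul_inv_rev, inv_inv, mul_one, one_mul, inv_one, inv_mul_cancel_left, mul_inv_cancel_left, inv_mul_cancel, mul_inv_cancel]
    have g5 : (b⁻¹ * d * b) * (d * b⁻¹ * b⁻¹ * d * b) * d⁻¹ * (b⁻¹ * d⁻¹ * b * b * d⁻¹) = 1 := by
      rw [show (b⁻¹ * d * b) * (d * b⁻¹ * b⁻¹ * d * b) * d⁻¹ * (b⁻¹ * d⁻¹ * b * b * d⁻¹) = 1 * (rel7 b d)⁻¹ * 1 from (by unfold rel7; simp only [mul_assoc, mul_inv_rev, inv_inv, mul_one, one_mul, inv_one, inv_mul_cancel_left, mul_inv_cancel_left, inv_mul_cancel, mul_inv_cancel]), h]; simp only [mul_assoc, mul_inv_rev, inv_inv, mul_one, one_mul, inv_one, inv_mul_cancel_left, mul_inv_cancel_left, inv_mul_cancel, mul_inv_cancel]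
    intro l hl
    simp only [cs7, List.mem_cons, List.not_mem_nil, or_false] at hl
    rcases hl with rfl | rfl | rfl | rfl | rfl | rfl
    · simp only [c7_0, wd, one_mul, f0, f1, f2, f3, f4, f5, f6, f7]; exact g0
    · simp only [c7_1, wd, one_mul, f0, f1, f2, f3, f4, f5, f6, f7]; exact g1
    · simp only [c7_2, wd, one_mul, f0, f1, f2, f3, f4, f5, f6, f7]; exact g2
    · simp only [c7_3, wd, one_mul, f0, f1, f2, f3, f4, f5, f6, f7]; exact g3
    · simp only [c7_4, wd, one_mul, f0, f1, f2, f3, f4, f5, f6, f7]; exact g4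
    · simp only [c7_5, wd, one_mul, f0, f1, f2, f3, f4, f5, f6, f7]; exact g5
end

end OctaGlue

namespace OctaGlue

theorem isRep_conj {G : Type} [Group G] {g : Gluing} {t : OctFace → G} (h : IsRep g t) (d : G) :
    IsRep g (fun F => d * t F * d⁻¹) := by
  obtain ⟨c, hc⟩ := h
  refine ⟨fun u v => d * c u v, fun F i j hij => ?_⟩
  simp only [hc F i j hij, mul_assoc, inv_mul_cancel_left]

theorem card_repQ (g : Gluing) (G : Type) [Group G] [Fintype G] [DecidableEq G]
    (code : G × G → ℕ) (hcode : Function.Injective code)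
    (r : G → G → G) (T : G → G → OctFace → G) (Fx Fy : OctFace)
    (hx : ∀ x y, T x y Fx = x) (hy : ∀ x y, T x y Fy = y)
    (hT : ∀ t, IsRep g t ↔ ∃ x y, r x y = 1 ∧ t = T x y) :
    Nat.card (RepQ g G) = Fintype.card {p : G × G // r p.1 p.2 = 1 ∧
      ∀ d : G, code p ≤ code (d * p.1 * d⁻¹, d * p.2 * d⁻¹)} := by
  rw [← Nat.card_eq_fintype_card]
  symm
  refine Nat.card_congr (Equiv.ofBijective
    (fun p => Quot.mk _ ⟨T p.1.1 p.1.2, (hT _).2 ⟨_, _, p.2.1, rfl⟩⟩) ⟨?_, ?_⟩)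
  · rintro ⟨⟨x, y⟩, h1, h2⟩ ⟨⟨x', y'⟩, h1', h2'⟩ h
    have h := Quot.eqvGen_exact h
    have key : ∀ a b : {t : OctFace → G // IsRep g t},
        Relation.EqvGen (fun t t' => ∃ d, ∀ F, t'.1 F = d * t.1 F * d⁻¹) a b →
        ∃ d, ∀ F, b.1 F = d * a.1 F * d⁻¹ := by
      intro a b hab
      induction hab with
      | rel a b h => exact h
      | refl a => exact ⟨1, fun F => by simp⟩
      | symm a b _ ih =>
        obtain ⟨d, hd⟩ := ih
        exact ⟨d⁻¹, fun F => by rw [hd]; simp [mul_assoc]⟩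
      | trans a b c _ _ ih1 ih2 =>
        obtain ⟨d, hd⟩ := ih1
        obtain ⟨d', hd'⟩ := ih2
        exact ⟨d' * d, fun F => by rw [hd', hd]; simp [mul_assoc]⟩
    obtain ⟨d, hd⟩ := key _ _ h
    have ex := hd Fx
    have ey := hd Fy
    simp only [hx, hy] at ex ey
    have a1 := h2 d
    have a2 := h2' d⁻¹
    simp only at a1 a2
    rw [← ex, ← ey] at a1
    rw [ex, ey] at a2
    simp only [mul_assoc, inv_inv, inv_mul_cancel_left, inv_mul_cancel, mul_one] at a2
    have a3 : code (x', y') = code (x, y) := by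
      refine le_antisymm ?_ a1
      rw [ex, ey]
      simpa only [mul_assoc] using a2
    exact Subtype.ext (hcode a3).symm
  · intro q
    induction q using Quot.ind with | _ t
    obtain ⟨t, ht⟩ := t
    obtain ⟨x, y, hr, rfl⟩ := (hT t).1 ht
    obtain ⟨d, hd⟩ := Finite.exists_min (fun d : G => code (d * x * d⁻¹, d * y * d⁻¹))
    obtain ⟨x', y', hr', he⟩ := (hT _).1 (isRep_conj ht d)
    have ex := congrFun he Fx
    have ey := congrFun he Fy
    simp only [hx, hy] at ex ey
    refine ⟨⟨(x', y'), hr', fun c => ?_⟩, ?_⟩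
    · have := hd (c * d)
      simp only [← ex, ← ey]
      simpa only [mul_assoc, mul_inv_rev] using this
    · refine Eq.symm (Quot.sound ⟨d, fun F => ?_⟩)
      exact (congrFun he F).symm

/-- The group `S3` given by its multiplication table. -/
def GpS3 : Type := Fin 6

instance : DecidableEq GpS3 := inferInstanceAs (DecidableEq (Fin 6))
instance : Fintype GpS3 := inferInstanceAs (Fintype (Fin 6))

def mulS3 (x y : Fin 6) : Fin 6 :=
  Fin.ofNat 6 ((6622109294235548718800921085576 >>> (3 * (6 * x.val + y.val))) % 8)

def invS3 (x : Fin 6) : Fin 6 :=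
  Fin.ofNat 6 ((178312 >>> (3 * x.val)) % 8)

theorem assocS3 : ∀ x y z, mulS3 (mulS3 x y) z = mulS3 x (mulS3 y z) := by
  decide +kernel

instance : Group GpS3 where
  mul := mulS3
  one := (0 : Fin 6)
  inv := invS3
  mul_assoc := assocS3
  one_mul := (by decide +kernel : ∀ x : Fin 6, mulS3 0 x = x)
  mul_one := (by decide +kernel : ∀ x : Fin 6, mulS3 x 0 = x)
  inv_mul_cancel := (by decide +kernel : ∀ x : Fin 6, mulS3 (invS3 x) x = 0)

def codeS3 (p : GpS3 × GpS3) : ℕ := 6 * Fin.val (n := 6) p.1 + Fin.val (n := 6) p.2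

theorem codeS3_inj : Function.Injective codeS3 := by
  rintro ⟨x, y⟩ ⟨x', y'⟩ h
  have hy : Fin.val (n := 6) y < 6 := Fin.isLt (n := 6) y
  have hy' : Fin.val (n := 6) y' < 6 := Fin.isLt (n := 6) y'
  simp only [codeS3] at h
  have h1 : Fin.val (n := 6) x = Fin.val (n := 6) x' := by omega
  have h2 : Fin.val (n := 6) y = Fin.val (n := 6) y' := by omega
  exact Prod.ext (Fin.ext (n := 6) h1) (Fin.ext (n := 6) h2)

/-- The group `A4` given by its multiplication table. -/
def GpA4 : Type := Fin 12

instance : DecidableEq GpA4 := inferInstanceAs (DecidableEq (Fin 12))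
instance : Fintype GpA4 := inferInstanceAs (Fintype (Fin 12))

def mulA4 (x y : Fin 12) : Fin 12 :=
  Fin.ofNat 12 ((1099246228769001890931082562126702001558018722078822917734316235188111912971129222491798936609133464225093121906702645793607206164188692679327496667199353807173393975620112 >>> (4 * (12 * x.val + y.val))) % 16)

def invA4 (x : Fin 12) : Fin 12 :=
  Fin.ofNat 12 ((201591346311456 >>> (4 * x.val)) % 16)

theorem assocA4 : ∀ x y z, mulA4 (mulA4 x y) z = mulA4 x (mulA4 y z) := by
  decide +kernel

instance : Group GpA4 where
  mul := mulA4
  one := (0 : Fin 12)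
  inv := invA4
  mul_assoc := assocA4
  one_mul := (by decide +kernel : ∀ x : Fin 12, mulA4 0 x = x)
  mul_one := (by decide +kernel : ∀ x : Fin 12, mulA4 x 0 = x)
  inv_mul_cancel := (by decide +kernel : ∀ x : Fin 12, mulA4 (invA4 x) x = 0)

def codeA4 (p : GpA4 × GpA4) : ℕ := 12 * Fin.val (n := 12) p.1 + Fin.val (n := 12) p.2

theorem codeA4_inj : Function.Injective codeA4 := by
  rintro ⟨x, y⟩ ⟨x', y'⟩ h
  have hy : Fin.val (n := 12) y < 12 := Fin.isLt (n := 12) y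
  have hy' : Fin.val (n := 12) y' < 12 := Fin.isLt (n := 12) y'
  simp only [codeA4] at h
  have h1 : Fin.val (n := 12) x = Fin.val (n := 12) x' := by omega
  have h2 : Fin.val (n := 12) y = Fin.val (n := 12) y' := by omega
  exact Prod.ext (Fin.ext (n := 12) h1) (Fin.ext (n := 12) h2)

theorem count0_S3 : Nat.card (RepQ rep0 GpS3) = 9 := by
  rw [card_repQ rep0 GpS3 codeS3 codeS3_inj rel0 T0 (fc false true false) (fc true false true)
    (fun _ _ => rfl) (fun _ _ => rfl) rep0_iff]
  decide +kernel

theorem count0_A4 : Nat.card (RepQ rep0 GpA4) = 20 := by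
  rw [card_repQ rep0 GpA4 codeA4 codeA4_inj rel0 T0 (fc false true false) (fc true false true)
    (fun _ _ => rfl) (fun _ _ => rfl) rep0_iff]
  decide +kernel

theorem count1_S3 : Nat.card (RepQ rep1 GpS3) = 10 := by
  rw [card_repQ rep1 GpS3 codeS3 codeS3_inj rel1 T1 (fc false true true) (fc true false false)
    (fun _ _ => rfl) (fun _ _ => rfl) rep1_iff]
  decide +kernel

theorem count1_A4 : Nat.card (RepQ rep1 GpA4) = 16 := by
  rw [card_repQ rep1 GpA4 codeA4 codeA4_inj rel1 T1 (fc false true true) (fc true false false)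
    (fun _ _ => rfl) (fun _ _ => rfl) rep1_iff]
  decide +kernel

theorem count2_S3 : Nat.card (RepQ rep2 GpS3) = 8 := by
  rw [card_repQ rep2 GpS3 codeS3 codeS3_inj rel2 T2 (fc false false false) (fc false false true)
    (fun _ _ => rfl) (fun _ _ => rfl) rep2_iff]
  decide +kernel

theorem count2_A4 : Nat.card (RepQ rep2 GpA4) = 14 := by
  rw [card_repQ rep2 GpA4 codeA4 codeA4_inj rel2 T2 (fc false false false) (fc false false true)
    (fun _ _ => rfl) (fun _ _ => rfl) rep2_iff]
  decide +kernel

theorem count3_S3 : Nat.card (RepQ rep3 GpS3) = 10 := by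
  rw [card_repQ rep3 GpS3 codeS3 codeS3_inj rel3 T3 (fc false false false) (fc true false true)
    (fun _ _ => rfl) (fun _ _ => rfl) rep3_iff]
  decide +kernel

theorem count3_A4 : Nat.card (RepQ rep3 GpA4) = 20 := by
  rw [card_repQ rep3 GpA4 codeA4 codeA4_inj rel3 T3 (fc false false false) (fc true false true)
    (fun _ _ => rfl) (fun _ _ => rfl) rep3_iff]
  decide +kernel

theorem count4_S3 : Nat.card (RepQ rep4 GpS3) = 11 := by
  rw [card_repQ rep4 GpS3 codeS3 codeS3_inj rel4 T4 (fc false false false) (fc true false false)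
    (fun _ _ => rfl) (fun _ _ => rfl) rep4_iff]
  decide +kernel

theorem count4_A4 : Nat.card (RepQ rep4 GpA4) = 18 := by
  rw [card_repQ rep4 GpA4 codeA4 codeA4_inj rel4 T4 (fc false false false) (fc true false false)
    (fun _ _ => rfl) (fun _ _ => rfl) rep4_iff]
  decide +kernel

theorem count5_S3 : Nat.card (RepQ rep5 GpS3) = 9 := by
  rw [card_repQ rep5 GpS3 codeS3 codeS3_inj rel5 T5 (fc false false true) (fc true false true)
    (fun _ _ => rfl) (fun _ _ => rfl) rep5_iff]
  decide +kernel

theorem count5_A4 : Nat.card (RepQ rep5 GpA4) = 18 := by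
  rw [card_repQ rep5 GpA4 codeA4 codeA4_inj rel5 T5 (fc false false true) (fc true false true)
    (fun _ _ => rfl) (fun _ _ => rfl) rep5_iff]
  decide +kernel

theorem count7_S3 : Nat.card (RepQ rep7 GpS3) = 10 := by
  rw [card_repQ rep7 GpS3 codeS3 codeS3_inj rel7 T7 (fc false false true) (fc true false true)
    (fun _ _ => rfl) (fun _ _ => rfl) rep7_iff]
  decide +kernel

theorem count7_A4 : Nat.card (RepQ rep7 GpA4) = 18 := by
  rw [card_repQ rep7 GpA4 codeA4 codeA4_inj rel7 T7 (fc false false true) (fc true false true)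
    (fun _ _ => rfl) (fun _ _ => rfl) rep7_iff]
  decide +kernel

end OctaGlue

namespace OctaGlue

/-! ### Combinatorial equivalence -/

theorem sym_apply (ρ : Equiv.Perm (Fin 3)) (ε : Fin 3 → Bool) (F : OctFace) (i : Fin 3) :
    symMapFace ρ ε F (ρ i) = Bool.xor (F i) (ε i) := by
  simp [symMapFace]

theorem sym_inv (ρ : Equiv.Perm (Fin 3)) (ε : Fin 3 → Bool) (F : OctFace) :
    symMapFace ρ⁻¹ (fun j => ε (ρ⁻¹ j)) (symMapFace ρ ε F) = F := by
  funext j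
  simp [symMapFace]

theorem sym_inv' (ρ : Equiv.Perm (Fin 3)) (ε : Fin 3 → Bool) (F : OctFace) :
    symMapFace ρ ε (symMapFace ρ⁻¹ (fun j => ε (ρ⁻¹ j)) F) = F := by
  funext j
  simp [symMapFace]

theorem equiv_refl (g : Gluing) : EquivGluing g g := by
  refine ⟨1, fun _ => false, ?_, ?_⟩
  · intro F
    have : ∀ F, symMapFace 1 (fun _ => false) F = F := fun F => by funext j; simp [symMapFace]
    rw [this, this]
  · intro F
    have : ∀ F, symMapFace 1 (fun _ => false) F = F := fun F => by funext j; simp [symMapFace]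
    rw [this]; simp

theorem equiv_data_symm {g h : Gluing} {ρ : Equiv.Perm (Fin 3)} {ε : Fin 3 → Bool}
    (h1 : ∀ F, h.face (symMapFace ρ ε F) = symMapFace ρ ε (g.face F))
    (h2 : ∀ F, h.axisMap (symMapFace ρ ε F) = ρ * g.axisMap F * ρ⁻¹) :
    (∀ F, g.face (symMapFace ρ⁻¹ (fun j => ε (ρ⁻¹ j)) F) =
      symMapFace ρ⁻¹ (fun j => ε (ρ⁻¹ j)) (h.face F)) ∧
    (∀ F, g.axisMap (symMapFace ρ⁻¹ (fun j => ε (ρ⁻¹ j)) F) = ρ⁻¹ * h.axisMap F * ρ⁻¹⁻¹) := by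
  constructor
  · intro F
    have := h1 (symMapFace ρ⁻¹ (fun j => ε (ρ⁻¹ j)) F)
    rw [sym_inv'] at this
    rw [this, sym_inv]
  · intro F
    have := h2 (symMapFace ρ⁻¹ (fun j => ε (ρ⁻¹ j)) F)
    rw [sym_inv'] at this
    rw [this]
    group

theorem equiv_symm {g h : Gluing} (e : EquivGluing g h) : EquivGluing h g := by
  obtain ⟨ρ, ε, h1, h2⟩ := e
  exact ⟨ρ⁻¹, fun j => ε (ρ⁻¹ j), (equiv_data_symm h1 h2).1, (equiv_data_symm h1 h2).2⟩

theorem equiv_trans {g h k : Gluing} (e : EquivGluing g h) (e' : EquivGluing h k) :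
    EquivGluing g k := by
  obtain ⟨ρ, ε, h1, h2⟩ := e
  obtain ⟨ρ', ε', h1', h2'⟩ := e'
  have key : ∀ F, symMapFace (ρ' * ρ) (fun i => Bool.xor (ε i) (ε' (ρ i))) F =
      symMapFace ρ' ε' (symMapFace ρ ε F) := by
    intro F
    funext j
    simp [symMapFace]
  refine ⟨ρ' * ρ, fun i => Bool.xor (ε i) (ε' (ρ i)), fun F => ?_, fun F => ?_⟩
  · rw [key, key, h1', h1]
  · rw [key, h2', h2]; group

theorem orbit_eq_iff (g h : Gluing) : orbit g = orbit h ↔ EquivGluing g h := by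
  constructor
  · intro e
    have : h ∈ orbit g := by rw [e]; exact equiv_refl h
    exact this
  · intro e
    ext k
    exact ⟨fun hk => equiv_trans (equiv_symm e) hk, fun hk => equiv_trans e hk⟩

/-! ### Homeomorphisms from combinatorial equivalences -/

theorem homeo_of_quot {Z Z' X X' : Type} [TopologicalSpace Z] [TopologicalSpace Z']
    [TopologicalSpace X] [TopologicalSpace X'] {q : Z → X} {q' : Z' → X'}
    (hq : Topology.IsQuotientMap q) (hq' : Topology.IsQuotientMap q') (Θ : Z → Z') (Ψ : Z' → Z)
    (hΘ : Continuous Θ) (hΨ : Continuous Ψ) (h1 : ∀ z, q (Ψ (Θ z)) = q z)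
    (h2 : ∀ z, q' (Θ (Ψ z)) = q' z)
    (e1 : ∀ a b, q a = q b → q' (Θ a) = q' (Θ b)) (e2 : ∀ a b, q' a = q' b → q (Ψ a) = q (Ψ b)) :
    Nonempty (X ≃ₜ X') := by
  let Q : C(Z, X) := ⟨q, hq.continuous⟩
  let Q' : C(Z', X') := ⟨q', hq'.continuous⟩
  have hQ : Topology.IsQuotientMap Q := hq
  have hQ' : Topology.IsQuotientMap Q' := hq'
  let f : C(X, X') := hQ.lift ⟨q' ∘ Θ, hq'.continuous.comp hΘ⟩ (fun a b h => e1 a b h)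
  let f' : C(X', X) := hQ'.lift ⟨q ∘ Ψ, hq.continuous.comp hΨ⟩ (fun a b h => e2 a b h)
  have hf : ∀ z, f (q z) = q' (Θ z) := fun z =>
    DFunLike.congr_fun (hQ.lift_comp ⟨q' ∘ Θ, hq'.continuous.comp hΘ⟩ (fun a b h => e1 a b h)) z
  have hf' : ∀ z, f' (q' z) = q (Ψ z) := fun z =>
    DFunLike.congr_fun (hQ'.lift_comp ⟨q ∘ Ψ, hq.continuous.comp hΨ⟩ (fun a b h => e2 a b h)) z
  refine ⟨⟨⟨f, f', ?_, ?_⟩, f.continuous, f'.continuous⟩⟩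
  · intro x
    obtain ⟨z, rfl⟩ := hq.surjective x
    rw [hf, hf', h1]
  · intro x
    obtain ⟨z, rfl⟩ := hq'.surjective x
    rw [hf', hf, h2]

def sgn' (b : Bool) : ℝ := if b then -1 else 1

theorem sgn'_sq (b : Bool) : sgn' b * sgn' b = 1 := by cases b <;> norm_num [sgn']
theorem abs_sgn' (b : Bool) : |sgn' b| = 1 := by cases b <;> norm_num [sgn']
theorem sg_xor (a b : Bool) : sg (Bool.xor a b) = sgn' b * sg a := by
  cases a <;> cases b <;> norm_num [sgn', sg]

def symE (ρ : Equiv.Perm (Fin 3)) (ε : Fin 3 → Bool) (x : Fin 3 → ℝ) : Fin 3 → ℝ :=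
  fun j => sgn' (ε (ρ⁻¹ j)) * x (ρ⁻¹ j)

theorem symE_mem (ρ : Equiv.Perm (Fin 3)) (ε : Fin 3 → Bool) {x : Fin 3 → ℝ} (hx : x ∈ SolidOcta) :
    symE ρ ε x ∈ SolidOcta := by
  rw [mem_solidOcta] at *
  simp only [symE, abs_mul, abs_sgn', one_mul]
  rwa [Equiv.sum_comp (ρ⁻¹) (fun j => |x j|)]

def symS (ρ : Equiv.Perm (Fin 3)) (ε : Fin 3 → Bool) (x : SolidOcta) : SolidOcta :=
  ⟨symE ρ ε x, symE_mem ρ ε x.2⟩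

theorem symS_continuous (ρ : Equiv.Perm (Fin 3)) (ε : Fin 3 → Bool) : Continuous (symS ρ ε) := by
  refine Continuous.subtype_mk ?_ _
  refine continuous_pi fun j => ?_
  exact continuous_const.mul ((continuous_apply _).comp continuous_subtype_val)

theorem symS_inv (ρ : Equiv.Perm (Fin 3)) (ε : Fin 3 → Bool) (x : SolidOcta) :
    symS ρ⁻¹ (fun j => ε (ρ⁻¹ j)) (symS ρ ε x) = x := by
  apply Subtype.ext
  funext j
  simp [symS, symE, ← mul_assoc, sgn'_sq]

theorem symS_inv' (ρ : Equiv.Perm (Fin 3)) (ε : Fin 3 → Bool) (x : SolidOcta) :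
    symS ρ ε (symS ρ⁻¹ (fun j => ε (ρ⁻¹ j)) x) = x := by
  apply Subtype.ext
  funext j
  simp [symS, symE, ← mul_assoc, sgn'_sq]

theorem symS_face (ρ : Equiv.Perm (Fin 3)) (ε : Fin 3 → Bool) {F : OctFace} {x : SolidOcta}
    (hx : x ∈ Fs F) : symS ρ ε x ∈ Fs (symMapFace ρ ε F) := by
  have e : ∀ j, sg (symMapFace ρ ε F j) * symE ρ ε x j = sg (F (ρ⁻¹ j)) * (x : Fin 3 → ℝ) (ρ⁻¹ j) := by
    intro j
    simp only [symMapFace, sg_xor, symE]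
    linear_combination (sg (F (ρ⁻¹ j)) * (x : Fin 3 → ℝ) (ρ⁻¹ j)) * sgn'_sq (ε (ρ⁻¹ j))
  constructor
  · intro j
    change 0 ≤ sg (symMapFace ρ ε F j) * symE ρ ε x j
    rw [e]; exact hx.1 _
  · change ∑ j, sg (symMapFace ρ ε F j) * symE ρ ε x j = 1
    simp only [e]
    rw [Equiv.sum_comp (ρ⁻¹) (fun j => sg (F j) * (x : Fin 3 → ℝ) j)]
    exact hx.2

theorem symS_pr {g h : Gluing} {ρ : Equiv.Perm (Fin 3)} {ε : Fin 3 → Bool}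
    (h1 : ∀ F, h.face (symMapFace ρ ε F) = symMapFace ρ ε (g.face F))
    (h2 : ∀ F, h.axisMap (symMapFace ρ ε F) = ρ * g.axisMap F * ρ⁻¹) (a b : SolidOcta)
    (hab : pr g a = pr g b) : pr h (symS ρ ε a) = pr h (symS ρ ε b) := by
  refine inv_of_gm g (fun x => pr h (symS ρ ε x)) (fun F x hx => ?_) hab
  rw [← pr_gm h (symMapFace ρ ε F) (symS_face ρ ε hx)]
  congr 1
  apply Subtype.ext
  funext j
  have hinv : (ρ * g.axisMap F * ρ⁻¹)⁻¹ j = ρ ((g.axisMap F)⁻¹ (ρ⁻¹ j)) := by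
    simp [mul_inv_rev]
  change symE ρ ε (gmE g F x) j = gmE h (symMapFace ρ ε F) (symE ρ ε x) j
  simp only [symE, gmE, h1, h2, hinv, sym_apply, sg_xor]
  rw [show symMapFace ρ ε (g.face F) j = Bool.xor (g.face F (ρ⁻¹ j)) (ε (ρ⁻¹ j)) from rfl, sg_xor]
  have e1 : ∀ i, ρ⁻¹ (ρ i) = i := fun i => by simp
  rw [e1]
  linear_combination (-sgn' (ε (ρ⁻¹ j)) * sg (g.face F (ρ⁻¹ j)) * sg (F ((g.axisMap F)⁻¹ (ρ⁻¹ j))) *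
    (x : Fin 3 → ℝ) ((g.axisMap F)⁻¹ (ρ⁻¹ j))) * sgn'_sq (ε ((g.axisMap F)⁻¹ (ρ⁻¹ j)))

theorem homeo_of_equiv {g h : Gluing} (e : EquivGluing g h) : Nonempty (XSpace g ≃ₜ XSpace h) := by
  obtain ⟨ρ, ε, h1, h2⟩ := e
  obtain ⟨h3, h4⟩ := equiv_data_symm h1 h2
  exact homeo_of_quot (pr_quot g) (pr_quot h) (symS ρ ε) (symS ρ⁻¹ (fun j => ε (ρ⁻¹ j)))
    (symS_continuous _ _) (symS_continuous _ _) (fun z => by rw [symS_inv])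
    (fun z => by rw [symS_inv']) (symS_pr h1 h2) (symS_pr h3 h4)

end OctaGlue

namespace OctaGlue

/-! ### Cutting the octahedron into four tetrahedra around the axis `0` -/

def dat8a : OctFace → OctFace × Equiv.Perm (Fin 3) := fun F => match F 0, F 1, F 2 with
  | false, false, false => (fc true false true, p102)
  | false, false, true => (fc true true false, p012)
  | false, true, false => (fc true true true, p102)
  | false, true, true => (fc true false false, p012)
  | true, false, false => (fc false true true, p012)
  | true, false, true => (fc false false false, p102)
  | true, true, false => (fc false false true, p012)
  | true, true, true => (fc false true false, p102)

/-- A relabelling of representative 8. -/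
def rep8a : Gluing := mkG dat8a (by decide +kernel) (by decide +kernel) (by decide +kernel) (by decide +kernel)

def dat8b : OctFace → OctFace × Equiv.Perm (Fin 3) := fun F => match F 0, F 1, F 2 with
  | false, false, false => (fc true true false, p021)
  | false, false, true => (fc true true true, p021)
  | false, true, false => (fc true false true, p012)
  | false, true, true => (fc true false false, p012)
  | true, false, false => (fc false true true, p012)
  | true, false, true => (fc false true false, p012)
  | true, true, false => (fc false false false, p021)
  | true, true, true => (fc false false true, p021)

/-- A relabelling of representative 8. -/
def rep8b : Gluing := mkG dat8b (by decide +kernel) (by decide +kernel) (by decide +kernel) (by decide +kernel)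


abbrev Tet : Type := Bool × Bool
abbrev ZZ : Type := Tet × stdSimplex ℝ (Fin 4)

def opp (a : Bool) : Fin 4 := if a then 0 else 1
def locv (a : Bool) : Fin 3 → Fin 4 := ![if a then 1 else 0, 2, 3]
def axv : Fin 4 → Fin 3 := ![0, 0, 1, 2]

def rm (a b : Bool) (p : Equiv.Perm (Fin 3)) (x : Fin 4) : Fin 4 :=
  if x = opp b then opp a else locv a (p⁻¹ (axv x))

theorem rm_inj : ∀ a b p, ∀ x y, rm a b p x = rm a b p y → x = y := by decide +kernel

def tabF (g : Gluing) (F : OctFace) : Tet × (Fin 4 → Fin 4) :=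
  ((g.face F 1, g.face F 2), rm (F 0) (g.face F 0) (g.axisMap F))

def tab (g : Gluing) (t : Tet) (v : Fin 4) : Tet × (Fin 4 → Fin 4) :=
  if v = 2 then ((!t.1, t.2), id) else if v = 3 then ((t.1, !t.2), id) else
    tabF g (fc (decide (v = 0)) t.1 t.2)

def tabRel (g : Gluing) (z z' : ZZ) : Prop :=
  ∃ v, z.2 v = 0 ∧ z'.1 = (tab g z.1 v).1 ∧ ∀ x, z'.2 x = z.2 ((tab g z.1 v).2 x)

/-- The parametrization of the octahedron by the four tetrahedra. -/
def ioE (z : ZZ) : Fin 3 → ℝ := ![z.2 1 - z.2 0, sg z.1.1 * z.2 2, sg z.1.2 * z.2 3]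

theorem zsum (z : ZZ) : z.2 0 + z.2 1 + z.2 2 + z.2 3 = 1 := by
  have := z.2.2.2
  rw [Fin.sum_univ_four] at this
  exact this

theorem znn (z : ZZ) (v : Fin 4) : 0 ≤ z.2 v := z.2.2.1 v

theorem ioE_mem (z : ZZ) : ioE z ∈ SolidOcta := by
  rw [mem_solidOcta, Fin.sum_univ_three]
  have h0 := znn z 0
  have h1 := znn z 1
  have h2 := znn z 2
  have h3 := znn z 3
  have hs := zsum z
  simp only [ioE, Matrix.cons_val, abs_mul, abs_sg, one_mul, abs_of_nonneg h2, abs_of_nonneg h3]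
  have : |z.2 1 - z.2 0| ≤ z.2 0 + z.2 1 := abs_le.2 ⟨by linarith, by linarith⟩
  linarith

def iotaQ (z : ZZ) : SolidOcta := ⟨ioE z, ioE_mem z⟩

theorem coord_cont (v : Fin 4) : Continuous (fun z : ZZ => z.2 v) :=
  (continuous_apply v).comp (continuous_subtype_val.comp continuous_snd)

theorem iotaQ_continuous : Continuous iotaQ := by
  refine Continuous.subtype_mk ?_ _
  refine continuous_pi fun j => ?_
  have c1 : Continuous (fun z : ZZ => sg z.1.1) :=
    (continuous_of_discreteTopology (f := sg)).comp (continuous_fst.comp continuous_fst)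
  have c2 : Continuous (fun z : ZZ => sg z.1.2) :=
    (continuous_of_discreteTopology (f := sg)).comp (continuous_snd.comp continuous_fst)
  fin_cases j
  · exact (coord_cont 1).sub (coord_cont 0)
  · exact c1.mul (coord_cont 2)
  · exact c2.mul (coord_cont 3)

theorem sg_abs (r : ℝ) : sg (decide (0 ≤ r)) * |r| = r := by
  by_cases h : 0 ≤ r
  · simp [sg, h, abs_of_nonneg h]
  · simp [sg, h, abs_of_neg (not_le.1 h)]

theorem iotaQ_surj : Function.Surjective iotaQ := by
  intro x
  have hx := (mem_solidOcta _).1 x.2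
  rw [Fin.sum_univ_three] at hx
  set X : Fin 3 → ℝ := x.1
  have a0 := le_abs_self (X 0)
  have a0' := neg_le_abs (X 0)
  have a1 := abs_nonneg (X 1)
  have a2 := abs_nonneg (X 2)
  refine ⟨((decide (0 ≤ X 1), decide (0 ≤ X 2)),
    ⟨![(1 - |X 1| - |X 2| - X 0) / 2, (1 - |X 1| - |X 2| + X 0) / 2, |X 1|, |X 2|], ?_, ?_⟩), ?_⟩
  · intro v
    fin_cases v
    · show 0 ≤ (1 - |X 1| - |X 2| - X 0) / 2
      linarith
    · show 0 ≤ (1 - |X 1| - |X 2| + X 0) / 2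
      linarith
    · exact a1
    · exact a2
  · rw [Fin.sum_univ_four]
    simp only [Matrix.cons_val]
    ring
  · apply Subtype.ext
    funext j
    fin_cases j
    · show (1 - |X 1| - |X 2| + X 0) / 2 - (1 - |X 1| - |X 2| - X 0) / 2 = X 0
      ring
    · exact sg_abs _
    · exact sg_abs _

theorem iotaQ_quot (g : Gluing) : Topology.IsQuotientMap (fun z => pr g (iotaQ z)) :=
  (pr_quot g).comp (iotaQ_continuous.isClosedMap.isQuotientMap iotaQ_continuous iotaQ_surj)

theorem sg_mul_eq {a b : Bool} {r s : ℝ} (hr : 0 ≤ r) (hs : 0 ≤ s) (h : sg a * r = sg b * s) :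
    r = s ∧ (a = b ∨ r = 0) := by
  cases a <;> cases b <;> simp [sg] at h ⊢ <;> first | exact h | (constructor <;> linarith)

/-- Points with the same image are related by crossing the interior walls. -/
theorem iotaQ_eq (g : Gluing) (z z' : ZZ) (h : iotaQ z = iotaQ z') : Relation.EqvGen (tabRel g) z z' := by
  have h' : ioE z = ioE z' := congrArg Subtype.val h
  have e0 : z.2 1 - z.2 0 = z'.2 1 - z'.2 0 := congrFun h' 0
  obtain ⟨e2, c1⟩ := sg_mul_eq (znn z 2) (znn z' 2) (congrFun h' 1)
  obtain ⟨e3, c2⟩ := sg_mul_eq (znn z 3) (znn z' 3) (congrFun h' 2)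
  have hs := zsum z
  have hs' := zsum z'
  have hw : z.2 = z'.2 := by
    apply Subtype.ext
    funext v
    fin_cases v
    · show z.2 0 = z'.2 0
      linarith
    · show z.2 1 = z'.2 1
      linarith
    · exact e2
    · exact e3
  obtain ⟨⟨a, b⟩, w⟩ := z
  obtain ⟨⟨a', b'⟩, w'⟩ := z'
  simp only at hw c1 c2
  subst hw
  have m1 : ∀ a a' b, (a = a' ∨ w 2 = 0) → Relation.EqvGen (tabRel g) ((a, b), w) ((a', b), w) := by
    intro a a' b hc
    by_cases hab : a = a'
    · subst hab; exact Relation.EqvGen.refl _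
    · refine Relation.EqvGen.rel _ _ ⟨2, hc.resolve_left hab, ?_, fun x => rfl⟩
      cases a <;> cases a' <;> simp_all [tab]
  have m2 : ∀ a b b', (b = b' ∨ w 3 = 0) → Relation.EqvGen (tabRel g) ((a, b), w) ((a, b'), w) := by
    intro a b b' hc
    by_cases hab : b = b'
    · subst hab; exact Relation.EqvGen.refl _
    · refine Relation.EqvGen.rel _ _ ⟨3, hc.resolve_left hab, ?_, fun x => rfl⟩
      cases b <;> cases b' <;> simp_all [tab]
  exact Relation.EqvGen.trans _ _ _ (m1 a a' b c1) (m2 a' b b' c2)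

theorem iotaQ_coord (z : ZZ) (F : OctFace) (h1 : z.1 = (F 1, F 2)) (h0 : z.2 (opp (F 0)) = 0) (i : Fin 3) :
    ioE z i = sg (F i) * z.2 (locv (F 0) i) := by
  fin_cases i
  · show z.2 1 - z.2 0 = _
    cases hF : F 0 <;> simp [hF, opp, locv, sg] at h0 ⊢ <;> linarith
  · show sg z.1.1 * z.2 2 = _
    rw [h1]; rfl
  · show sg z.1.2 * z.2 3 = _
    rw [h1]; rfl

theorem rm_loc : ∀ (a b : Bool) (p : Equiv.Perm (Fin 3)) (j : Fin 3),
    rm a b p (locv b j) = locv a (p⁻¹ j) := by decide +kernel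

theorem rm_opp (a b : Bool) (p : Equiv.Perm (Fin 3)) : rm a b p (opp b) = opp a := by
  simp [rm]

theorem iotaQ_face (z z' : ZZ) (g : Gluing) (F : OctFace) (h1 : z.1 = (F 1, F 2))
    (h0 : z.2 (opp (F 0)) = 0) (h1' : z'.1 = (tabF g F).1) (h2' : ∀ x, z'.2 x = z.2 ((tabF g F).2 x)) :
    iotaQ z ∈ Fs F ∧ iotaQ z' = gm g F (iotaQ z) := by
  constructor
  · have e : ∀ i, sg (F i) * ioE z i = z.2 (locv (F 0) i) := by
      intro i
      rw [iotaQ_coord z F h1 h0, ← mul_assoc, sg_mul_self, one_mul]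
    refine ⟨fun i => ?_, ?_⟩
    · change 0 ≤ sg (F i) * ioE z i
      rw [e]; exact znn _ _
    · change ∑ i, sg (F i) * ioE z i = 1
      simp only [e]
      have hs := zsum z
      rw [Fin.sum_univ_three]
      cases hF : F 0 <;> simp [hF, opp, locv] at h0 ⊢ <;> linarith
  · apply Subtype.ext
    funext j
    have h0' : z'.2 (opp (g.face F 0)) = 0 := by
      rw [h2']
      simp only [tabF, rm_opp]
      exact h0
    change ioE z' j = gmE g F (ioE z) j
    rw [iotaQ_coord z' (g.face F) h1' h0']
    simp only [gmE]
    rw [iotaQ_coord z F h1 h0, h2']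
    simp only [tabF, rm_loc]
    linear_combination (-sg (g.face F j) * z.2 (locv (F 0) ((g.axisMap F)⁻¹ j))) *
      sg_mul_self (F ((g.axisMap F)⁻¹ j))

theorem tab_face (g : Gluing) (F : OctFace) : tab g (F 1, F 2) (opp (F 0)) = tabF g F := by
  have : fc (decide (opp (F 0) = 0)) (F 1) (F 2) = F := by
    conv_rhs => rw [← fc_eta F]
    cases F 0 <;> rfl
  have h2 : opp (F 0) ≠ 2 ∧ opp (F 0) ≠ 3 := by cases F 0 <;> decide
  rw [tab, if_neg h2.1, if_neg h2.2]
  simp only [this]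

theorem tabRel_pr (g : Gluing) (z z' : ZZ) (h : tabRel g z z') : pr g (iotaQ z) = pr g (iotaQ z') := by
  obtain ⟨v, hv, h1, h2⟩ := h
  by_cases c2 : v = 2
  · subst c2
    congr 1
    apply Subtype.ext
    simp only [tab, if_true, id] at h1 h2
    funext j
    fin_cases j
    · show z.2 1 - z.2 0 = z'.2 1 - z'.2 0
      rw [h2, h2]
    · show sg z.1.1 * z.2 2 = sg z'.1.1 * z'.2 2
      rw [h2, hv]; simp
    · show sg z.1.2 * z.2 3 = sg z'.1.2 * z'.2 3
      rw [h2, h1]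
  by_cases c3 : v = 3
  · subst c3
    congr 1
    apply Subtype.ext
    rw [tab, if_neg (by decide), if_pos rfl] at h1 h2
    simp only [id] at h1 h2
    funext j
    fin_cases j
    · show z.2 1 - z.2 0 = z'.2 1 - z'.2 0
      rw [h2, h2]
    · show sg z.1.1 * z.2 2 = sg z'.1.1 * z'.2 2
      rw [h2, h1]
    · show sg z.1.2 * z.2 3 = sg z'.1.2 * z'.2 3
      rw [h2, hv]; simp
  rw [tab, if_neg c2, if_neg c3] at h1 h2
  have hv' : opp (fc (decide (v = 0)) z.1.1 z.1.2 0) = v := by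
    change opp (decide (v = 0)) = v
    clear hv h1 h2
    revert v; decide
  obtain ⟨a1, a2⟩ := iotaQ_face z z' g _ rfl (by rw [hv']; exact hv) h1 h2
  rw [a2, pr_gm g _ a1]

theorem sg_cancel (a b : Bool) (r : ℝ) (hr : 0 ≤ r) (h : 0 ≤ sg a * (sg b * r)) :
    sg a * r = sg b * r := by
  cases a <;> cases b <;> simp [sg] at h ⊢ <;> linarith

theorem glue_tab (g : Gluing) (z z' : ZZ) (h : glueRel g (iotaQ z) (iotaQ z')) :
    Relation.EqvGen (tabRel g) z z' := by
  obtain ⟨F, hF, he⟩ := (glueRel_iff g _ _).1 h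
  -- move to the tetrahedron of the face
  have hn : ∀ i, 0 ≤ sg (F i) * ioE z i := hF.1
  have hsum : ∑ i, sg (F i) * ioE z i = 1 := hF.2
  set z0 : ZZ := ((F 1, F 2), z.2)
  have e1 : sg (F 1) * z.2 2 = sg z.1.1 * z.2 2 := by
    have := hn 1
    change 0 ≤ sg (F 1) * (sg z.1.1 * z.2 2) at this
    have hz := znn z 2
    exact sg_cancel _ _ _ hz this
  have e2 : sg (F 2) * z.2 3 = sg z.1.2 * z.2 3 := by
    have := hn 2
    change 0 ≤ sg (F 2) * (sg z.1.2 * z.2 3) at this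
    have hz := znn z 3
    exact sg_cancel _ _ _ hz this
  have hz0 : iotaQ z = iotaQ z0 := by
    apply Subtype.ext
    funext j
    fin_cases j
    · rfl
    · exact e1.symm
    · exact e2.symm
  have h0 : z0.2 (opp (F 0)) = 0 := by
    rw [Fin.sum_univ_three] at hsum
    change sg (F 0) * (z.2 1 - z.2 0) + sg (F 1) * (sg z.1.1 * z.2 2) +
      sg (F 2) * (sg z.1.2 * z.2 3) = 1 at hsum
    rw [← e1, ← e2, ← mul_assoc, ← mul_assoc, sg_mul_self, sg_mul_self] at hsum
    have hs := zsum z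
    change z.2 (opp (F 0)) = 0
    cases hF0 : F 0 <;> simp [hF0, sg, opp] at hsum ⊢ <;> linarith
  have hbij : Function.Bijective (tabF g F).2 :=
    Finite.injective_iff_bijective.1 (fun x y => rm_inj _ _ _ x y)
  set z1 : ZZ := ((tabF g F).1, ⟨fun x => z.2 ((tabF g F).2 x), fun x => znn z _, by
    rw [hbij.sum_comp (fun x => z.2 x)]; exact z.2.2.2⟩)
  obtain ⟨a1, a2⟩ := iotaQ_face z0 z1 g F rfl h0 rfl (fun x => rfl)
  have s1 := iotaQ_eq g z z0 hz0
  have s2 : tabRel g z0 z1 := by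
    refine ⟨opp (F 0), h0, ?_, ?_⟩
    · change _ = (tab g (F 1, F 2) (opp (F 0))).1
      rw [tab_face]
    · change ∀ x, _ = z0.2 ((tab g (F 1, F 2) (opp (F 0))).2 x)
      rw [tab_face]
      intro x; rfl
  have s3 := iotaQ_eq g z1 z' (by rw [a2, he, hz0])
  exact Relation.EqvGen.trans _ _ _ s1 (Relation.EqvGen.trans _ _ _ (Relation.EqvGen.rel _ _ s2) s3)

theorem pr_io_iff (g : Gluing) (z z' : ZZ) :
    pr g (iotaQ z) = pr g (iotaQ z') ↔ Relation.EqvGen (tabRel g) z z' := by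
  constructor
  · intro h
    have h' : Relation.EqvGen (glueRel g) (iotaQ z) (iotaQ z') := Quotient.exact h
    have key : ∀ x y, Relation.EqvGen (glueRel g) x y → ∀ z z', iotaQ z = x → iotaQ z' = y →
        Relation.EqvGen (tabRel g) z z' := by
      intro x y hxy
      induction hxy with
      | rel x y h => rintro z z' rfl rfl; exact glue_tab g z z' h
      | refl x => intro z z' e e'; exact iotaQ_eq g z z' (e.trans e'.symm)
      | symm x y _ ih => intro z z' e e'; exact Relation.EqvGen.symm _ _ (ih z' z e' e)
      | trans x y w _ _ ih1 ih2 =>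
        intro z z' e e'
        obtain ⟨m, hm⟩ := iotaQ_surj y
        exact Relation.EqvGen.trans _ _ _ (ih1 z m e hm) (ih2 m z' hm e')
    exact key _ _ h' z z' rfl rfl
  · intro h
    induction h with
    | rel x y h => exact tabRel_pr g x y h
    | refl x => rfl
    | symm x y _ ih => exact ih.symm
    | trans x y w _ _ ih1 ih2 => exact ih1.trans ih2

/-- Relabelling tetrahedra. -/
def relbl (α : Tet → Tet) (γ : Tet → Equiv.Perm (Fin 4)) (z : ZZ) : ZZ :=
  (α z.1, ⟨fun x => z.2 (γ z.1 x), fun x => znn z _, by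
    rw [Equiv.sum_comp (γ z.1) (fun x => z.2 x)]; exact z.2.2.2⟩)

theorem relbl_continuous (α : Tet → Tet) (γ : Tet → Equiv.Perm (Fin 4)) : Continuous (relbl α γ) := by
  rw [continuous_prod_of_discrete_left]
  intro t
  refine Continuous.prodMk (continuous_const (y := α t)) (Continuous.subtype_mk (continuous_pi fun x => ?_) _)
  exact (continuous_apply (A := fun _ : Fin 4 => ℝ) (γ t x)).comp continuous_subtype_val

def isoTab (g g' : Gluing) (α : Tet → Tet) (γ : Tet → Equiv.Perm (Fin 4)) : Prop :=
  ∀ t v, (tab g' (α t) v).1 = α (tab g t (γ t v)).1 ∧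
    ∀ x, γ t ((tab g' (α t) v).2 x) = (tab g t (γ t v)).2 (γ (tab g t (γ t v)).1 x)

instance (g g' : Gluing) (α : Tet → Tet) (γ : Tet → Equiv.Perm (Fin 4)) :
    Decidable (isoTab g g' α γ) := by
  unfold isoTab; infer_instance

theorem relbl_pr {g g' : Gluing} {α : Tet → Tet} {γ : Tet → Equiv.Perm (Fin 4)}
    (h : isoTab g g' α γ) (a b : ZZ) (hab : pr g (iotaQ a) = pr g (iotaQ b)) :
    pr g' (iotaQ (relbl α γ a)) = pr g' (iotaQ (relbl α γ b)) := by
  rw [pr_io_iff] at *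
  induction hab with
  | rel x y hxy =>
    obtain ⟨v, hv, h1, h2⟩ := hxy
    refine Relation.EqvGen.rel _ _ ⟨(γ x.1).symm v, ?_, ?_, fun u => ?_⟩
    · change x.2 (γ x.1 ((γ x.1).symm v)) = 0
      rw [Equiv.apply_symm_apply]; exact hv
    · change α y.1 = (tab g' (α x.1) _).1
      rw [(h x.1 _).1, Equiv.apply_symm_apply, h1]
    · change y.2 (γ y.1 u) = x.2 (γ x.1 ((tab g' (α x.1) _).2 u))
      rw [(h x.1 _).2, Equiv.apply_symm_apply, h2, h1]
  | refl x => exact Relation.EqvGen.refl _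
  | symm x y _ ih => exact Relation.EqvGen.symm _ _ ih
  | trans x y w _ _ ih1 ih2 => exact Relation.EqvGen.trans _ _ _ ih1 ih2

theorem relbl_inv {α α' : Tet → Tet} {γ γ' : Tet → Equiv.Perm (Fin 4)} (h1 : ∀ t, α' (α t) = t)
    (h2 : ∀ t x, γ t (γ' (α t) x) = x) (z : ZZ) : relbl α' γ' (relbl α γ z) = z := by
  refine Prod.ext (h1 _) (Subtype.ext ?_)
  funext x
  exact congrArg (fun v => z.2 v) (h2 z.1 x)

theorem homeo_of_iso {g g' : Gluing} {α α' : Tet → Tet} {γ γ' : Tet → Equiv.Perm (Fin 4)}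
    (h : isoTab g g' α γ) (h' : isoTab g' g α' γ') (h1 : ∀ t, α' (α t) = t) (h2 : ∀ t, α (α' t) = t)
    (h3 : ∀ t x, γ t (γ' (α t) x) = x) (h4 : ∀ t x, γ' t (γ (α' t) x) = x) :
    Nonempty (XSpace g ≃ₜ XSpace g') :=
  homeo_of_quot (iotaQ_quot g) (iotaQ_quot g') (relbl α γ) (relbl α' γ') (relbl_continuous _ _)
    (relbl_continuous _ _) (fun z => by rw [relbl_inv h1 h3]) (fun z => by rw [relbl_inv h2 h4])
    (relbl_pr h) (relbl_pr h')

def mkP4 (f h : Fin 4 → Fin 4) (h1 : ∀ i, h (f i) = i) (h2 : ∀ i, f (h i) = i) :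
    Equiv.Perm (Fin 4) := ⟨f, h, h1, h2⟩

def alA : Tet → Tet
  | (false, false) => (false, false)
  | (false, true) => (true, false)
  | (true, false) => (true, true)
  | (true, true) => (false, true)

def alAi : Tet → Tet
  | (false, false) => (false, false)
  | (false, true) => (true, true)
  | (true, false) => (false, true)
  | (true, true) => (true, false)

def gaA : Tet → Equiv.Perm (Fin 4)
  | (false, false) => mkP4 ![2, 1, 3, 0] ![3, 1, 0, 2] (by decide) (by decide)
  | (false, true) => mkP4 ![2, 1, 3, 0] ![3, 1, 0, 2] (by decide) (by decide)
  | (true, false) => mkP4 ![1, 2, 3, 0] ![3, 0, 1, 2] (by decide) (by decide)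
  | (true, true) => mkP4 ![1, 2, 3, 0] ![3, 0, 1, 2] (by decide) (by decide)

def gaAi : Tet → Equiv.Perm (Fin 4)
  | (false, false) => mkP4 ![3, 1, 0, 2] ![2, 1, 3, 0] (by decide) (by decide)
  | (false, true) => mkP4 ![3, 0, 1, 2] ![1, 2, 3, 0] (by decide) (by decide)
  | (true, false) => mkP4 ![3, 1, 0, 2] ![2, 1, 3, 0] (by decide) (by decide)
  | (true, true) => mkP4 ![3, 0, 1, 2] ![1, 2, 3, 0] (by decide) (by decide)

theorem homeoA : Nonempty (XSpace rep4 ≃ₜ XSpace rep8a) :=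
  homeo_of_iso (α := alA) (α' := alAi) (γ := gaA) (γ' := gaAi) (by decide +kernel)
    (by decide +kernel) (by decide +kernel) (by decide +kernel) (by decide +kernel) (by decide +kernel)

theorem equivA : EquivGluing rep8 rep8a :=
  ⟨p102, fun _ => false, by decide +kernel, by decide +kernel⟩

def alB : Tet → Tet
  | (false, false) => (false, false)
  | (false, true) => (false, true)
  | (true, false) => (true, true)
  | (true, true) => (true, false)

def alBi : Tet → Tet
  | (false, false) => (false, false)
  | (false, true) => (false, true)
  | (true, false) => (true, true)
  | (true, true) => (true, false)

def gaB : Tet → Equiv.Perm (Fin 4)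
  | (false, false) => mkP4 ![2, 0, 1, 3] ![1, 2, 0, 3] (by decide) (by decide)
  | (false, true) => mkP4 ![2, 0, 1, 3] ![1, 2, 0, 3] (by decide) (by decide)
  | (true, false) => mkP4 ![0, 2, 1, 3] ![0, 2, 1, 3] (by decide) (by decide)
  | (true, true) => mkP4 ![0, 2, 1, 3] ![0, 2, 1, 3] (by decide) (by decide)

def gaBi : Tet → Equiv.Perm (Fin 4)
  | (false, false) => mkP4 ![1, 2, 0, 3] ![2, 0, 1, 3] (by decide) (by decide)
  | (false, true) => mkP4 ![1, 2, 0, 3] ![2, 0, 1, 3] (by decide) (by decide)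
  | (true, false) => mkP4 ![0, 2, 1, 3] ![0, 2, 1, 3] (by decide) (by decide)
  | (true, true) => mkP4 ![0, 2, 1, 3] ![0, 2, 1, 3] (by decide) (by decide)

theorem homeoB : Nonempty (XSpace rep6 ≃ₜ XSpace rep8b) :=
  homeo_of_iso (α := alB) (α' := alBi) (γ := gaB) (γ' := gaBi) (by decide +kernel)
    (by decide +kernel) (by decide +kernel) (by decide +kernel) (by decide +kernel) (by decide +kernel)

theorem equivB : EquivGluing rep8 rep8b :=
  ⟨p210, fun _ => false, by decide +kernel, by decide +kernel⟩

theorem homeo_4_8 : Nonempty (XSpace rep8 ≃ₜ XSpace rep4) := by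
  obtain ⟨e⟩ := homeoA
  obtain ⟨e'⟩ := homeo_of_equiv equivA
  exact ⟨e'.trans e.symm⟩

theorem homeo_6_8 : Nonempty (XSpace rep8 ≃ₜ XSpace rep6) := by
  obtain ⟨e⟩ := homeoB
  obtain ⟨e'⟩ := homeo_of_equiv equivB
  exact ⟨e'.trans e.symm⟩

theorem homeo_4_6 : Nonempty (XSpace rep6 ≃ₜ XSpace rep4) := by
  obtain ⟨e⟩ := homeo_4_8
  obtain ⟨e'⟩ := homeo_6_8
  exact ⟨e'.symm.trans e⟩

end OctaGlue

namespace OctaGlue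

/-! ### Numerical encoding of gluings and exhaustive search

The functions below are written with explicit recursors and the primitive operations on natural
numbers, so that the kernel evaluates them quickly. -/

/-- Code of a face. -/
def fcd (F : OctFace) : ℕ := (F 0).toNat + 2 * (F 1).toNat + 4 * (F 2).toNat

/-- Code of an edge-end. -/
def enc (e : En) : ℕ := 4 * fcd e.1 + e.2.val

/-- Code of a vertex. -/
def vcd (v : OctVertex) : ℕ := 2 * v.1.val + v.2.toNat

/-- All edge-end codes. -/
def EL : List ℕ :=
  [nat_lit 0, nat_lit 1, nat_lit 2, nat_lit 4, nat_lit 5, nat_lit 6, nat_lit 8, nat_lit 9,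
  nat_lit 10, nat_lit 12, nat_lit 13, nat_lit 14, nat_lit 16, nat_lit 17, nat_lit 18, nat_lit 20,
  nat_lit 21, nat_lit 22, nat_lit 24, nat_lit 25, nat_lit 26, nat_lit 28, nat_lit 29, nat_lit 30]

/-- All vertex codes. -/
def VL : List ℕ := [nat_lit 0, nat_lit 1, nat_lit 2, nat_lit 3, nat_lit 4, nat_lit 5]

/-- Code of the vertex of the end with code `e`. -/
def vt (e : ℕ) : ℕ :=
  Nat.mod (Nat.shiftRight (nat_lit 6674895406972002161885516048) (Nat.mul (nat_lit 3) e)) (nat_lit 8)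

/-- The permutation of end codes stored in the packed table `R`. -/
def stp (R e : ℕ) : ℕ :=
  Nat.mod (Nat.shiftRight R (Nat.mul (nat_lit 5) e)) (nat_lit 32)

/-- Walk along the cycle of `e`, looking for a smaller element. -/
def walk (R e n : ℕ) : ℕ → Bool :=
  Nat.rec (fun _ => false)
    (fun _ ih x => Bool.rec (ih (stp R x)) (Nat.beq x e) (Nat.ble x e)) n

/-- `e` is minimal in its cycle. -/
def isMin (R e : ℕ) : Bool := walk R e (nat_lit 24) (stp R e)

/-- The list of elements satisfying `p`. -/
def filt (p : ℕ → Bool) (l : List ℕ) : List ℕ :=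
  List.rec [] (fun a _ ih => Bool.rec ih (a :: ih) (p a)) l

/-- The number of elements satisfying `p`. -/
def cnt (p : ℕ → Bool) (l : List ℕ) : ℕ :=
  List.rec Nat.zero (fun a _ ih => Bool.rec ih (Nat.succ ih) (p a)) l

/-- All elements satisfy `p`. -/
def alls {α : Type} (p : α → Bool) (l : List α) : Bool :=
  List.rec true (fun a _ ih => Bool.rec false ih (p a)) l

/-- Membership. -/
def memb (x : ℕ) (l : List ℕ) : Bool :=
  List.rec false (fun a _ ih => Bool.rec ih true (Nat.beq x a)) l

/-- Removal of an element. -/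
def remv (x : ℕ) (l : List ℕ) : List ℕ := filt (fun y => Bool.rec true false (Nat.beq x y)) l

/-- Map. -/
def mapp (f : ℕ → ℕ) (l : List ℕ) : List ℕ := List.rec [] (fun x _ ih => f x :: ih) l

/-- Label of a vertex. -/
def lk (L : List ℕ) : ℕ → ℕ :=
  List.rec (fun _ => Nat.zero) (fun a _ ih n => Nat.rec a (fun m _ => ih m) n) L

/-- Merge two labels. -/
def merge (L : List ℕ) (a b : ℕ) : List ℕ :=
  Bool.rec (mapp (fun x => Bool.rec x a (Nat.beq x b)) L) L (Nat.beq a b)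

/-- Labels of vertex classes. -/
def labs (R : ℕ) (l : List ℕ) : List ℕ → List ℕ :=
  List.rec (fun L => L) (fun e _ ih L => ih (merge L (lk L (vt e)) (lk L (vt (stp R e))))) l

/-- The counting part of the test. -/
def test2 (L M : List ℕ) : Bool :=
  and (alls (fun l => (fun c m => Bool.rec (Bool.rec (Nat.beq m (Nat.add c (nat_lit 2))) true
      (Nat.beq m c)) true (Nat.beq c Nat.zero)) (cnt (Nat.beq l) L) (cnt (Nat.beq l) M)) VL)
    (Nat.beq (cnt (fun l => (fun c m => Bool.rec (Nat.beq m c) false (Nat.beq c Nat.zero))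
      (cnt (Nat.beq l) L) (cnt (Nat.beq l) M)) VL) (nat_lit 2))

/-- Test for the links being two tori and spheres. -/
def test (R : ℕ) : Bool :=
  (fun A => Bool.rec false ((fun L => test2 L (mapp (fun e => lk L (vt e)) A)) (labs R EL VL))
    (Nat.ble (nat_lit 6) (cnt (fun _ => true) A))) (filt (isMin R) EL)

/-- Possible partners of each face, with the packed contribution to the table. -/
def opts : ℕ → List (ℕ × ℕ)
  | 0 => [
    (1, 10921970348), (1, 5916078165), (1, 17520678274), (2, 11452513114929952),
    (2, 6203444603912665), (2, 18371739788534798), (3, 6290339729134957110492),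
    (3, 12401976625055852927881), (3, 19085462587261744869670), (4, 12592171337105977483739551800),
    (4, 6820759474265737803692270273), (4, 20199941519940838880165496598),
    (5, 6916301674845219614566012688549828), (5, 13636117506655063671900036380260497),
    (5, 20984688036178109512376424861798974), (6, 7252267945002501002563171320889560036936),
    (6, 14298505550658340044826252547435666622749), (6, 22004040242223497360049622075880824120242),
    (7, 14517785124243435665139752595494083340393277876),
    (7, 7863800275631860985284032655892628476046365517),
    (7, 23288946970140511379495019788605092025214187162)]
  | 1 => [
    (2, 23727488240713728), (2, 2697117081534464), (2, 14251870572773376),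
    (3, 3149781550592679739392), (3, 25237451735874155839488), (3, 14265097776511127126016),
    (4, 26088619187283697591996383232), (4, 2965495035514685389982924800),
    (4, 15670096473844823388367880192), (5, 3463221439823522724889025943961600),
    (5, 27748871638995941598762838485106688), (5, 15684640876623882384718727179403264),
    (6, 3631450884484390164773200888706210201600), (6, 29096800827731808457864336549545967091712),
    (6, 16446537991846764095438804756880129261568),
    (7, 30078130086518177962146300020234477596043116544),
    (7, 3418982998249726160386694807675401951987630080),
    (7, 18066391203959621072536623765629253886970691584)]
  | 2 => [
    (3, 17450626996574351261696), (3, 29530963165199007219712), (3, 545342996537688457216),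
    (4, 31490099749323787087118336000), (4, 17361383695511304900347691008),
    (4, 984065617193389119602950144), (5, 19187159485054480255433629293871104),
    (5, 32469602474245867895514378390208512), (5, 599598733907952526221961869656064),
    (6, 20119194944200486652272044959744502267904), (6, 34046845884034835168558123714424535515136),
    (6, 628724842006265207883533691876087431168),
    (7, 36305613183207854474420149347887106014431936512),
    (7, 20016312612256142433474653132123936352882393088),
    (7, 1134550411975245452325629667143989373893083136)]
  | 3 => [
    (4, 7809686832289764509634002944), (4, 12231940589869375955375489024),
    (4, 34905317281132797518111834112), (5, 11961551063774754106405528438571008),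
    (5, 8935669081044373973389951226609664), (5, 36718767286216276987180019022299136),
    (6, 12542595368226466211630786580300657852416), (6, 9369728142287872009678167769642503766016),
    (6, 38502418125905873185067072017177828655104),
    (7, 9003925873906739093395077450637690619318763520),
    (7, 14102433744920802809128674428717093348356128768),
    (7, 40243088507323417622847565720922800254642814976)]
  | 4 => [
    (5, 28628658956246860513626579902922752), (5, 2299524321694691039328822898982912),
    (5, 32047496060360814849814236623798272), (6, 30019285056829954548933874787227011121152),
    (6, 2411219584364472313882655900198435291136), (6, 33604212961474689689694996727313335320576),
    (7, 2441931599239103251121386459876603215443132416),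
    (7, 32471278805635495490998221368996294873761972224),
    (7, 34329209639988078023794692313935343086471217152)]
  | 5 => [
    (6, 24420615123020649327775020631643549335552), (6, 41026645816517712888945712729346730360832),
    (6, 6207506324106742012021049848383099895808),
    (7, 43581231304262772899588353321927561261799702528),
    (7, 24483430634863840530563393690570737084232892416),
    (7, 7070730024526834919903158865395692037394661376)]
  | 6 => [
    (7, 26995088031730885252652507746059892789113520128),
    (7, 41772111695784683585320081963140022624237649920),
    (7, 12261247049416043317559678552195565859163340800)]
  | _ => []

/-- Codes of the gluings equivalent to `rep0`. -/
def cod0 : List ℕ := [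
  30078164133376023560637414669570575032756754488, 30078130715254981532067453994980552484308670520,
  30078150205725083720517486520651580672676225729, 30078150205725083733896668566326681749149452054,
  14102440997192211064559600263937090350978463304, 40243095759594825878278491556142797257265149512,
  9003933126202432999025175704731561434482243144, 9003933126190368768262803645517517323176539720,
  30078163690743100987899764469349062950931938080, 30078132497749723877682388657008235836031908640,
  30078160105815196343164623708234042091281343502, 30078160105815196343164623708221873796096721369,
  7070737276794779953894264327672350606752773704, 24483437887131785564554499152847395653591004744,
  43581238556530717933579469899520445749605201480, 43581238556530717933579480871874405112633914952,
  1134588914409056011667609953706702762640693304, 1134588914421120242429982012920746873946396728,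
  1134588914396834599838579776881734457831196438, 1134588914396834586459397731206633381357970113,
  40243108626539346527040492576324959812374762046, 14102453864136731713321601284119252906088075838,
  9003926502652565803366559917528582308635873854, 9003959920773607831936520592118604857083957822,
  1134588914395670882520509425255335385542691500, 1134588914425418854259175549065820799267506860,
  1134588914422000017155061594729633137540739157, 1134588914422000017155061594729633149145339266,
  41772111695805668289026373997124219011818590782, 12261247049437028021265970586179762246744281662,
  26995088031751869956358811860380257801350419006, 26995088031751869956358782874760089140031656510,
  32471319832281312008711135552172212607763102496, 32471319832281312008711124579818253244734389024,
  32471319832281312008711113464496778257775985113, 32471319832281312008711113464508946552960607246,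
  24483460654148897360517955026424846484178475913, 7070760043811891749857720201249801437340244873,
  43581233715482357264060679606562783633169456009, 43581264908475734374278055418903610748069485449,
  32471319832281312008711110860052020769102760620, 32471319832281312008711139845672189430421523116,
  32471319832281312008711127765336020812364273026, 32471319832281312008711127765336020800759672917,
  12261247049444671976515937814688514612000725897, 41772111695813312244276341225632971377075035017,
  26995088031762932748712880962889029198671780745, 26995088031733184776974214839078543784946965385]

/-- Codes of the gluings equivalent to `rep1`. -/
def cod1 : List ℕ := [
  30078142629132733360689737468382469009734391864, 36305616814670700522466260212300377732820260920,
  14517805243450341442778798808929146205330500020, 30078150205720038472117484344183767862867937220,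
  36305620435479262706170662266073080439569937992, 14517797666842267144535887498329339754113427892,
  9003929505364539910950187192776932425335850948, 9003933126193871281469753681348142730169054792,
  30078154507133300990605314627556326262341384992, 2441935230701949286575325987195349963206834976,
  14517815143540454046158076283499003584083683764, 30078160105822421951585909724704427587305219292,
  2441938851526235413107446653084908326976779848, 14517809544858558717279183269620052663740688820,
  43581234935713657415468624134791966190085350620, 43581238556530717909899042717412374149234456136,
  1134554043462848716594182054438035582865135672, 18066429706396934150487034650062682177832769592,
  14517823626665024793436826802484378663768844724, 1134572416018950905072500071780718790295167922,
  18066411323175549968869140979476354565968761406, 14517805243475098648582717618371046492285725108,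
  9003947877966168492047588454360023517804635058, 9003929505378608266805485950544344869993714238,
  1134556619481569566877328520483602277548952236, 34329248142425391089152931861262793904515713708,
  14517823626690190229969184523093978968697629108, 1134554043454758595672060386321091921751077158,
  34329213271459947196221052647275604791894479422, 14517791331749759787551878541015751686212315572,
  26995088031750072427807677785622737068520141094, 26995088031751869948498372687876285594182095422,
  32471282437095315644469430516182026044313713440, 3419024024895542685909270585689348321466923808,
  14517826150889252200214028386499668180151069108, 32471293104160233308823323825285826531402205469,
  3419013017553970149826310623782247864145550217, 14517815143537428164175345903344957635712543156,
  43581245602768323565738084980472570324181862685, 43581234935713657401339914192616379924210523017,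
  32471288175382824938355285527419498156481579692, 20016353638901958958997228910126430220168727212,
  14517826150889252185818154027348494651457825204, 32471282437100016092895058656496080190703696017,
  20016316243735655576821077167815076694848445321, 14517794494000206611968009134178176679881501108,
  26995088031744521377968849642024254452209318033, 26995088031750072415103069663806636864243243913]

/-- Codes of the gluings equivalent to `rep2`. -/
def cod2 : List ℕ := [
  30078137338798084547201177086835991101160060488, 1134588914414356061905089317573206364951417406,
  32471319832281312008711122716688346393426795401]

/-- Codes of the gluings equivalent to `rep3`. -/
def cod3 : List ℕ := [
  3418990250529632745441571874276915457104574024, 30078137338795058665218446706702975523948099144,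
  30078144385035690203040219349917217647266646301, 30078137338798084533072461033023508914389415496,
  18066398456239527657591500832230767392087635528, 30078137338822841763423618609716765591743788616,
  30078152090570381768197534573286746092424143794, 30078137338798084516695142954705593133644674632,
  20016351114695253043054112782553153343940727358, 1134559781724372443903913928668958829626528318,
  1134588914407007491375566271732729976469878929, 1134588914414356049200487879243068366566462014,
  36305651685646965083999608998316323005490270782, 1134562954591598382498115881287769487780614718,
  1134588914400287675543756427675395952778168260, 1134588914414356072323612031012080568579920446,
  34329250666633894541507593661627394606136040329, 32471285013141819597740245792025465429796330377,
  32471319832281312008711129400174308599318737190, 32471319832281312008711122716699901146918034313,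
  2441972625884919768834287807568654735107955593, 32471303226250618511647561545996248690245770121,
  32471319832281312008711116605051450472530978012, 32471319832281312008711122716709376764585974665]

/-- Codes of the gluings equivalent to `rep4`. -/
def cod4 : List ℕ := [
  3418990250526606863458841494143899879892612680, 30078144385035690188911503296104735460496001309,
  18066398456264284873813942355111541882671363656, 30078152090570381737691500441156348124908757938,
  20016321982005269425052937393648905808615838270, 1134588914407007478670964833402591978084923537,
  36305625725824207404592635562030886128319468094, 1134588914400287685962279141114270156406671300,
  34329215847494402130536716736964513642505575305, 32471319832281312008711129400185863352809976102,
  2441956019854226271770726636876557031926930313, 32471319832281312008711116605072480843690157276]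

/-- Codes of the gluings equivalent to `rep5`. -/
def cod5 : List ℕ := [
  3418990250554389961664013397157689947688302152, 18066398456236501775608770452097751814875674184,
  30078144385035690172534185217786819679751260445, 30078152090570381754068818519474263905653498802,
  20016325154872495363647139346267716466769924670, 36305622552956981465998433609412075470165381694,
  1134588914407007501794088985171604180098381969, 1134588914400287662839154989345257954393212868,
  34329234060603201044444032490935296902955015049, 2441937806745427357863410882905773771477490569,
  32471319832281312008711129400195338970477916454, 32471319832281312008711116605063005226022216924]

/-- Codes of the gluings equivalent to `rep6`. -/
def cod6 : List ℕ := [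
  3419005002298904053949164848464256903641310130, 18066405502501890515524268564380286242007304477,
  20016321981991201049110127217189969600071092164, 36305625725816858821358511077860271741452974225,
  34329215847494402130536710625348648092768937180, 2441956019854226271770733320374073991310111014]

/-- Codes of the gluings equivalent to `rep7`. -/
def cod7 : List ℕ := [
  36305620435487761054073545852448530024426927688, 30078142629120462521777456619959410996507854788,
  2441938851519009804686163777178057121682454088, 30078154507133301014285733834918625461667898588,
  18066429706398731667430052559407036609264095806, 1134572416052206458779302467598068662107382706,
  34329248142427188617704055490533988559734444606, 1134556619481569574737757247501248407105728806,
  3419024024895542695460979850876061254918609801, 32471293104149981818419310569224929377736739101,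
  20016353638901958954153049515327976145448606601, 32471288175377273896376886110838661669727533201]

/-- Codes of the gluings equivalent to `rep8`. -/
def cod8 : List ℕ := [
  14517788755703255835972345438179666898177780148, 3418997296774463986021480946473147526582126877,
  14517788755731038917800199262875541185228728756, 18066413208019050463328725127796527906722685874,
  14517794493990765115462311789431972002173839796, 20016316243720663043181159801286489605106858129,
  14517797666857991077179637893819794862341384628, 36305616814665655268294846172992325242964690884,
  14517791331749759779691451448847948103699950004, 34329213271458149667669930652854252683720159526,
  14517809544858558693598767202828206981817330100, 2441935230709174894996612003672654685904315612]

/-- Codes of all two-tori gluings. -/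
def codAll : List ℕ := cod0 ++ cod1 ++ cod2 ++ cod3 ++ cod4 ++ cod5 ++ cod6 ++ cod7 ++ cod8

/-- Evaluate the first argument before calling the continuation. -/
def strict (n : ℕ) (k : ℕ → Bool) : Bool := Nat.rec (k Nat.zero) (fun m _ => k (Nat.succ m)) n

/-- Check at the leaves. -/
def leaf (R : ℕ) : Bool := Bool.rec true (memb R codAll) (test R)

/-- Exhaustive search. -/
def search (n : ℕ) : List ℕ → ℕ → Bool :=
  Nat.rec (fun _ R => leaf R) (fun _ ih rem R => List.rec (leaf R)
    (fun f rest _ => alls (fun x =>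
      Bool.rec true (strict (Nat.add R x.2) (ih (remv x.1 rest))) (memb x.1 rest)) (opts f)) rem) n

end OctaGlue

namespace OctaGlue

/-! ### Specification of the primitive functions -/

theorem filt_eq (p : ℕ → Bool) (l : List ℕ) : filt p l = l.filter p := by
  induction l with
  | nil => rfl
  | cons a l ih =>
    have : filt p (a :: l) = Bool.rec (filt p l) (a :: filt p l) (p a) := rfl
    rw [this, ih]
    cases h : p a <;> simp [h]

theorem cnt_eq (p : ℕ → Bool) (l : List ℕ) : cnt p l = l.countP p := by
  induction l with
  | nil => rfl
  | cons a l ih =>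
    have : cnt p (a :: l) = Bool.rec (cnt p l) (Nat.succ (cnt p l)) (p a) := rfl
    rw [this, ih]
    cases h : p a <;> simp [h]

theorem alls_eq {α : Type} (p : α → Bool) (l : List α) : alls p l = true ↔ ∀ x ∈ l, p x = true := by
  induction l with
  | nil => simp [alls]
  | cons a l ih =>
    have : alls p (a :: l) = Bool.rec false (alls p l) (p a) := rfl
    rw [this]
    cases h : p a <;> simp [h, ih]

theorem memb_eq (x : ℕ) (l : List ℕ) : memb x l = true ↔ x ∈ l := by
  induction l with
  | nil => simp [memb]
  | cons a l ih =>
    have : memb x (a :: l) = Bool.rec (memb x l) true (Nat.beq x a) := rfl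
    rw [this]
    cases h : Nat.beq x a
    · have : x ≠ a := Nat.ne_of_beq_eq_false h
      simp [this, ih]
    · have : x = a := Nat.eq_of_beq_eq_true h
      simp [this]

theorem mapp_eq (f : ℕ → ℕ) (l : List ℕ) : mapp f l = l.map f := by
  induction l with
  | nil => rfl
  | cons a l ih =>
    have : mapp f (a :: l) = f a :: mapp f l := rfl
    rw [this, ih]; rfl

theorem lk_eq (L : List ℕ) (v : ℕ) : lk L v = L.getD v 0 := by
  induction L generalizing v with
  | nil => simp [lk]
  | cons a l ih =>
    cases v with
    | zero => rfl
    | succ v =>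
      have : lk (a :: l) (v + 1) = lk l v := rfl
      rw [this, ih]; simp

theorem remv_eq (x : ℕ) (l : List ℕ) : remv x l = l.filter (fun y => y ≠ x) := by
  rw [remv, filt_eq]
  congr 1
  funext y
  cases h : Nat.beq x y
  · have := Nat.ne_of_beq_eq_false h
    simp [Ne.symm this]
  · have := Nat.eq_of_beq_eq_true h
    simp [this]

theorem beq_fun (l : ℕ) : (Nat.beq l) = fun x => decide (x = l) := by
  funext x
  cases h : Nat.beq l x
  · have := Nat.ne_of_beq_eq_false h
    simp [Ne.symm this]
  · have := Nat.eq_of_beq_eq_true h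
    simp [this]

theorem strict_eq (n : ℕ) (k : ℕ → Bool) : strict n k = k n := by
  cases n <;> rfl

theorem merge_eq (L : List ℕ) (a b : ℕ) : merge L a b = L.map (fun x => if x = b then a else x) := by
  unfold merge
  cases h : Nat.beq a b
  · simp only
    rw [mapp_eq]
    congr 1
    funext x
    cases h' : Nat.beq x b
    · simp [Nat.ne_of_beq_eq_false h']
    · simp [Nat.eq_of_beq_eq_true h']
  · have := Nat.eq_of_beq_eq_true h
    subst this
    simp only
    conv_lhs => rw [← List.map_id L]
    congr 1
    funext x
    split_ifs with h <;> simp [h]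

theorem lk_merge (L : List ℕ) (a b v : ℕ) (hv : v < L.length) :
    lk (merge L a b) v = if lk L v = b then a else lk L v := by
  rw [lk_eq, lk_eq, merge_eq]
  simp [List.getD_eq_getElem?_getD, hv]

/-! ### Encoding -/

theorem enc_inj : Function.Injective enc := by
  intro a b; revert a b; decide +kernel

theorem vcd_inj : Function.Injective vcd := by
  intro a b; revert a b; decide +kernel

theorem fcd_inj : Function.Injective fcd := by
  intro a b; revert a b; decide +kernel

theorem enc_lt (e : En) : enc e < 32 := by revert e; decide +kernel
theorem fcd_lt (F : OctFace) : fcd F < 8 := by revert F; decide +kernel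
theorem vcd_lt (v : OctVertex) : vcd v < 6 := by revert v; decide +kernel

theorem vt_enc (e : En) : vt (enc e) = vcd (e.2, e.1 e.2) := by revert e; decide +kernel

/-- Packed entry for a single face. -/
def kap (F F' : OctFace) (p : Equiv.Perm (Fin 3)) : ℕ :=
  enc (flipF F' (p (th F 0)), p 0) + 32 * enc (flipF F' (p (th F 1)), p 1) +
    1024 * enc (flipF F' (p (th F 2)), p 2)

/-- The packed table of some gluing data. -/
def Rof (s : OctFace → OctFace) (p : OctFace → Equiv.Perm (Fin 3)) : ℕ :=
  ∑ F, kap F (s F) (p F) * 2 ^ (20 * fcd F)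

theorem kap_lt (F F' : OctFace) (p : Equiv.Perm (Fin 3)) : kap F F' p < 32768 := by
  have h0 := enc_lt (flipF F' (p (th F 0)), p 0)
  have h1 := enc_lt (flipF F' (p (th F 1)), p 1)
  have h2 := enc_lt (flipF F' (p (th F 2)), p 2)
  unfold kap
  omega

theorem faces_sum (f : OctFace → ℕ) : ∑ F, f F = f (fc false false false) + f (fc true false false) +
    f (fc false true false) + f (fc true true false) + f (fc false false true) +
    f (fc true false true) + f (fc false true true) + f (fc true true true) := by
  have : (Finset.univ : Finset OctFace) = {fc false false false, fc true false false,
    fc false true false, fc true true false, fc false false true, fc true false true,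
    fc false true true, fc true true true} := by decide +kernel
  rw [this]
  rw [Finset.sum_insert (by decide +kernel), Finset.sum_insert (by decide +kernel),
    Finset.sum_insert (by decide +kernel), Finset.sum_insert (by decide +kernel),
    Finset.sum_insert (by decide +kernel), Finset.sum_insert (by decide +kernel),
    Finset.sum_insert (by decide +kernel), Finset.sum_singleton]
  ring

theorem ext8 (a0 a1 a2 a3 a4 a5 a6 a7 : ℕ) (h0 : a0 < 32768) (h1 : a1 < 32768) (h2 : a2 < 32768)
    (h3 : a3 < 32768) (h4 : a4 < 32768) (h5 : a5 < 32768) (h6 : a6 < 32768) (h7 : a7 < 32768)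
    (R : ℕ) (hR : R = a0 * 2 ^ 0 + a1 * 2 ^ 20 + a2 * 2 ^ 40 + a3 * 2 ^ 60 + a4 * 2 ^ 80 +
      a5 * 2 ^ 100 + a6 * 2 ^ 120 + a7 * 2 ^ 140) :
    R / 2 ^ 0 % 2 ^ 15 = a0 ∧ R / 2 ^ 20 % 2 ^ 15 = a1 ∧ R / 2 ^ 40 % 2 ^ 15 = a2 ∧
    R / 2 ^ 60 % 2 ^ 15 = a3 ∧ R / 2 ^ 80 % 2 ^ 15 = a4 ∧ R / 2 ^ 100 % 2 ^ 15 = a5 ∧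
    R / 2 ^ 120 % 2 ^ 15 = a6 ∧ R / 2 ^ 140 % 2 ^ 15 = a7 := by
  norm_num at hR ⊢
  refine ⟨?_, ?_, ?_, ?_, ?_, ?_, ?_, ?_⟩ <;> omega

theorem Rof_face (s : OctFace → OctFace) (p : OctFace → Equiv.Perm (Fin 3)) (F : OctFace) :
    Rof s p / 2 ^ (20 * fcd F) % 2 ^ 15 = kap F (s F) (p F) := by
  have h := ext8 _ _ _ _ _ _ _ _ (kap_lt (fc false false false) (s _) (p _))
    (kap_lt (fc true false false) (s _) (p _)) (kap_lt (fc false true false) (s _) (p _))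
    (kap_lt (fc true true false) (s _) (p _)) (kap_lt (fc false false true) (s _) (p _))
    (kap_lt (fc true false true) (s _) (p _)) (kap_lt (fc false true true) (s _) (p _))
    (kap_lt (fc true true true) (s _) (p _)) (Rof s p) (faces_sum _)
  obtain ⟨h0, h1, h2, h3, h4, h5, h6, h7⟩ := h
  rw [← fc_eta F]
  cases F 0 <;> cases F 1 <;> cases F 2
  · exact h0
  · exact h4
  · exact h2
  · exact h6
  · exact h1
  · exact h5
  · exact h3
  · exact h7

theorem stp_Rof (s : OctFace → OctFace) (p : OctFace → Equiv.Perm (Fin 3)) (F : OctFace) (i : Fin 3) :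
    stp (Rof s p) (enc (F, i)) = enc (flipF (s F) (p F (th F i)), p F i) := by
  have h := Rof_face s p F
  have h0 := enc_lt (flipF (s F) (p F (th F 0)), p F 0)
  have h1 := enc_lt (flipF (s F) (p F (th F 1)), p F 1)
  have h2 := enc_lt (flipF (s F) (p F (th F 2)), p F 2)
  have e1 : stp (Rof s p) (enc (F, i)) =
      Rof s p / 2 ^ (20 * fcd F) / 2 ^ (5 * i.val) % 32 := by
    change (Rof s p >>> (5 * (4 * fcd F + i.val))) % 32 = _
    rw [Nat.shiftRight_eq_div_pow, Nat.div_div_eq_div_mul, ← pow_add]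
    congr 3
    ring
  rw [e1]
  generalize Rof s p / 2 ^ (20 * fcd F) = Q at h
  unfold kap at h
  fin_cases i
  · simp only [Fin.zero_eta, Fin.isValue, mul_zero, pow_zero]
    omega
  · simp only [Fin.mk_one, Fin.isValue, mul_one]
    omega
  · simp only [Fin.reduceFinMk, Fin.isValue]
    omega

theorem Rof_inj {s s' : OctFace → OctFace} {p p' : OctFace → Equiv.Perm (Fin 3)}
    (h : Rof s p = Rof s' p') : s = s' ∧ p = p' := by
  have key : ∀ F i, (flipF (s F) (p F (th F i)), p F i) = (flipF (s' F) (p' F (th F i)), p' F i) := by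
    intro F i
    apply enc_inj
    rw [← stp_Rof, ← stp_Rof, h]
  have hp : p = p' := by
    funext F
    ext i : 1
    exact congrArg Prod.snd (key F i)
  refine ⟨?_, hp⟩
  subst hp
  funext F j
  have := congrFun (congrArg Prod.fst (key F 0)) j
  simp only [flipF] at this
  split_ifs at this <;> simpa using this

/-- The packed table of a gluing. -/
def Rc (g : Gluing) : ℕ := Rof g.face g.axisMap

theorem stp_Rc (g : Gluing) (e : En) : stp (Rc g) (enc e) = enc (rho g e) := stp_Rof _ _ e.1 e.2

end OctaGlue

namespace OctaGlue

/-! ### Vertex classes and labels -/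

/-- Vertex of an end. -/
def vx (e : En) : OctVertex := (e.2, e.1 e.2)

theorem vx_rho (g : Gluing) (F : OctFace) (i : Fin 3) :
    vx (rho g (F, i)) = (g.axisMap F i, g.face F (g.axisMap F i)) :=
  congrArg Prod.fst (ends_rho g F i)

theorem vtxRel_iff (g : Gluing) (v w : OctVertex) :
    vtxRel g v w ↔ ∃ e, v = vx e ∧ w = vx (rho g e) := by
  constructor
  · rintro ⟨F, i, h1, h2⟩
    exact ⟨(F, i), h1, h2.trans (vx_rho g F i).symm⟩
  · rintro ⟨⟨F, i⟩, h1, h2⟩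
    exact ⟨F, i, h1, h2.trans (vx_rho g F i)⟩

theorem mem_EL (e : En) : enc e ∈ EL := by revert e; decide +kernel

theorem EL_mem : ∀ x ∈ EL, ∃ e, enc e = x := by decide +kernel

theorem labs_cons (R e : ℕ) (es L : List ℕ) :
    labs R (e :: es) L = labs R es (merge L (lk L (vt e)) (lk L (vt (stp R e)))) := rfl

theorem merge_length (L : List ℕ) (a b : ℕ) : (merge L a b).length = L.length := by
  rw [merge_eq, List.length_map]

theorem labs_length (R : ℕ) (es L : List ℕ) : (labs R es L).length = L.length := by
  induction es generalizing L with
  | nil => rfl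
  | cons e es ih => rw [labs_cons, ih, merge_length]

theorem labs_mono (R : ℕ) (es L : List ℕ) (x y : ℕ) (hx : x < L.length) (hy : y < L.length)
    (h : lk L x = lk L y) : lk (labs R es L) x = lk (labs R es L) y := by
  induction es generalizing L with
  | nil => exact h
  | cons e es ih =>
    rw [labs_cons]
    apply ih
    · rwa [merge_length]
    · rwa [merge_length]
    · rw [lk_merge _ _ _ _ hx, lk_merge _ _ _ _ hy, h]

theorem labs_edge (g : Gluing) (es L : List ℕ) (hL : L.length = 6) (e : En) (he : enc e ∈ es) :
    lk (labs (Rc g) es L) (vcd (vx e)) = lk (labs (Rc g) es L) (vcd (vx (rho g e))) := by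
  induction es generalizing L with
  | nil => simp at he
  | cons a es ih =>
    rw [labs_cons]
    rcases List.mem_cons.1 he with h | h
    · subst h
      have h1 := vcd_lt (vx e)
      have h2 := vcd_lt (vx (rho g e))
      have e1 : vt (enc e) = vcd (vx e) := vt_enc e
      have e2 : vt (stp (Rc g) (enc e)) = vcd (vx (rho g e)) := by rw [stp_Rc]; exact vt_enc _
      apply labs_mono
      · rw [merge_length, hL]; exact h1
      · rw [merge_length, hL]; exact h2
      · rw [e1, e2, lk_merge _ _ _ _ (by rw [hL]; exact h1), lk_merge _ _ _ _ (by rw [hL]; exact h2)]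
        simp
    · exact ih _ (by rw [merge_length, hL]) h

theorem labs_sound (g : Gluing) (es L : List ℕ) (hL : L.length = 6) (hes : ∀ x ∈ es, ∃ e, enc e = x)
    (h : ∀ v, ∃ u, lk L (vcd v) = vcd u ∧ Relation.EqvGen (vtxRel g) v u) :
    ∀ v, ∃ u, lk (labs (Rc g) es L) (vcd v) = vcd u ∧ Relation.EqvGen (vtxRel g) v u := by
  induction es generalizing L with
  | nil => exact h
  | cons a es ih =>
    rw [labs_cons]
    apply ih
    · rw [merge_length, hL]
    · exact fun x hx => hes x (List.mem_cons_of_mem _ hx)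
    · intro v
      obtain ⟨e, rfl⟩ := hes a List.mem_cons_self
      have e1 : vt (enc e) = vcd (vx e) := vt_enc e
      have e2 : vt (stp (Rc g) (enc e)) = vcd (vx (rho g e)) := by rw [stp_Rc]; exact vt_enc _
      rw [e1, e2, lk_merge _ _ _ _ (by rw [hL]; exact vcd_lt v)]
      obtain ⟨u, hu, huu⟩ := h v
      obtain ⟨w, hw, hw'⟩ := h (vx e)
      obtain ⟨z, hz, hz'⟩ := h (vx (rho g e))
      split_ifs with hc
      · refine ⟨w, hw, ?_⟩
        rw [hu, hz] at hc
        have := vcd_inj hc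
        subst this
        refine huu.trans _ _ _ (hz'.symm.trans _ _ _ (Relation.EqvGen.trans _ _ _ (Relation.EqvGen.symm _ _ (Relation.EqvGen.rel _ _ ?_)) hw'))
        exact (vtxRel_iff g _ _).2 ⟨e, rfl, rfl⟩
      · exact ⟨u, hu, huu⟩

/-- The list of labels. -/
def labL (g : Gluing) : List ℕ := labs (Rc g) EL VL

/-- The label of a vertex. -/
def lab (g : Gluing) (v : OctVertex) : ℕ := lk (labL g) (vcd v)

theorem labL_length (g : Gluing) : (labL g).length = 6 := labs_length _ _ _

theorem lab_exists (g : Gluing) (v : OctVertex) :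
    ∃ u, lab g v = vcd u ∧ Relation.EqvGen (vtxRel g) v u := by
  refine labs_sound g EL VL rfl EL_mem (fun v => ⟨v, ?_, Relation.EqvGen.refl v⟩) v
  revert v
  decide +kernel

theorem lab_lt (g : Gluing) (v : OctVertex) : lab g v < 6 := by
  obtain ⟨u, h, _⟩ := lab_exists g v
  rw [h]; exact vcd_lt u

theorem lab_lt' (g : Gluing) (v : OctVertex) : lk (labL g) (vcd v) < 6 := lab_lt g v

theorem lab_iff (g : Gluing) (v w : OctVertex) :
    lab g v = lab g w ↔ Relation.EqvGen (vtxRel g) v w := by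
  constructor
  · intro h
    obtain ⟨u, h1, h2⟩ := lab_exists g v
    obtain ⟨z, h3, h4⟩ := lab_exists g w
    have : u = z := vcd_inj (by rw [← h1, h, h3])
    subst this
    exact Relation.EqvGen.trans _ _ _ h2 (Relation.EqvGen.symm _ _ h4)
  · intro h
    induction h with
    | rel x y h =>
      obtain ⟨e, rfl, rfl⟩ := (vtxRel_iff g x y).1 h
      exact labs_edge g EL VL rfl e (mem_EL e)
    | refl x => rfl
    | symm x y _ ih => exact ih.symm
    | trans x y w _ _ ih1 ih2 => exact ih1.trans ih2

theorem lab_mk (g : Gluing) (v w : OctVertex) :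
    (Quotient.mk (vtxSetoid g) v = Quotient.mk (vtxSetoid g) w) ↔ lab g v = lab g w := by
  rw [lab_iff]
  exact Quotient.eq (r := vtxSetoid g)

/-! ### Cycles of edge-ends -/

theorem period_ex (g : Gluing) (e : En) : ∃ n, 0 < n ∧ n ≤ 24 ∧ (rho g)^[n] e = e := by
  have hp : e ∈ Function.periodicPts (rho g) := (rho_inj g).mem_periodicPts e
  refine ⟨Function.minimalPeriod (rho g) e, Function.minimalPeriod_pos_of_mem_periodicPts hp, ?_,
    Function.iterate_minimalPeriod⟩
  have := Function.minimalPeriod_le_card (f := rho g) (x := e)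
  have h24 : Fintype.card En = 24 := by decide +kernel
  omega

theorem orb_symm (g : Gluing) (a b : En) (k : ℕ) (h : (rho g)^[k] a = b) :
    ∃ k', (rho g)^[k'] b = a := by
  obtain ⟨n, hn, -, hp⟩ := period_ex g a
  refine ⟨n * k - k, ?_⟩
  rw [← h, ← Function.iterate_add_apply, Nat.sub_add_cancel (Nat.le_mul_of_pos_left k hn)]
  rw [Function.iterate_mul]
  exact Function.iterate_fixed hp k

/-- Edge-end attached to a code. -/
def edE (e : En) : EdgeEnd := ⟨ends e, fun h => nx_ne e.1 e.2 h.symm⟩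

theorem edE_surj (p : EdgeEnd) : ∃ e, edE e = p := by
  obtain ⟨e, he⟩ := ends_surj p.1.1 p.1.2 p.2
  exact ⟨e, Subtype.ext he⟩

theorem edE_inj {a b : En} (h : edE a = edE b) : a = b := ends_inj (congrArg Subtype.val h)

theorem endRel_rho (g : Gluing) (e : En) : endRel g (edE e) (edE (rho g e)) :=
  ⟨e.1, e.2, nx e.1 e.2, (nx_ne _ _).symm, rfl, ends_rho g e.1 e.2⟩

theorem endRel_cases (g : Gluing) (a b : En) (h : endRel g (edE a) (edE b)) :
    rho g a = b ∨ rho g b = a := by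
  obtain ⟨F, i, j, hij, h1, h2⟩ := h
  rcases nx_or_th F i j hij with rfl | rfl
  · left
    have : a = (F, i) := ends_inj h1
    subst this
    apply ends_inj
    rw [ends_rho]; exact h2.symm
  · right
    obtain ⟨h3, h4⟩ := ends_right g F i
    have : b = (g.face F, g.axisMap F i) := ends_inj (h2.trans h3.symm)
    subst this
    apply ends_inj
    rw [h4]; exact h1.symm

theorem endS_iff (g : Gluing) (a b : En) :
    Quotient.mk (endSetoid g) (edE a) = Quotient.mk (endSetoid g) (edE b) ↔
      ∃ k, (rho g)^[k] a = b := by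
  constructor
  · intro h
    have h' : Relation.EqvGen (endRel g) (edE a) (edE b) := Quotient.exact h
    have key : ∀ x y, Relation.EqvGen (endRel g) x y → ∀ a b, edE a = x → edE b = y →
        ∃ k, (rho g)^[k] a = b := by
      intro x y hxy
      induction hxy with
      | rel x y h =>
        rintro a b rfl rfl
        rcases endRel_cases g a b h with h | h
        · exact ⟨1, h⟩
        · exact orb_symm g b a 1 h
      | refl x => intro a b h1 h2; exact ⟨0, edE_inj (h1.trans h2.symm)⟩
      | symm x y _ ih =>
        intro a b h1 h2
        obtain ⟨k, hk⟩ := ih b a h2 h1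
        exact orb_symm g _ _ k hk
      | trans x y z _ _ ih1 ih2 =>
        intro a b h1 h2
        obtain ⟨c, hc⟩ := edE_surj y
        obtain ⟨k, hk⟩ := ih1 a c h1 hc
        obtain ⟨m, hm⟩ := ih2 c b hc h2
        exact ⟨m + k, by rw [Function.iterate_add_apply, hk, hm]⟩
    exact key _ _ h' a b rfl rfl
  · rintro ⟨k, rfl⟩
    induction k with
    | zero => rfl
    | succ k ih =>
      rw [ih, Function.iterate_succ_apply']
      exact Quotient.sound (s := endSetoid g) (Relation.EqvGen.rel _ _ (endRel_rho g _))

theorem walk_succ (R e n x : ℕ) :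
    walk R e (n + 1) x = if x < e then false else if x = e then true else walk R e n (stp R x) := by
  have : walk R e (n + 1) x = Bool.rec (walk R e n (stp R x)) (Nat.beq x e) (Nat.ble x e) := rfl
  rw [this]
  cases h : Nat.ble x e
  · have : ¬ x ≤ e := fun hh => by rw [Nat.ble_eq_true_of_le hh] at h; cases h
    rw [if_neg (by omega), if_neg (by omega)]
  · have : x ≤ e := Nat.le_of_ble_eq_true h
    cases h' : Nat.beq x e
    · have := Nat.ne_of_beq_eq_false h'
      rw [if_pos (by omega)]
    · have := Nat.eq_of_beq_eq_true h'
      rw [if_neg (by omega), if_pos this]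

theorem walk_true (g : Gluing) (e : En) (n : ℕ) (x : En) (h : walk (Rc g) (enc e) n (enc x) = true) :
    ∃ m, (rho g)^[m] x = e ∧ ∀ k ≤ m, enc e ≤ enc ((rho g)^[k] x) := by
  induction n generalizing x with
  | zero => cases h
  | succ n ih =>
    rw [walk_succ] at h
    split_ifs at h with h1 h2
    · exact ⟨0, enc_inj h2, fun k hk => by
        have : k = 0 := by omega
        subst this; exact h2.ge⟩
    · rw [stp_Rc] at h
      obtain ⟨m, hm, hk⟩ := ih _ h
      refine ⟨m + 1, hm, fun k hk' => ?_⟩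
      cases k with
      | zero => exact not_lt.1 h1
      | succ k => exact hk k (by omega)

theorem walk_ok (g : Gluing) (e : En) (n : ℕ) (x : En)
    (h : ∀ k, enc e ≤ enc ((rho g)^[k] x)) (m : ℕ) (hm : m < n) (hx : (rho g)^[m] x = e) :
    walk (Rc g) (enc e) n (enc x) = true := by
  induction n generalizing x m with
  | zero => omega
  | succ n ih =>
    rw [walk_succ, if_neg (not_lt.2 (show enc e ≤ enc x from h 0))]
    split_ifs with h2
    · rfl
    · rw [stp_Rc]
      cases m with
      | zero => exact absurd (congrArg enc hx) h2
      | succ m => exact ih _ (fun k => h (k + 1)) m (by omega) hx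

theorem isMin_iff (g : Gluing) (e : En) :
    isMin (Rc g) (enc e) = true ↔ ∀ k, enc e ≤ enc ((rho g)^[k] e) := by
  unfold isMin
  rw [stp_Rc]
  constructor
  · intro h k
    obtain ⟨m, hm, hk⟩ := walk_true g e _ _ h
    have hper : Function.IsPeriodicPt (rho g) (m + 1) e := hm
    rw [← hper.iterate_mod_apply k]
    have hlt : k % (m + 1) < m + 1 := Nat.mod_lt k (Nat.succ_pos m)
    cases hq : k % (m + 1) with
    | zero => exact le_rfl
    | succ q => exact hk q (by omega)
  · intro h
    obtain ⟨n, hn, hn', hp⟩ := period_ex g e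
    refine walk_ok g e _ _ (fun k => h (k + 1)) (n - 1) (show n - 1 < 24 by omega) ?_
    rw [← Function.iterate_succ_apply, Nat.succ_eq_add_one, Nat.sub_add_cancel hn]
    exact hp

theorem lab_iterate (g : Gluing) (e : En) (k : ℕ) : lab g (vx ((rho g)^[k] e)) = lab g (vx e) := by
  induction k with
  | zero => rfl
  | succ k ih =>
    rw [Function.iterate_succ_apply', ← ih, eq_comm, lab_iff]
    exact Relation.EqvGen.rel _ _ ((vtxRel_iff g _ _).2 ⟨_, rfl, rfl⟩)

theorem min_ex (g : Gluing) (e : En) : ∃ k, isMin (Rc g) (enc ((rho g)^[k] e)) = true := by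
  classical
  have hne : ∃ n, ∃ k, enc ((rho g)^[k] e) = n := ⟨_, 0, rfl⟩
  obtain ⟨k, hk⟩ := Nat.find_spec hne
  refine ⟨k, (isMin_iff g _).2 fun m => ?_⟩
  rw [hk, ← Function.iterate_add_apply]
  exact Nat.find_min' hne ⟨_, rfl⟩

theorem min_unique (g : Gluing) (a b : En) (k : ℕ) (h : (rho g)^[k] a = b)
    (ha : isMin (Rc g) (enc a) = true) (hb : isMin (Rc g) (enc b) = true) : a = b := by
  obtain ⟨k', h'⟩ := orb_symm g a b k h
  have h1 := (isMin_iff g a).1 ha k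
  have h2 := (isMin_iff g b).1 hb k'
  rw [h] at h1
  rw [h'] at h2
  exact enc_inj (le_antisymm h1 h2)

theorem cornerCount_eq (g : Gluing) (v : OctVertex) :
    cornerCount g (Quotient.mk (vtxSetoid g) v) =
      Nat.card {e : En // isMin (Rc g) (enc e) = true ∧ lab g (vx e) = lab g v} := by
  symm
  unfold cornerCount
  refine Nat.card_congr (Equiv.ofBijective (fun e => ⟨Quotient.mk (endSetoid g) (edE e.1), edE e.1,
    rfl, (lab_mk g _ _).2 e.2.2⟩) ⟨?_, ?_⟩)
  · intro a b h
    have h' := congrArg Subtype.val h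
    obtain ⟨k, hk⟩ := (endS_iff g _ _).1 h'
    exact Subtype.ext (min_unique g _ _ k hk a.2.1 b.2.1)
  · rintro ⟨q, p, rfl, hp⟩
    obtain ⟨e, rfl⟩ := edE_surj p
    obtain ⟨k, hk⟩ := min_ex g e
    refine ⟨⟨(rho g)^[k] e, hk, ?_⟩, ?_⟩
    · rw [lab_iterate]; exact (lab_mk g _ _).1 hp
    · apply Subtype.ext
      exact ((endS_iff g _ _).2 ⟨k, rfl⟩).symm

theorem classSize_eq (g : Gluing) (v : OctVertex) :
    classSize g (Quotient.mk (vtxSetoid g) v) = Nat.card {w : OctVertex // lab g w = lab g v} :=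
  Nat.card_congr (Equiv.subtypeEquivRight fun w => lab_mk g w v)

/-! ### The counts as list counts -/

theorem card_countP {α : Type} [Fintype α] [DecidableEq α] (l : List α) (hn : l.Nodup)
    (hl : ∀ x, x ∈ l) (p : α → Bool) : Nat.card {x // p x = true} = l.countP p := by
  rw [Nat.card_eq_fintype_card, Fintype.card_subtype, List.countP_eq_length_filter,
    ← List.toFinset_card_of_nodup (hn.filter p)]
  congr 1
  ext x
  simp [hl]

def enL : List En := (List.finRange 8).flatMap fun f =>
  (List.finRange 3).map fun i => (fc (f.val.testBit 0) (f.val.testBit 1) (f.val.testBit 2), i)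

def vxL : List OctVertex :=
  [(0, false), (0, true), (1, false), (1, true), (2, false), (2, true)]

theorem enL_map : enL.map enc = EL := by decide +kernel
theorem enL_nodup : enL.Nodup := by decide +kernel
theorem enL_mem : ∀ e, e ∈ enL := by decide +kernel
theorem vxL_map : vxL.map vcd = VL := by decide +kernel
theorem vxL_nodup : vxL.Nodup := by decide +kernel
theorem vxL_mem : ∀ e, e ∈ vxL := by decide +kernel

/-- Labels of minimal ends. -/
def minL (g : Gluing) : List ℕ :=
  mapp (fun e => lk (labL g) (vt e)) (filt (isMin (Rc g)) EL)

theorem minL_count (g : Gluing) (l : ℕ) : cnt (Nat.beq l) (minL g) =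
    Nat.card {e : En // isMin (Rc g) (enc e) = true ∧ lab g (vx e) = l} := by
  have h := card_countP enL enL_nodup enL_mem
    (fun e => isMin (Rc g) (enc e) && decide (lab g (vx e) = l))
  have h2 : Nat.card {e : En // isMin (Rc g) (enc e) = true ∧ lab g (vx e) = l} =
      Nat.card {e : En // (isMin (Rc g) (enc e) && decide (lab g (vx e) = l)) = true} :=
    Nat.card_congr (Equiv.subtypeEquivRight fun e => by simp)
  rw [h2, h, cnt_eq, minL, mapp_eq, filt_eq, List.countP_map, List.countP_filter, ← enL_map,
    List.countP_map]
  congr 1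
  funext e
  have : vt (enc e) = vcd (vx e) := vt_enc e
  simp only [Function.comp, beq_fun, this, lab]
  exact Bool.and_comm _ _

theorem labL_eq (g : Gluing) : labL g = VL.map (lk (labL g)) := by
  have h := labL_length g
  generalize labL g = L at h
  match L, h with
  | [a, b, c, d, e, f], _ => rfl

theorem labL_count (g : Gluing) (l : ℕ) : cnt (Nat.beq l) (labL g) =
    Nat.card {w : OctVertex // lab g w = l} := by
  have h := card_countP vxL vxL_nodup vxL_mem (fun e => decide (lab g e = l))
  have h2 : Nat.card {e : OctVertex // lab g e = l} =
      Nat.card {e : OctVertex // (decide (lab g e = l)) = true} :=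
    Nat.card_congr (Equiv.subtypeEquivRight fun e => by simp)
  rw [h2, h, cnt_eq, labL_eq, List.countP_map, ← vxL_map, List.countP_map]
  refine congrArg (fun p => List.countP p vxL) (funext fun e => ?_)
  simp only [Function.comp, beq_fun, lab]
  exact decide_eq_decide.2 Iff.rfl

attribute [local irreducible] labL minL lab cnt

theorem linkChi_eq (g : Gluing) (v : OctVertex) : linkChi g (Quotient.mk (vtxSetoid g) v) =
    (cnt (Nat.beq (lab g v)) (minL g) : ℤ) - cnt (Nat.beq (lab g v)) (labL g) := by
  rw [linkChi, cornerCount_eq, classSize_eq, minL_count, labL_count]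

theorem labL_count_ne (g : Gluing) (l : ℕ) :
    cnt (Nat.beq l) (labL g) ≠ 0 ↔ ∃ v, lab g v = l := by
  rw [labL_count, Nat.card_ne_zero]
  constructor
  · rintro ⟨⟨v, hv⟩, -⟩
    exact ⟨v, hv⟩
  · rintro ⟨v, hv⟩
    exact ⟨⟨v, hv⟩, inferInstance⟩

theorem beq_iff (a b : ℕ) : Nat.beq a b = true ↔ a = b :=
  ⟨Nat.eq_of_beq_eq_true, fun h => by subst h; exact Nat.beq_refl a⟩

theorem test2_iff (L M : List ℕ) : test2 L M = true ↔
    (∀ l < 6, cnt (Nat.beq l) L = 0 ∨ cnt (Nat.beq l) M = cnt (Nat.beq l) L ∨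
      cnt (Nat.beq l) M = cnt (Nat.beq l) L + 2) ∧
    Nat.card {l : Fin 6 // cnt (Nat.beq l) L ≠ 0 ∧ cnt (Nat.beq l) M = cnt (Nat.beq l) L} = 2 := by
  have hb : ∀ c m : ℕ, (Bool.rec (Bool.rec (Nat.beq m (Nat.add c 2)) true
      (Nat.beq m c)) true (Nat.beq c Nat.zero) : Bool) = true ↔ c = 0 ∨ m = c ∨ m = c + 2 := by
    intro c m
    cases h1 : Nat.beq c Nat.zero
    · have h1' : c ≠ 0 := Nat.ne_of_beq_eq_false h1
      cases h2 : Nat.beq m c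
      · have h2' := Nat.ne_of_beq_eq_false h2
        simp only [h1', h2', false_or]
        exact beq_iff _ _
      · simp [Nat.eq_of_beq_eq_true h2]
    · simp only [true_iff]
      left
      exact Nat.eq_of_beq_eq_true h1
  have hc : ∀ c m : ℕ, (Bool.rec (Nat.beq m c) false (Nat.beq c Nat.zero) : Bool) = true ↔
      c ≠ 0 ∧ m = c := by
    intro c m
    cases h1 : Nat.beq c Nat.zero
    · have h1' : c ≠ 0 := Nat.ne_of_beq_eq_false h1
      simp only [h1', ne_eq, not_false_eq_true, true_and]
      exact beq_iff _ _
    · have : c = 0 := Nat.eq_of_beq_eq_true h1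
      simp [this]
  have hV : VL = (List.finRange 6).map Fin.val := by decide +kernel
  unfold test2
  rw [Bool.and_eq_true, alls_eq, beq_iff, cnt_eq _ VL]
  refine and_congr ?_ ?_
  · rw [hV]
    simp only [List.mem_map, List.mem_finRange, true_and, forall_exists_index,
      forall_apply_eq_imp_iff]
    constructor
    · intro h l hl
      exact (hb _ _).1 (h ⟨l, hl⟩)
    · intro h l
      exact (hb _ _).2 (h l l.2)
  · rw [hV, List.countP_map, ← card_countP (List.finRange 6) (List.nodup_finRange 6) List.mem_finRange]
    have : Nat.card {l : Fin 6 // cnt (Nat.beq l) L ≠ 0 ∧ cnt (Nat.beq l) M = cnt (Nat.beq l) L} =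
      Nat.card {x : Fin 6 // ((fun l => (fun c m => Bool.rec (Nat.beq m c) false (Nat.beq c Nat.zero) : ℕ → ℕ → Bool)
      (cnt (Nat.beq l) L) (cnt (Nat.beq l) M)) ∘ Fin.val) x = true} :=
      Nat.card_congr (Equiv.subtypeEquivRight fun l => (hc _ _).symm)
    rw [this]

theorem card_bij {Q V : Type} (mk : V → Q) (hs : ∀ c, ∃ v, mk v = c) (lb : V → ℕ)
    (hlt : ∀ v, lb v < 6) (hmk : ∀ v w, mk v = mk w ↔ lb v = lb w) (P : Q → Prop) (P' : ℕ → Prop)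
    (hP : ∀ v, P (mk v) ↔ P' (lb v)) (hP' : ∀ l, P' l → ∃ v, lb v = l) :
    Nat.card {c // P c} = Nat.card {l : Fin 6 // P' l} := by
  choose r hr using hs
  refine Nat.card_congr (Equiv.ofBijective
    (fun c => ⟨⟨lb (r c.1), hlt _⟩, (hP _).1 (by rw [hr]; exact c.2)⟩) ⟨?_, ?_⟩)
  · intro a b h
    have h1 : lb (r a.1) = lb (r b.1) := congrArg (fun x => x.1.1) h
    apply Subtype.ext
    rw [← hr a.1, ← hr b.1]
    exact (hmk _ _).2 h1
  · rintro ⟨⟨l, hl⟩, h1⟩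
    obtain ⟨v, rfl⟩ := hP' l h1
    refine ⟨⟨mk v, (hP v).2 h1⟩, ?_⟩
    apply Subtype.ext
    apply Fin.ext
    exact (hmk _ _).1 (hr _)

theorem links_iff_test2 (g : Gluing) : LinksTwoTori g ↔ test2 (labL g) (minL g) = true := by
  rw [test2_iff]
  refine and_congr ?_ ?_
  · constructor
    · intro h l hl
      by_cases h0 : cnt (Nat.beq l) (labL g) = 0
      · exact Or.inl h0
      · obtain ⟨v, rfl⟩ := (labL_count_ne g l).1 h0
        have := h (Quotient.mk _ v)
        rw [linkChi_eq] at this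
        omega
    · intro h c
      induction c using Quotient.ind with
      | _ v =>
        have h1 := h (lab g v) (lab_lt g v)
        have h2 := (labL_count_ne g (lab g v)).2 ⟨v, rfl⟩
        rw [linkChi_eq]
        omega
  · have : Nat.card {c : Quotient (vtxSetoid g) // linkChi g c = 0} =
        Nat.card {l : Fin 6 // cnt (Nat.beq l) (labL g) ≠ 0 ∧
          cnt (Nat.beq l) (minL g) = cnt (Nat.beq l) (labL g)} := by
      refine card_bij (Quotient.mk (vtxSetoid g)) Quotient.exists_rep (lab g) (lab_lt g) (lab_mk g)
        (fun c => linkChi g c = 0) (fun l => cnt (Nat.beq l) (labL g) ≠ 0 ∧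
          cnt (Nat.beq l) (minL g) = cnt (Nat.beq l) (labL g)) (fun v => ?_)
        (fun l h => (labL_count_ne g l).1 h.1)
      have h2 := (labL_count_ne g (lab g v)).2 ⟨v, rfl⟩
      rw [linkChi_eq]
      generalize cnt (Nat.beq (lab g v)) (labL g) = c at h2
      generalize cnt (Nat.beq (lab g v)) (minL g) = m
      omega
    rw [this]

theorem test2_len (L M : List ℕ) (hlen : L.length = 6) (hlt : ∀ x ∈ L, x < 6)
    (h : test2 L M = true) : 6 ≤ M.length := by
  obtain ⟨h1, -⟩ := (test2_iff _ _).1 h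
  have hle : ∀ l ∈ Finset.range 6, cnt (Nat.beq l) L ≤ cnt (Nat.beq l) M := by
    intro l hl
    have := h1 l (Finset.mem_range.1 hl)
    omega
  have hs := Finset.sum_le_sum hle
  have hM : ∀ M : List ℕ, ∑ l ∈ Finset.range 6, cnt (Nat.beq l) M ≤ M.length := by
    intro M
    induction M with
    | nil => simp [cnt]
    | cons a M ih =>
      have : ∀ l, cnt (Nat.beq l) (a :: M) = cnt (Nat.beq l) M + if a = l then 1 else 0 := by
        intro l
        rw [cnt_eq, cnt_eq, beq_fun, List.countP_cons]
        simp
      simp only [this, Finset.sum_add_distrib, Finset.sum_ite_eq, List.length_cons]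
      split_ifs <;> omega
  have hL : ∀ L : List ℕ, (∀ x ∈ L, x < 6) → ∑ l ∈ Finset.range 6, cnt (Nat.beq l) L = L.length := by
    intro M hx
    induction M with
    | nil => simp [cnt]
    | cons a M ih =>
      have : ∀ l, cnt (Nat.beq l) (a :: M) = cnt (Nat.beq l) M + if a = l then 1 else 0 := by
        intro l
        rw [cnt_eq, cnt_eq, beq_fun, List.countP_cons]
        simp
      simp only [this, Finset.sum_add_distrib, Finset.sum_ite_eq, List.length_cons]
      rw [if_pos (Finset.mem_range.2 (hx a List.mem_cons_self)),
        ih (fun x h => hx x (List.mem_cons_of_mem _ h))]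
  have h6 := hL L hlt
  rw [hlen] at h6
  have := hM M
  omega

theorem list_lt (L : List ℕ) (h : L.length = 6) (hv : ∀ v, lk L (vcd v) < 6) : ∀ x ∈ L, x < 6 := by
  intro x hx
  obtain ⟨n, hn, rfl⟩ := List.getElem_of_mem hx
  have h6 : ∀ n < 6, ∃ v, vcd v = n := by decide +kernel
  obtain ⟨v, hv'⟩ := h6 n (by omega)
  have := hv v
  rw [hv', lk_eq, List.getD_eq_getElem _ _ hn] at this
  exact this

theorem labL_lt (g : Gluing) : ∀ x ∈ labL g, x < 6 := list_lt _ (labL_length g) (lab_lt' g)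

theorem test_eq (R : ℕ) : test R = Bool.rec false
    (test2 (labs R EL VL) (mapp (fun e => lk (labs R EL VL) (vt e)) (filt (isMin R) EL)))
    (Nat.ble (nat_lit 6) (cnt (fun _ => true) (filt (isMin R) EL))) := rfl

theorem bool_aux (t : Bool) (n : ℕ) (h : t = true → 6 ≤ n) :
    t = true ↔ (Bool.rec false t (Nat.ble (nat_lit 6) n) : Bool) = true := by
  constructor
  · intro ht
    rw [Nat.ble_eq_true_of_le (h ht)]
    exact ht
  · intro ht
    cases hb : Nat.ble (nat_lit 6) n
    · rw [hb] at ht; cases ht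
    · rw [hb] at ht; exact ht

theorem links_iff (g : Gluing) : LinksTwoTori g ↔ test (Rc g) = true := by
  rw [links_iff_test2, test_eq]
  have hlen : cnt (fun _ => true) (filt (isMin (Rc g)) EL) = (minL g).length := by
    rw [cnt_eq, minL, mapp_eq]; simp
  have h2 := fun M => test2_len _ M (labL_length g) (labL_lt g)
  rw [hlen]
  have := bool_aux _ _ (h2 (minL g))
  rw [minL, labL] at this ⊢
  exact this

end OctaGlue

namespace OctaGlue

/-! ### Soundness of the search -/

/-- Face with a given code. -/
def fdec (c : ℕ) : OctFace := fc (c.testBit 0) (c.testBit 1) (c.testBit 2)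

theorem fdec_fcd (F : OctFace) : fdec (fcd F) = F := by revert F; decide +kernel

theorem fcd_fdec : ∀ c < 8, fcd (fdec c) = c := by decide +kernel

theorem opts_mem : ∀ (F F' : OctFace) (p : Equiv.Perm (Fin 3)),
    (Equiv.Perm.sign p = 1 ↔ faceSign F ≠ faceSign F') → fcd F < fcd F' →
    (fcd F', kap F F' p * 2 ^ (20 * fcd F) + kap F' F p⁻¹ * 2 ^ (20 * fcd F')) ∈ opts (fcd F) := by
  decide +kernel

/-- Contribution of a face code to the packed table. -/
def wc (g : Gluing) (c : ℕ) : ℕ :=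
  kap (fdec c) (g.face (fdec c)) (g.axisMap (fdec c)) * 2 ^ (20 * c)

/-- The involution on face codes. -/
def sc (g : Gluing) (c : ℕ) : ℕ := fcd (g.face (fdec c))

theorem sc_sc (g : Gluing) (c : ℕ) (hc : c < 8) : sc g (sc g c) = c := by
  unfold sc
  rw [fdec_fcd, face_face, fcd_fdec c hc]

theorem sc_ne (g : Gluing) (c : ℕ) (hc : c < 8) : sc g c ≠ c := by
  intro h
  have h2 : fcd (g.face (fdec c)) = fcd (fdec c) := by rw [fcd_fdec c hc]; exact h
  exact face_ne g _ (fcd_inj h2)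

theorem opts_sc (g : Gluing) (c : ℕ) (hc : c < 8) (h : c < sc g c) :
    (sc g c, wc g c + wc g (sc g c)) ∈ opts c := by
  have h0 := fcd_fdec c hc
  have h1 := opts_mem (fdec c) (g.face (fdec c)) (g.axisMap (fdec c)) (axis_sign g _)
    (by rw [h0]; exact h)
  have e : wc g (sc g c) = kap (g.face (fdec c)) (fdec c) (g.axisMap (fdec c))⁻¹ *
      2 ^ (20 * fcd (g.face (fdec c))) := by
    unfold wc sc
    rw [fdec_fcd, face_face, axis_face]
  rw [e]
  rw [h0] at h1
  exact h1

theorem search_succ (n f : ℕ) (rest : List ℕ) (R : ℕ) : search (n + 1) (f :: rest) R =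
    alls (fun x : ℕ × ℕ => Bool.rec true (strict (Nat.add R x.2) (search n (remv x.1 rest)))
      (memb x.1 rest)) (opts f) := rfl

theorem search_sound (g : Gluing) (n : ℕ) (rem : List ℕ) (R : ℕ) (hs : rem.Pairwise (· < ·))
    (h8 : ∀ c ∈ rem, c < 8) (hc : ∀ c ∈ rem, sc g c ∈ rem) (hlen : rem.length ≤ 2 * n)
    (hR : R + (rem.map (wc g)).sum = Rc g) (h : search n rem R = true) : leaf (Rc g) = true := by
  induction n generalizing rem R with
  | zero =>
    have : rem = [] := List.length_eq_zero_iff.1 (by omega)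
    subst this
    simp only [List.map_nil, List.sum_nil, add_zero] at hR
    rw [← hR]; exact h
  | succ n ih =>
    cases rem with
    | nil =>
      simp only [List.map_nil, List.sum_nil, add_zero] at hR
      rw [← hR]; exact h
    | cons f rest =>
      rw [search_succ, alls_eq] at h
      have hf8 := h8 f List.mem_cons_self
      have hne := sc_ne g f hf8
      have hmem : sc g f ∈ rest := by
        rcases List.mem_cons.1 (hc f List.mem_cons_self) with h | h
        · exact absurd h hne
        · exact h
      obtain ⟨hs1, hs2⟩ := List.pairwise_cons.1 hs
      have hnd : rest.Nodup := hs2.imp (fun h => ne_of_lt h)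
      have h1 := h _ (opts_sc g f hf8 (hs1 _ hmem))
      simp only [(memb_eq _ _).2 hmem, strict_eq, remv_eq] at h1
      have her : rest.filter (fun y => y ≠ sc g f) = rest.erase (sc g f) := by
        rw [hnd.erase_eq_filter]
        congr 1
        funext y
        by_cases hy : y = sc g f <;> simp [hy]
      rw [her] at h1
      refine ih (rest.erase (sc g f)) _ ?_ ?_ ?_ ?_ ?_ h1
      · exact hs2.sublist List.erase_sublist
      · exact fun c hc' => h8 c (List.mem_cons_of_mem _ (List.mem_of_mem_erase hc'))
      · intro c hc'
        obtain ⟨c1, c2⟩ := (hnd.mem_erase_iff).1 hc'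
        have hc8 := h8 c (List.mem_cons_of_mem _ c2)
        rw [hnd.mem_erase_iff]
        constructor
        · intro he
          have := congrArg (sc g) he
          rw [sc_sc g c hc8, sc_sc g f hf8] at this
          exact absurd (hs1 c c2) (by omega)
        · rcases List.mem_cons.1 (hc c (List.mem_cons_of_mem _ c2)) with h | h
          · exfalso
            apply c1
            rw [← h, sc_sc g c hc8]
          · exact h
      · rw [List.length_erase_of_mem hmem]
        simp only [List.length_cons] at hlen
        omega
      · have h2 := List.sum_map_erase (wc g) hmem
        simp only [List.map_cons, List.sum_cons] at hR
        change R + (wc g f + wc g (sc g f)) + _ = _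
        omega

theorem search_true : search 4 [0, 1, 2, 3, 4, 5, 6, 7] 0 = true := by
  decide +kernel

theorem sum_codes (f : ℕ → ℕ) (G : OctFace → ℕ) (e : ∀ F, G F = f (fcd F)) :
    0 + (([0, 1, 2, 3, 4, 5, 6, 7] : List ℕ).map f).sum = ∑ F, G F := by
  have c0 : fcd (fc false false false) = 0 := rfl
  have c1 : fcd (fc true false false) = 1 := rfl
  have c2 : fcd (fc false true false) = 2 := rfl
  have c3 : fcd (fc true true false) = 3 := rfl
  have c4 : fcd (fc false false true) = 4 := rfl
  have c5 : fcd (fc true false true) = 5 := rfl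
  have c6 : fcd (fc false true true) = 6 := rfl
  have c7 : fcd (fc true true true) = 7 := rfl
  rw [faces_sum, e, e, e, e, e, e, e, e, c0, c1, c2, c3, c4, c5, c6, c7]
  simp only [List.map_cons, List.map_nil, List.sum_cons, List.sum_nil]
  omega

theorem wc_fcd (g : Gluing) (F : OctFace) :
    kap F (g.face F) (g.axisMap F) * 2 ^ (20 * fcd F) = wc g (fcd F) := by
  rw [wc, fdec_fcd]

theorem Rc_sum (g : Gluing) :
    0 + (([0, 1, 2, 3, 4, 5, 6, 7] : List ℕ).map (wc g)).sum = Rc g :=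
  sum_codes (wc g) (fun F => kap F (g.face F) (g.axisMap F) * 2 ^ (20 * fcd F)) (wc_fcd g)

theorem sc_mem (g : Gluing) (c : ℕ) : sc g c ∈ ([0, 1, 2, 3, 4, 5, 6, 7] : List ℕ) := by
  have : ∀ n < 8, n ∈ ([0, 1, 2, 3, 4, 5, 6, 7] : List ℕ) := by decide
  exact this _ (fcd_lt _)

theorem leaf_true (g : Gluing) : leaf (Rc g) = true :=
  search_sound g 4 [0, 1, 2, 3, 4, 5, 6, 7] 0 (by decide) (by decide) (fun c _ => sc_mem g c)
    (by decide) (Rc_sum g) search_true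

theorem mem_codAll (g : Gluing) (h : LinksTwoTori g) : Rc g ∈ codAll := by
  have h1 := leaf_true g
  rw [leaf, (links_iff g).1 h] at h1
  exact (memb_eq _ _).1 h1

/-! ### Codes of orbits -/

/-- Explicit form of the packed table. -/
def Rexp (s : OctFace → OctFace) (p : OctFace → Equiv.Perm (Fin 3)) : ℕ :=
  (fun f : OctFace → ℕ => f (fc false false false) + f (fc true false false) +
    f (fc false true false) + f (fc true true false) + f (fc false false true) +
    f (fc true false true) + f (fc false true true) + f (fc true true true))
  (fun F => kap F (s F) (p F) * 2 ^ (20 * fcd F))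

theorem Rof_eq (s : OctFace → OctFace) (p : OctFace → Equiv.Perm (Fin 3)) : Rof s p = Rexp s p :=
  faces_sum _

/-- Code of a transformed gluing. -/
def codT (g : Gluing) (r : Equiv.Perm (Fin 3)) (ε : Fin 3 → Bool) : ℕ :=
  Rexp (fun F => symMapFace r ε (g.face (symMapFace r⁻¹ (fun j => ε (r⁻¹ j)) F)))
    (fun F => r * g.axisMap (symMapFace r⁻¹ (fun j => ε (r⁻¹ j)) F) * r⁻¹)

theorem equiv_iff_cod (g h : Gluing) : EquivGluing g h ↔ ∃ r ε, codT g r ε = Rc h := by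
  constructor
  · rintro ⟨r, ε, h1, h2⟩
    refine ⟨r, ε, ?_⟩
    rw [codT, ← Rof_eq, Rc]
    congr 1
    · funext F
      rw [← h1, sym_inv']
    · funext F
      rw [← h2, sym_inv']
  · rintro ⟨r, ε, he⟩
    rw [codT, ← Rof_eq, Rc] at he
    obtain ⟨e1, e2⟩ := Rof_inj he
    refine ⟨r, ε, fun F => ?_, fun F => ?_⟩
    · rw [← congrFun e1, sym_inv]
    · rw [← congrFun e2, sym_inv]

/-- All symmetries. -/
def syms : List (Equiv.Perm (Fin 3) × (Fin 3 → Bool)) :=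
  [p012, p021, p102, p120, p201, p210].flatMap fun r =>
    [fc false false false, fc false false true, fc false true false, fc false true true,
      fc true false false, fc true false true, fc true true false, fc true true true].map fun e =>
        (r, e)

theorem mem_syms : ∀ (r : Equiv.Perm (Fin 3)) (ε : OctFace), (r, ε) ∈ syms := by decide +kernel

/-- The representatives. -/
def rs : Fin 9 → Gluing := ![rep0, rep1, rep2, rep3, rep4, rep5, rep6, rep7, rep8]

/-- Codes of the orbits. -/
def cods : Fin 9 → List ℕ := ![cod0, cod1, cod2, cod3, cod4, cod5, cod6, cod7, cod8]

theorem cod0_eq : (syms.map fun x => codT rep0 x.1 x.2).dedup = cod0 := by decide +kernel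
theorem cod1_eq : (syms.map fun x => codT rep1 x.1 x.2).dedup = cod1 := by decide +kernel
theorem cod2_eq : (syms.map fun x => codT rep2 x.1 x.2).dedup = cod2 := by decide +kernel
theorem cod3_eq : (syms.map fun x => codT rep3 x.1 x.2).dedup = cod3 := by decide +kernel
theorem cod4_eq : (syms.map fun x => codT rep4 x.1 x.2).dedup = cod4 := by decide +kernel
theorem cod5_eq : (syms.map fun x => codT rep5 x.1 x.2).dedup = cod5 := by decide +kernel
theorem cod6_eq : (syms.map fun x => codT rep6 x.1 x.2).dedup = cod6 := by decide +kernel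
theorem cod7_eq : (syms.map fun x => codT rep7 x.1 x.2).dedup = cod7 := by decide +kernel
theorem cod8_eq : (syms.map fun x => codT rep8 x.1 x.2).dedup = cod8 := by decide +kernel

theorem cods_eq (i : Fin 9) : (syms.map fun x => codT (rs i) x.1 x.2).dedup = cods i := by
  fin_cases i
  · exact cod0_eq
  · exact cod1_eq
  · exact cod2_eq
  · exact cod3_eq
  · exact cod4_eq
  · exact cod5_eq
  · exact cod6_eq
  · exact cod7_eq
  · exact cod8_eq

theorem equiv_iff_mem (i : Fin 9) (h : Gluing) : EquivGluing (rs i) h ↔ Rc h ∈ cods i := by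
  rw [equiv_iff_cod, ← cods_eq, List.mem_dedup, List.mem_map]
  constructor
  · rintro ⟨r, ε, e⟩
    exact ⟨(r, ε), mem_syms r ε, e⟩
  · rintro ⟨⟨r, ε⟩, -, e⟩
    exact ⟨r, ε, e⟩

/-- Codes of the representatives. -/
def rcs : Fin 9 → ℕ := ![
  30078164133376023560637414669570575032756754488, 30078142629132733360689737468382469009734391864,
  30078137338798084547201177086835991101160060488, 30078137338795058665218446706702975523948099144,
  3418990250526606863458841494143899879892612680, 3418990250554389961664013397157689947688302152,
  18066405502501890515524268564380286242007304477, 36305620435487761054073545852448530024426927688,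
  3418997296774463986021480946473147526582126877]

theorem rcs_eq (i : Fin 9) : Rc (rs i) = rcs i := by
  rw [Rc, Rof_eq]
  revert i
  decide +kernel

theorem rcs_test : ∀ i, test (rcs i) = true := by decide +kernel

theorem rcs_sep : ∀ i j, rcs j ∈ cods i → i = j := by decide +kernel

theorem links_rs (i : Fin 9) : LinksTwoTori (rs i) := by
  rw [links_iff, rcs_eq]; exact rcs_test i

theorem rs_inequiv (i j : Fin 9) (h : EquivGluing (rs i) (rs j)) : i = j := by
  rw [equiv_iff_mem, rcs_eq] at h
  exact rcs_sep i j h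

theorem cods_all : ∀ x ∈ codAll, ∃ i, x ∈ cods i := by decide +kernel

theorem rs_complete (g : Gluing) (h : LinksTwoTori g) : ∃ i, EquivGluing (rs i) g := by
  obtain ⟨i, hi⟩ := cods_all _ (mem_codAll g h)
  exact ⟨i, (equiv_iff_mem i g).2 hi⟩

theorem count_orbits :
    Nat.card {s : Set Gluing // ∃ g : Gluing, LinksTwoTori g ∧ s = orbit g} = 9 := by
  have : Nat.card (Fin 9) = 9 := Nat.card_fin 9
  rw [← this]
  symm
  refine Nat.card_congr (Equiv.ofBijective (fun i => ⟨orbit (rs i), rs i, links_rs i, rfl⟩) ⟨?_, ?_⟩)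
  · intro i j h
    exact rs_inequiv i j ((orbit_eq_iff _ _).1 (congrArg Subtype.val h))
  · rintro ⟨s, g, hg, rfl⟩
    obtain ⟨i, hi⟩ := rs_complete g hg
    exact ⟨i, Subtype.ext ((orbit_eq_iff _ _).2 hi)⟩

/-- Representatives of homeomorphism classes. -/
def hs : Fin 7 → Gluing := ![rep0, rep1, rep2, rep3, rep4, rep5, rep7]

theorem hs_links (i : Fin 7) : LinksTwoTori (hs i) := by
  fin_cases i
  · exact links_rs 0
  · exact links_rs 1
  · exact links_rs 2
  · exact links_rs 3
  · exact links_rs 4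
  · exact links_rs 5
  · exact links_rs 7

theorem hs_S3 (i : Fin 7) : Nat.card (RepQ (hs i) GpS3) = ![9, 10, 8, 10, 11, 9, 10] i := by
  fin_cases i
  · exact count0_S3
  · exact count1_S3
  · exact count2_S3
  · exact count3_S3
  · exact count4_S3
  · exact count5_S3
  · exact count7_S3

theorem hs_A4 (i : Fin 7) : Nat.card (RepQ (hs i) GpA4) = ![20, 16, 14, 20, 18, 18, 18] i := by
  fin_cases i
  · exact count0_A4
  · exact count1_A4
  · exact count2_A4
  · exact count3_A4
  · exact count4_A4
  · exact count5_A4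
  · exact count7_A4

theorem hs_sep (i j : Fin 7) (h : Nonempty (XSpace (hs i) ≃ₜ XSpace (hs j))) : i = j := by
  obtain ⟨e⟩ := h
  have h1 := homeo_card e GpS3
  have h2 := homeo_card e GpA4
  rw [hs_S3, hs_S3] at h1
  rw [hs_A4, hs_A4] at h2
  revert i j
  have : ∀ i j : Fin 7, (![9, 10, 8, 10, 11, 9, 10] : Fin 7 → ℕ) i = ![9, 10, 8, 10, 11, 9, 10] j →
      (![20, 16, 14, 20, 18, 18, 18] : Fin 7 → ℕ) i = ![20, 16, 14, 20, 18, 18, 18] j → i = j := by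
    decide +kernel
  intro i j _ h1 h2
  exact this i j h1 h2

theorem rs_hs (i : Fin 9) : ∃ j, Nonempty (XSpace (rs i) ≃ₜ XSpace (hs j)) := by
  fin_cases i
  · exact ⟨0, ⟨Homeomorph.refl _⟩⟩
  · exact ⟨1, ⟨Homeomorph.refl _⟩⟩
  · exact ⟨2, ⟨Homeomorph.refl _⟩⟩
  · exact ⟨3, ⟨Homeomorph.refl _⟩⟩
  · exact ⟨4, ⟨Homeomorph.refl _⟩⟩
  · exact ⟨5, ⟨Homeomorph.refl _⟩⟩
  · exact ⟨4, homeo_4_6⟩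
  · exact ⟨6, ⟨Homeomorph.refl _⟩⟩
  · exact ⟨4, homeo_4_8⟩

end OctaGlue

/-- there are exactly `9` combinatorially inequivalent orientation-reversing
gluing patterns of the octahedron whose non-sphere vertex-link data consists of two tori,
and their quotient spaces fall into exactly `7` homeomorphism classes. -/
theorem count_two_tori_octahedral_manifolds :
    Nat.card {s : Set Gluing // ∃ g : Gluing, LinksTwoTori g ∧ s = orbit g} = 9 ∧
    ∃ t : Finset Gluing, (∀ g ∈ t, LinksTwoTori g) ∧ t.card = 7 ∧
      (∀ g : Gluing, LinksTwoTori g → ∃ h ∈ t, Nonempty (XSpace g ≃ₜ XSpace h)) ∧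
      (∀ h ∈ t, ∀ h' ∈ t, Nonempty (XSpace h ≃ₜ XSpace h') → h = h') := by
  classical
  refine ⟨OctaGlue.count_orbits, Finset.univ.image OctaGlue.hs, ?_, ?_, ?_, ?_⟩
  · intro g hg
    obtain ⟨i, -, rfl⟩ := Finset.mem_image.1 hg
    exact OctaGlue.hs_links i
  · rw [Finset.card_image_of_injective]
    · simp
    · intro i j h
      exact OctaGlue.hs_sep i j (by rw [h]; exact ⟨Homeomorph.refl _⟩)
  · intro g hg
    obtain ⟨i, hi⟩ := OctaGlue.rs_complete g hg
    obtain ⟨e⟩ := OctaGlue.homeo_of_equiv hi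
    obtain ⟨j, ⟨e'⟩⟩ := OctaGlue.rs_hs i
    exact ⟨OctaGlue.hs j, Finset.mem_image_of_mem _ (Finset.mem_univ j), ⟨e.symm.trans e'⟩⟩
  · intro h hh h' hh' he
    obtain ⟨i, -, rfl⟩ := Finset.mem_image.1 hh
    obtain ⟨j, -, rfl⟩ := Finset.mem_image.1 hh'
    rw [OctaGlue.hs_sep i j he]
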